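/- arXiv:2605.29544 — 2 statements merged into one kernel-verified Lean document; each statement's English description precedes it below -/
import Mathlib

section
/- Let (R,𝔪) be a Noetherian local ring and M a finitely generated R-module of finiteness dimension t > 0, with n_0 ≥ 1 such that 𝔪^{n_0} H^i_𝔪(M) = 0 for all i < t. For every standard sequence x_1,…,x_t on M and all s ≤ t, the limit closure satisfies (x_1,…,x_s)^{lim}_M = (x_1,…,x_s)M + Σ_{i=1}^s ((x_1,…,x̂_i,…,x_s)M :_M x_i). -/
universe u

open IsLocalRing

/-- The `i`-th local cohomology module `H^i_J(M)`. -/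
noncomputable def lcoh {R : Type u} [CommRing R] (J : Ideal R) (i : ℕ)
    (M : Type u) [AddCommGroup M] [Module R M] : ModuleCat.{u} R :=
  (localCohomology J i).obj (ModuleCat.of R M)

/-- `x` is a filter regular sequence on `M`. -/
def IsFilterRegularSeq {R : Type u} [CommRing R] (𝔪 : Ideal R)
    (M : Type u) [AddCommGroup M] [Module R M] {s : ℕ} (x : Fin s → R) : Prop :=
  ∀ i : Fin s, ∀ m : M,
    x i • m ∈ (Ideal.span (x '' {j | j < i}) • ⊤ : Submodule R M) →
      ∃ n : ℕ, ∀ r ∈ 𝔪 ^ n, r • m ∈ (Ideal.span (x '' {j | j < i}) • ⊤ : Submodule R M)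

/-- `x` is a standard sequence on `M`: a filter regular sequence with
`(x_1,…,x_s) ⬝ H^i_𝔪(M/(x_1,…,x_j)M) = 0` for all `i + j < s`. -/
def IsStandardSeq {R : Type u} [CommRing R] (𝔪 : Ideal R)
    (M : Type u) [AddCommGroup M] [Module R M] {s : ℕ} (x : Fin s → R) : Prop :=
  IsFilterRegularSeq 𝔪 M x ∧
    ∀ i j : ℕ, i + j < s →
      ∀ (a : lcoh 𝔪 i (M ⧸ (Ideal.span (x '' {l | (l : ℕ) < j}) • ⊤ : Submodule R M))),
        ∀ r ∈ Ideal.span (Set.range x), r • a = 0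

/-- The limit closure of the sequence `x_1, …, x_s` in `M`. -/
def limitClosure {R : Type u} [CommRing R] {s : ℕ} (x : Fin s → R)
    (M : Type u) [AddCommGroup M] [Module R M] : Submodule R M :=
  ⨆ n : ℕ, (Ideal.span (Set.range fun i => x i ^ (n + 2)) • (⊤ : Submodule R M)).comap
    ((∏ i, x i) ^ (n + 1) • (LinearMap.id : M →ₗ[R] M))

set_option linter.unusedSectionVars false

section Generic
open CategoryTheory CategoryTheory.Limits Opposite

universe v₁ u₁ v₂ u₂
variable {C : Type u₁} [Category.{v₁} C] [Abelian C] [EnoughProjectives C]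
  {D : Type u₂} [Category.{v₂} D] [Abelian D]

lemma gK_d {X : C} (P : ProjectiveResolution X) (F : C ⥤ D) [F.Additive] {I : D} {n m : ℕ}
    (q : F.obj (P.complex.X n) ⟶ I) (hq : F.map (P.complex.d m n) ≫ q = 0) :
    (((F.mapHomologicalComplex (ComplexShape.down ℕ)).obj P.complex).d m n) ≫
      (show ((F.mapHomologicalComplex (ComplexShape.down ℕ)).obj P.complex).X n ⟶ I from q) = 0 := hq

/-- descend a cocycle to the left derived functor -/
noncomputable def gdesc {X : C} (P : ProjectiveResolution X) (F : C ⥤ D) [F.Additive] {I : D} {n : ℕ}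
    (q : F.obj (P.complex.X n) ⟶ I) (hq : F.map (P.complex.d (n + 1) n) ≫ q = 0) :
    (F.leftDerived n).obj X ⟶ I :=
  (P.isoLeftDerivedObj F n).hom ≫
    ((F.mapHomologicalComplex (ComplexShape.down ℕ)).obj P.complex).homologyι n ≫
    ((F.mapHomologicalComplex (ComplexShape.down ℕ)).obj P.complex).descOpcycles
      (show ((F.mapHomologicalComplex (ComplexShape.down ℕ)).obj P.complex).X n ⟶ I from q)
      (n + 1) (by simp) (gK_d P F q hq)

lemma desc_comp_aux {K : ChainComplex D ℕ} {I I' : D} {n : ℕ} (q : K.X n ⟶ I)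
    (hq : K.d (n + 1) n ≫ q = 0) (w : I ⟶ I') (hq' : K.d (n + 1) n ≫ q ≫ w = 0) :
    K.homologyι n ≫ K.descOpcycles q (n + 1) (by simp) hq ≫ w =
     K.homologyι n ≫ K.descOpcycles (q ≫ w) (n + 1) (by simp) hq' := by
  congr 1
  rw [← cancel_epi (K.pOpcycles n)]
  simp

lemma gdesc_comp {X : C} (P : ProjectiveResolution X) (F : C ⥤ D) [F.Additive] {I I' : D} {n : ℕ}
    (q : F.obj (P.complex.X n) ⟶ I) (hq : F.map (P.complex.d (n + 1) n) ≫ q = 0) (w : I ⟶ I')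
    (hqw : F.map (P.complex.d (n + 1) n) ≫ q ≫ w = 0) :
    gdesc P F q hq ≫ w = gdesc P F (q ≫ w) hqw := by
  unfold gdesc
  rw [Category.assoc]
  congr 1
  exact (Category.assoc _ _ _).trans (desc_comp_aux
    (K := (F.mapHomologicalComplex (ComplexShape.down ℕ)).obj P.complex) q (gK_d P F q hq) w _)

lemma desc_nat_aux {K L : ChainComplex D ℕ} (ψ : K ⟶ L) {I : D} {n : ℕ} (q : L.X n ⟶ I)
    (hq : L.d (n + 1) n ≫ q = 0) (hq' : K.d (n + 1) n ≫ ψ.f n ≫ q = 0) :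
    HomologicalComplex.homologyMap ψ n ≫ L.homologyι n ≫ L.descOpcycles q (n + 1) (by simp) hq =
     K.homologyι n ≫ K.descOpcycles (ψ.f n ≫ q) (n + 1) (by simp) hq' := by
  rw [HomologicalComplex.homologyι_naturality_assoc]
  congr 1
  rw [← cancel_epi (K.pOpcycles n)]
  simp

lemma desc_zero_aux {K : ChainComplex D ℕ} {I : D} [Injective I] {n : ℕ} (q : K.X n ⟶ I)
    (hq : K.d (n + 1) n ≫ q = 0)
    (h : K.homologyι n ≫ K.descOpcycles q (n + 1) (by simp) hq = 0) :
    ∃ q' : K.X ((ComplexShape.down ℕ).next n) ⟶ I, K.d n _ ≫ q' = q := by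
  let S : ShortComplex D := ShortComplex.mk (K.homologyι n)
    (K.fromOpcycles n ((ComplexShape.down ℕ).next n)) (by simp)
  have hS : S.Exact := ShortComplex.exact_of_f_is_kernel _ (K.homologyIsKernel n _ rfl)
  refine ⟨hS.descToInjective _ h, ?_⟩
  have h1 := hS.comp_descToInjective _ h
  have h2 := congrArg (fun t => K.pOpcycles n ≫ t) h1
  simpa [S] using h2

lemma gdesc_zero {X : C} (P : ProjectiveResolution X) (F : C ⥤ D) [F.Additive] {I : D} [Injective I]
    {n : ℕ}
    (q : F.obj (P.complex.X n) ⟶ I) (hq : F.map (P.complex.d (n + 1) n) ≫ q = 0)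
    (h : gdesc P F q hq = 0) :
    ∃ q' : F.obj (P.complex.X ((ComplexShape.down ℕ).next n)) ⟶ I,
      F.map (P.complex.d n _) ≫ q' = q := by
  refine desc_zero_aux (K := (F.mapHomologicalComplex (ComplexShape.down ℕ)).obj P.complex)
    q (gK_d P F q hq) ?_
  exact (cancel_epi (P.isoLeftDerivedObj F n).hom).1 (h.trans comp_zero.symm)

lemma gdesc_nat {X X' : C} (α : X' ⟶ X) (P : ProjectiveResolution X) (P' : ProjectiveResolution X')
    (φ : P'.complex ⟶ P.complex) (comm : φ.f 0 ≫ P.π.f 0 = P'.π.f 0 ≫ α)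
    (F : C ⥤ D) [F.Additive] {I : D} {n : ℕ}
    (q : F.obj (P.complex.X n) ⟶ I) (hq : F.map (P.complex.d (n + 1) n) ≫ q = 0)
    (hq' : F.map (P'.complex.d (n + 1) n) ≫ F.map (φ.f n) ≫ q = 0) :
    (F.leftDerived n).map α ≫ gdesc P F q hq = gdesc P' F (F.map (φ.f n) ≫ q) hq' := by
  unfold gdesc
  rw [P'.isoLeftDerivedObj_hom_naturality_assoc α P φ comm F n]
  congr 1
  exact desc_nat_aux ((F.mapHomologicalComplex _).map φ) q (gK_d P F q hq) _
end Generic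

section Bridge
open CategoryTheory CategoryTheory.Limits Opposite

variable {R : Type u} [CommRing R]

/-- the functor whose left derived functors give Ext -/
noncomputable abbrev yF (Y : ModuleCat.{u} R) : ModuleCat.{u} R ⥤ (ModuleCat.{u} R)ᵒᵖ :=
  ((linearYoneda R (ModuleCat.{u} R)).obj Y).rightOp

/-- the morphism attached to an element -/
noncomputable def yphi {A Y : ModuleCat.{u} R} (f : A ⟶ Y) :
    (yF Y).obj A ⟶ op (ModuleCat.of R R) :=
  (ModuleCat.ofHom (LinearMap.toSpanSingleton R (A ⟶ Y) f) :
    ModuleCat.of R R ⟶ ModuleCat.of R (A ⟶ Y)).op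

lemma yphi_comp {A B Y : ModuleCat.{u} R} (f : A ⟶ Y) (g : B ⟶ A) :
    (yF Y).map g ≫ yphi f = yphi (g ≫ f) := by
  apply Quiver.Hom.unop_inj
  apply ModuleCat.hom_ext
  apply LinearMap.ext_ring
  change g ≫ ((1:R) • f) = (1:R) • (g ≫ f)
  simp

lemma yphi_zero {A Y : ModuleCat.{u} R} : yphi (0 : A ⟶ Y) = 0 := by
  apply Quiver.Hom.unop_inj
  apply ModuleCat.hom_ext
  apply LinearMap.ext_ring
  change (1:R) • (0 : A ⟶ Y) = 0
  simp

/-- multiplication by `r` -/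
noncomputable def ymul (r : R) : op (ModuleCat.of R R) ⟶ op (ModuleCat.of R R) :=
  (ModuleCat.ofHom (r • LinearMap.id : R →ₗ[R] R)).op

lemma yphi_smul {A Y : ModuleCat.{u} R} (f : A ⟶ Y) (r : R) :
    yphi f ≫ ymul r = yphi (r • f) := by
  apply Quiver.Hom.unop_inj
  apply ModuleCat.hom_ext
  apply LinearMap.ext_ring
  change (r • (1:R)) • f = (1:R) • (r • f)
  simp

lemma yphi_inj {A Y : ModuleCat.{u} R} {f g : A ⟶ Y} (h : yphi f = yphi g) : f = g := by
  have h2 := congrArg Quiver.Hom.unop h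
  have h3 := congrArg (fun k : ModuleCat.of R R ⟶ ModuleCat.of R (A ⟶ Y) => k.hom (1:R)) h2
  change (1:R) • f = (1:R) • g at h3
  simpa using h3

lemma yphi_surj {A Y : ModuleCat.{u} R} (q : (yF Y).obj A ⟶ op (ModuleCat.of R R)) :
    ∃ f : A ⟶ Y, yphi f = q := by
  let k : ModuleCat.of R R ⟶ ModuleCat.of R (A ⟶ Y) := q.unop
  refine ⟨k.hom (1:R), ?_⟩
  apply Quiver.Hom.unop_inj
  apply ModuleCat.hom_ext
  apply LinearMap.ext_ring
  change (1:R) • (k.hom (1:R)) = k.hom (1:R)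
  simp

instance : Projective (ModuleCat.of R R) :=
  (IsProjective.iff_projective (R := R) R).1 inferInstance

lemma yhf {X : ModuleCat.{u} R} (P : ProjectiveResolution X) {Y : ModuleCat.{u} R} {n : ℕ}
    (f : P.complex.X n ⟶ Y) (hf : P.complex.d (n+1) n ≫ f = 0) :
    (yF Y).map (P.complex.d (n+1) n) ≫ yphi f = 0 := by
  rw [yphi_comp, hf, yphi_zero]

/-- cocycle class -/
noncomputable def ydesc {X : ModuleCat.{u} R} (P : ProjectiveResolution X) {Y : ModuleCat.{u} R} {n : ℕ}
    (f : P.complex.X n ⟶ Y) (hf : P.complex.d (n+1) n ≫ f = 0) :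
    ((yF Y).leftDerived n).obj X ⟶ op (ModuleCat.of R R) :=
  gdesc P (yF Y) (yphi f) (yhf P f hf)

lemma ydesc_zero {X : ModuleCat.{u} R} (P : ProjectiveResolution X) {Y : ModuleCat.{u} R} {n : ℕ}
    (f : P.complex.X n ⟶ Y) (hf : P.complex.d (n+1) n ≫ f = 0) (h : ydesc P f hf = 0) :
    P.extMk f (n+1) rfl hf = 0 := by
  obtain ⟨q, hq⟩ := gdesc_zero P (yF Y) (yphi f) _ h
  obtain ⟨g, rfl⟩ := yphi_surj q
  rw [yphi_comp] at hq
  have h3 := yphi_inj hq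
  generalize hj : (ComplexShape.down ℕ).next n = j at g h3
  match n, f, hf, g, h3, hj with
  | 0, f, hf, g, h3, hj =>
    have : f = 0 := by 
      have : j = 0 := by rw [← hj]; simp
      subst this
      rw [← h3]; simp
    subst this
    simp
  | n+1, f, hf, g, h3, hj =>
    rw [P.extMk_eq_zero_iff f _ rfl hf n rfl]
    have hj : j = n := by rw [← hj]; simp
    subst hj
    exact ⟨g, h3⟩

lemma ydesc_nat {X X' : ModuleCat.{u} R} (α : X' ⟶ X) (P : ProjectiveResolution X) (P' : ProjectiveResolution X')
    {Y : ModuleCat.{u} R} {n : ℕ} (φ : P'.complex ⟶ P.complex)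
    (comm : φ.f 0 ≫ P.π.f 0 = P'.π.f 0 ≫ α)
    (f : P.complex.X n ⟶ Y) (hf : P.complex.d (n+1) n ≫ f = 0)
    (hf' : P'.complex.d (n+1) n ≫ φ.f n ≫ f = 0) :
    ((yF Y).leftDerived n).map α ≫ ydesc P f hf = ydesc P' (φ.f n ≫ f) hf' := by
  unfold ydesc
  rw [gdesc_nat α P P' φ comm]
  · congr 1
  · rw [yphi_comp, yphi_comp, hf', yphi_zero]

lemma ydesc_smul {X : ModuleCat.{u} R} (P : ProjectiveResolution X) {Y : ModuleCat.{u} R} {n : ℕ}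
    (f : P.complex.X n ⟶ Y) (hf : P.complex.d (n+1) n ≫ f = 0) (r : R)
    (hf' : P.complex.d (n+1) n ≫ (r • f) = 0) :
    ydesc P f hf ≫ ymul r = ydesc P (r • f) hf' := by
  unfold ydesc
  rw [gdesc_comp]
  · congr 1
    exact yphi_smul _ _
  · rw [yphi_smul, yphi_comp, hf', yphi_zero]

/-- the class of a cocycle in the old Ext -/
noncomputable def ycl {X : ModuleCat.{u} R} (P : ProjectiveResolution X) {Y : ModuleCat.{u} R} {n : ℕ}
    (f : P.complex.X n ⟶ Y) (hf : P.complex.d (n+1) n ≫ f = 0) :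
    ModuleCat.of R R ⟶ ((Ext R (ModuleCat.{u} R) n).obj (op X)).obj Y :=
  (ydesc P f hf).unop

lemma ycl_zero {X X' : ModuleCat.{u} R} (P : ProjectiveResolution X) {Y : ModuleCat.{u} R} {n : ℕ}
    (f : P.complex.X n ⟶ Y) (hf : P.complex.d (n+1) n ≫ f = 0) (α : X' ⟶ X) (r : R)
    (h : (((Ext R (ModuleCat.{u} R) n).map α.op).app Y).hom (r • (ycl P f hf).hom (1 : R)) = 0) :
    r • (Abelian.Ext.mk₀ α).comp (P.extMk f (n+1) rfl hf) (zero_add n) = 0 := by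
  let P' := projectiveResolution X'
  have comm : (ProjectiveResolution.lift α P' P).f 0 ≫ P.π.f 0 = P'.π.f 0 ≫ α := by
    have := ProjectiveResolution.lift_commutes_zero α P' P
    exact this
  let φ : ProjectiveResolution.Hom P' P α :=
    ⟨ProjectiveResolution.lift α P' P, by
      rw [comm]; congr 1⟩
  have h1 : ModuleCat.ofHom (r • LinearMap.id : R →ₗ[R] R) ≫ ycl P f hf ≫
      ((Ext R (ModuleCat.{u} R) n).map α.op).app Y = 0 := by
    apply ModuleCat.hom_ext
    apply LinearMap.ext_ring
    rw [← map_smul] at h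
    exact h
  have h2 : (((yF Y).leftDerived n).map α ≫ ydesc P f hf) ≫ ymul r = 0 := by
    have := congrArg Quiver.Hom.op h1
    exact this
  have h0 : P'.complex.d (n + 1) n ≫ φ.hom.f n ≫ f = 0 := by
    rw [← φ.hom.comm_assoc, hf, comp_zero]
  have h0' : P'.complex.d (n + 1) n ≫ (r • (φ.hom.f n ≫ f)) = 0 := by
    rw [Linear.comp_smul, h0, smul_zero]
  rw [ydesc_nat α P P' φ.hom comm f hf h0, ydesc_smul _ _ _ r h0'] at h2
  have h3 := ydesc_zero P' _ _ h2
  rw [ProjectiveResolution.mk₀_comp_extMk f _ rfl hf φ, Abelian.Ext.smul_eq_comp_mk₀,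
    ProjectiveResolution.extMk_comp_mk₀]
  rw [← h3]
  congr 1
end Bridge

section Bridge2
open CategoryTheory CategoryTheory.Limits Opposite

variable {R : Type u} [CommRing R]

/-- restriction `R/J^n' → R/J^n` -/
noncomputable def resq (J : Ideal R) {n n' : ℕ} (h : n ≤ n') :
    ModuleCat.of R (R ⧸ J ^ n') ⟶ ModuleCat.of R (R ⧸ J ^ n) :=
  ModuleCat.ofHom <| Submodule.mapQ _ _ LinearMap.id (Ideal.pow_le_pow_right h)

/-- `r` kills the `i`-th local cohomology -/
def Kill (J : Ideal R) (r : R) (i : ℕ) (N : ModuleCat.{u} R) : Prop :=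
  ∀ (n : ℕ) (e : Abelian.Ext (ModuleCat.of R (R ⧸ J ^ n)) N i),
    ∃ (n' : ℕ) (h : n ≤ n'), r • (Abelian.Ext.mk₀ (resq J h)).comp e (zero_add i) = 0

lemma kill_of_lcoh (J : Ideal R) (r : R) (i : ℕ) (N : Type u) [AddCommGroup N] [Module R N]
    (h : ∀ a : lcoh J i N, r • a = 0) : Kill J r i (ModuleCat.of R N) := by
  intro n e
  let P := projectiveResolution (ModuleCat.of R (R ⧸ J ^ n))
  obtain ⟨f, hf, rfl⟩ := P.extMk_surjective e (i+1) rfl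
  let F := localCohomology.diagram (localCohomology.idealPowersDiagram J) i
  have hc := isColimitOfPreserves ((evaluation (ModuleCat.{u} R) (ModuleCat.{u} R)).obj (ModuleCat.of R N))
    (colimit.isColimit F)
  let G := F ⋙ (evaluation (ModuleCat.{u} R) (ModuleCat.{u} R)).obj (ModuleCat.of R N)
  have : PreservesFilteredColimitsOfSize.{0, 0} (forget (ModuleCat.{u} R)) :=
    preservesFilteredColimitsOfSize_of_univLE.{u, u} _
  have : PreservesColimit G (forget (ModuleCat.{u} R)) := 
    (PreservesFilteredColimitsOfSize.preserves_filtered_colimits (F := forget (ModuleCat.{u} R))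
      ((ℕᵒᵖ)ᵒᵖ)).preservesColimit
  let a : G.obj (op (op n)) := (ycl P f hf).hom (1:R)
  have h1 := h (((colimit.ι F (op (op n))).app (ModuleCat.of R N)).hom a)
  have h2 : ((colimit.ι F (op (op n))).app (ModuleCat.of R N)).hom (r • a) = 
    ((colimit.ι F (op (op n))).app (ModuleCat.of R N)).hom (0 : G.obj (op (op n))) := by
    rw [map_zero, map_smul]; exact h1
  obtain ⟨k, f1, g1, h3⟩ := Concrete.isColimit_exists_of_rep_eq G hc (r • a) (0 : G.obj (op (op n))) h2
  refine ⟨k.unop.unop, f1.unop.unop.down.down, ?_⟩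
  apply ycl_zero
  have h4 : (G.map f1).hom (r • a) = 0 := by
    have : (G.map g1).hom (0 : G.obj (op (op n))) = 0 := map_zero _
    exact h3.trans this
  exact h4
end Bridge2

section WV
open CategoryTheory CategoryTheory.Limits Opposite

variable {R : Type u} [CommRing R]

/-- restriction of an Ext class -/
noncomputable def rs {A' A N : ModuleCat.{u} R} (g : A' ⟶ A) {i : ℕ} (e : Abelian.Ext A N i) :
    Abelian.Ext A' N i := (Abelian.Ext.mk₀ g).comp e (zero_add i)

lemma rs_rs {A'' A' A N : ModuleCat.{u} R} (h : A'' ⟶ A') (g : A' ⟶ A) {i : ℕ} (e : Abelian.Ext A N i) :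
    rs h (rs g e) = rs (h ≫ g) e := by
  simp [rs]

lemma rs_comp {A' A N Q : ModuleCat.{u} R} (g : A' ⟶ A) {i j k : ℕ} (e : Abelian.Ext A N i)
    (f : Abelian.Ext N Q j) (h : i + j = k) : rs g (e.comp f h) = (rs g e).comp f h := by
  unfold rs
  rw [Abelian.Ext.comp_assoc]
  lia

lemma rs_zero {A' A N : ModuleCat.{u} R} (g : A' ⟶ A) {i : ℕ} :
    rs g (0 : Abelian.Ext A N i) = 0 := by simp [rs]

lemma rs_sub {A' A N : ModuleCat.{u} R} (g : A' ⟶ A) {i : ℕ} (e f : Abelian.Ext A N i) :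
    rs g (e - f) = rs g e - rs g f := by
  rw [sub_eq_add_neg, sub_eq_add_neg]; simp [rs]

lemma rs_smul {A' A N : ModuleCat.{u} R} (g : A' ⟶ A) {i : ℕ} (r : R) (e : Abelian.Ext A N i) :
    rs g (r • e) = r • rs g e := by simp [rs]

lemma ext_step {S S' : ShortComplex (ModuleCat.{u} R)} (hS : S.ShortExact) (hS' : S'.ShortExact)
    (φ : S' ⟶ S) {K : ModuleCat.{u} R} {i : ℕ} (e : Abelian.Ext S.X₁ K i)
    (h : rs φ.τ₁ e = 0) : rs φ.τ₃ (hS.extClass.comp e (add_comm 1 i)) = 0 := by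
  rw [rs_comp]
  have := ShortComplex.ShortExact.extClass_naturality hS' hS φ
  unfold rs
  rw [← this, Abelian.Ext.comp_assoc_of_second_deg_zero]
  unfold rs at h
  rw [h, Abelian.Ext.comp_zero]

lemma lem_W [IsNoetherianRing R] (J : Ideal R) (k : ℕ) (K : ModuleCat.{u} R)
    (hK : ∀ r ∈ J ^ k, ∀ m : K, r • m = 0) (i : ℕ) :
    ∀ (A : Type u) [AddCommGroup A] [Module R A] [Module.Finite R A]
      (e : Abelian.Ext (ModuleCat.of R A) K i),
    ∃ c : ℕ, ∀ (A' : Type u) [AddCommGroup A'] [Module R A'] (g : A' →ₗ[R] A),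
      (∀ a, g a ∈ (J ^ c • ⊤ : Submodule R A)) → rs (ModuleCat.ofHom g) e = 0 := by
  induction i with
  | zero =>
    intro A _ _ _ e
    refine ⟨k, fun A' _ _ g hg => ?_⟩
    obtain ⟨f, rfl⟩ := (Abelian.Ext.mk₀_bijective (ModuleCat.of R A) K).2 e
    have : ModuleCat.ofHom g ≫ f = 0 := by
      ext a
      change f.hom (g a) = 0
      have h1 : (J ^ k • ⊤ : Submodule R A) ≤ LinearMap.ker f.hom := by
        rw [Submodule.smul_le]
        intro r hr n _
        rw [LinearMap.mem_ker, map_smul]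
        exact hK r hr _
      exact h1 (hg a)
    simp [rs, this]
  | succ i ih =>
    intro A _ _ _ e
    obtain ⟨n, p, hp⟩ := Module.Finite.exists_fin' R A
    have hS := LinearMap.shortExact_shortComplexKer hp
    have : Projective (ModuleCat.of R (Fin n → R)) :=
      (IsProjective.iff_projective (R := R) (Fin n → R)).1 inferInstance
    obtain ⟨e', he'⟩ := Abelian.Ext.contravariant_sequence_exact₃ hS K e
      (Abelian.Ext.eq_zero_of_projective (P := ModuleCat.of R (Fin n → R)) _) (add_comm 1 i)
    obtain ⟨c', hc'⟩ := ih (LinearMap.ker p) e'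
    obtain ⟨k', hk'⟩ := Ideal.exists_pow_inf_eq_pow_smul J (LinearMap.ker p)
    refine ⟨k' + c', fun A' _ _ g hg => ?_⟩
    let p' : (J ^ (k' + c') • ⊤ : Submodule R (Fin n → R)) →ₗ[R] (J ^ (k' + c') • ⊤ : Submodule R A) :=
      p.restrict (fun a ha => by
        have : p a ∈ (J ^ (k' + c') • ⊤ : Submodule R (Fin n → R)).map p := ⟨a, ha, rfl⟩
        rw [Submodule.map_smul''] at this
        exact Submodule.smul_mono le_rfl le_top this)
    have hp' : Function.Surjective p' := by
      rintro ⟨a, ha⟩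
      have : (J ^ (k' + c') • ⊤ : Submodule R A) ≤ (J ^ (k' + c') • ⊤ : Submodule R (Fin n → R)).map p := by
        rw [Submodule.map_smul'', Submodule.map_top, LinearMap.range_eq_top.2 hp]
      obtain ⟨b, hb, hb'⟩ := this ha
      exact ⟨⟨b, hb⟩, Subtype.ext hb'⟩
    have hS' := LinearMap.shortExact_shortComplexKer hp'
    let q : LinearMap.ker p' →ₗ[R] LinearMap.ker p :=
      LinearMap.codRestrict _ ((Submodule.subtype _).comp (Submodule.subtype _)) (fun a => by
        have := a.2
        rw [LinearMap.mem_ker] at this ⊢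
        exact congrArg Subtype.val this)
    let φ : p'.shortComplexKer ⟶ p.shortComplexKer :=
      { τ₁ := ModuleCat.ofHom q
        τ₂ := ModuleCat.ofHom (Submodule.subtype _)
        τ₃ := ModuleCat.ofHom (Submodule.subtype _) }
    have h1 : rs φ.τ₃ e = 0 := by
      rw [← he']
      apply ext_step hS hS' φ
      apply hc'
      intro a
      have h2 : (q a : Fin n → R) ∈ (J ^ (k' + c') • ⊤ ⊓ LinearMap.ker p : Submodule R (Fin n → R)) :=
        ⟨a.1.2, (q a).2⟩
      rw [hk' _ (Nat.le_add_right _ _), Nat.add_sub_cancel_left] at h2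
      have h3 := (Submodule.smul_mono (le_refl (J ^ c'))
        (inf_le_right : (J ^ k' • ⊤ ⊓ LinearMap.ker p) ≤ LinearMap.ker p)) h2
      have h4 : J ^ c' • LinearMap.ker p = (J ^ c' • (⊤ : Submodule R (LinearMap.ker p))).map (Submodule.subtype _) := by
        rw [Submodule.map_smul'', Submodule.map_top, Submodule.range_subtype]
      rw [h4] at h3
      obtain ⟨b, hb, hb'⟩ := h3
      have : b = q a := Subtype.ext hb'
      rwa [← this]
    let g' : A' →ₗ[R] (J ^ (k' + c') • ⊤ : Submodule R A) := LinearMap.codRestrict _ g hg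
    have h5 : ModuleCat.ofHom g = ModuleCat.ofHom g' ≫ φ.τ₃ := by
      ext a; rfl
    rw [h5]
    have := congrArg (rs (ModuleCat.ofHom g')) h1
    rw [rs_rs, rs_zero] at this
    exact this

lemma lem_V [IsNoetherianRing R] (J : Ideal R) (k : ℕ) (K : ModuleCat.{u} R)
    (hK : ∀ r ∈ J ^ k, ∀ m : K, r • m = 0) (i : ℕ) (n : ℕ)
    (e : Abelian.Ext (ModuleCat.of R (R ⧸ J ^ n)) K (i + 1)) :
    ∃ (n' : ℕ) (h : n ≤ n'), rs (resq J h) e = 0 := by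
  have hS (n : ℕ) := LinearMap.shortExact_shortComplexKer (Submodule.mkQ_surjective (J ^ n))
  obtain ⟨e', he'⟩ := Abelian.Ext.contravariant_sequence_exact₃ (hS n) K e
      (Abelian.Ext.eq_zero_of_projective (P := ModuleCat.of R R) _) (add_comm 1 i)
  obtain ⟨c, hc⟩ := lem_W J k K hK i (LinearMap.ker (Submodule.mkQ (J ^ n))) e'
  refine ⟨c + n, Nat.le_add_left _ _, ?_⟩
  let q : LinearMap.ker (Submodule.mkQ (J ^ (c + n))) →ₗ[R] LinearMap.ker (Submodule.mkQ (J ^ n)) :=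
    LinearMap.codRestrict _ (Submodule.subtype _) (fun a => by
        rw [Submodule.ker_mkQ]
        exact Ideal.pow_le_pow_right (Nat.le_add_left _ _)
          ((Submodule.ker_mkQ (J ^ (c + n))).le a.2))
  let φ : (Submodule.mkQ (J ^ (c + n))).shortComplexKer ⟶ (Submodule.mkQ (J ^ n)).shortComplexKer :=
      { τ₁ := ModuleCat.ofHom q
        τ₂ := ModuleCat.ofHom LinearMap.id
        τ₃ := resq J (Nat.le_add_left _ _) }
  rw [← he']
  apply ext_step (hS n) (hS (c + n)) φ
  apply hc
  intro a
  have h2 : (q a : R) ∈ J ^ (c + n) := by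
    exact (Submodule.ker_mkQ (J ^ (c + n))).le a.2
  have h5 : J ^ (c + n) = J ^ c • J ^ n := by rw [pow_add, smul_eq_mul]
  have h2 := h5.le h2
  have h4 : J ^ c • J ^ n = (J ^ c • (⊤ : Submodule R (LinearMap.ker (Submodule.mkQ (J ^ n))))).map (Submodule.subtype _) := by
    rw [Submodule.map_smul'', Submodule.map_top, Submodule.range_subtype, Submodule.ker_mkQ]
  have h2 := h4.le h2
  obtain ⟨b, hb, hb'⟩ := h2
  have : b = q a := Subtype.ext hb'
  rwa [← this]
end WV

section IES
open CategoryTheory CategoryTheory.Limits Opposite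

variable {R : Type u} [CommRing R]

lemma resq_trans (J : Ideal R) {n n' n'' : ℕ} (h : n ≤ n') (h' : n' ≤ n'') :
    resq J h' ≫ resq J h = resq J (h.trans h') := by
  apply ModuleCat.hom_ext
  apply LinearMap.ext
  intro x
  obtain ⟨x, rfl⟩ := Submodule.mkQ_surjective _ x
  rfl

lemma rq_rq (J : Ideal R) {n n' n'' : ℕ} (h : n ≤ n') (h' : n' ≤ n'') {N : ModuleCat.{u} R} {i : ℕ}
    (e : Abelian.Ext (ModuleCat.of R (R ⧸ J ^ n)) N i) :
    rs (resq J h') (rs (resq J h) e) = rs (resq J (h.trans h')) e := by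
  rw [rs_rs, resq_trans]

/-- composition with a morphism -/
noncomputable def ps {A N Q : ModuleCat.{u} R} (f : N ⟶ Q) {i : ℕ} (e : Abelian.Ext A N i) :
    Abelian.Ext A Q i := e.comp (Abelian.Ext.mk₀ f) (add_zero i)

lemma rs_ps {A' A N Q : ModuleCat.{u} R} (g : A' ⟶ A) (f : N ⟶ Q) {i : ℕ} (e : Abelian.Ext A N i) :
    rs g (ps f e) = ps f (rs g e) := rs_comp _ _ _ _

lemma ps_ps {A N Q Q' : ModuleCat.{u} R} (f : N ⟶ Q) (g : Q ⟶ Q') {i : ℕ} (e : Abelian.Ext A N i) :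
    ps g (ps f e) = ps (f ≫ g) e := by
  simp [ps]

lemma ps_zero {A N Q : ModuleCat.{u} R} (f : N ⟶ Q) {i : ℕ} :
    ps f (0 : Abelian.Ext A N i) = 0 := by simp [ps]

lemma ps_smul {A N Q : ModuleCat.{u} R} (f : N ⟶ Q) {i : ℕ} (r : R) (e : Abelian.Ext A N i) :
    ps f (r • e) = r • ps f e := by simp [ps]

lemma ps_sub {A N Q : ModuleCat.{u} R} (f : N ⟶ Q) {i : ℕ} (e e' : Abelian.Ext A N i) :
    ps f (e - e') = ps f e - ps f e' := by
  rw [sub_eq_add_neg, sub_eq_add_neg]; simp [ps]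

lemma ps_smul_id {A N : ModuleCat.{u} R} {i : ℕ} (r : R) (e : Abelian.Ext A N i) :
    ps (r • 𝟙 N) e = r • e := by
  simp [ps, Abelian.Ext.mk₀_smul]

variable [IsNoetherianRing R] (J : Ideal R) {N Q : Type u} [AddCommGroup N] [Module R N]
  [Module.Finite R N] [AddCommGroup Q] [Module R Q] (y : R) (π : N →ₗ[R] Q)

/-- hypotheses: `y` is filter regular on `N` and `Q = N/yN` -/
structure QD : Prop where
  fr : ∀ m : N, y • m = 0 → ∃ k, ∀ r ∈ J ^ k, r • m = 0
  surj : Function.Surjective π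
  ker : ∀ m : N, π m = 0 ↔ ∃ m', m = y • m'

lemma unif_ann (K : Type u) [AddCommGroup K] [Module R K] [Module.Finite R K]
    (h : ∀ m : K, ∃ k, ∀ r ∈ J ^ k, r • m = 0) : ∃ k, ∀ r ∈ J ^ k, ∀ m : K, r • m = 0 := by
  obtain ⟨s, hs⟩ := (Module.Finite.fg_top : (⊤ : Submodule R K).FG)
  choose k hk using h
  refine ⟨s.sup k, fun r hr m => ?_⟩
  have : (⊤ : Submodule R K) ≤ LinearMap.ker (r • (LinearMap.id : K →ₗ[R] K)) := by
    rw [← hs, Submodule.span_le]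
    intro x hx
    exact hk x r (Ideal.pow_le_pow_right (Finset.le_sup hx) hr)
  exact this (Submodule.mem_top (x := m))

variable {J y π}

/-- multiplication onto `ker π` -/
def QD.p (h : QD J y π) : N →ₗ[R] LinearMap.ker π :=
  LinearMap.codRestrict _ (y • LinearMap.id) (fun m => (h.ker _).2 ⟨m, rfl⟩)

lemma QD.p_surj (h : QD J y π) : Function.Surjective h.p := by
  rintro ⟨m, hm⟩
  obtain ⟨m', rfl⟩ := (h.ker _).1 hm
  exact ⟨m', rfl⟩

lemma QD.p_comp (h : QD J y π) :
    ModuleCat.ofHom h.p ≫ ModuleCat.ofHom (LinearMap.ker π).subtype = y • 𝟙 (ModuleCat.of R N) := by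
  ext m; rfl

lemma QD.ezK (h : QD J y π) (i n : ℕ)
    (e : Abelian.Ext (ModuleCat.of R (R ⧸ J ^ n)) (ModuleCat.of R (LinearMap.ker h.p)) (i + 1)) :
    ∃ (n' : ℕ) (hn : n ≤ n'), rs (resq J hn) e = 0 := by
  obtain ⟨k, hk⟩ := unif_ann J (LinearMap.ker h.p) (fun m => by
    obtain ⟨k, hk⟩ := h.fr m.1 (congrArg Subtype.val m.2)
    exact ⟨k, fun r hr => Subtype.ext (hk r hr)⟩)
  exact lem_V J k _ hk i n e

lemma QD.liftp (h : QD J y π) (i n : ℕ)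
    (e : Abelian.Ext (ModuleCat.of R (R ⧸ J ^ n)) (ModuleCat.of R (LinearMap.ker π)) i) :
    ∃ (n' : ℕ) (hn : n ≤ n') (w : Abelian.Ext (ModuleCat.of R (R ⧸ J ^ n')) (ModuleCat.of R N) i),
      rs (resq J hn) e = ps (ModuleCat.ofHom h.p) w := by
  have hS := LinearMap.shortExact_shortComplexKer h.p_surj
  obtain ⟨n', hn, h1⟩ := h.ezK i n (e.comp hS.extClass rfl)
  rw [rs_comp] at h1
  obtain ⟨w, hw⟩ := Abelian.Ext.covariant_sequence_exact₃ _ hS _ rfl h1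
  exact ⟨n', hn, w, hw.symm⟩

lemma QD.inj (h : QD J y π) {i n : ℕ} (hk : Kill J y i (ModuleCat.of R N))
    (e : Abelian.Ext (ModuleCat.of R (R ⧸ J ^ n)) (ModuleCat.of R N) i)
    (he : ∃ (n' : ℕ) (hn : n ≤ n'), rs (resq J hn) (ps (ModuleCat.ofHom π) e) = 0) :
    ∃ (n' : ℕ) (hn : n ≤ n'), rs (resq J hn) e = 0 := by
  obtain ⟨n1, hn1, h1⟩ := he
  rw [rs_ps] at h1
  have hS := LinearMap.shortExact_shortComplexKer h.surj
  obtain ⟨e1, he1⟩ := Abelian.Ext.covariant_sequence_exact₂ _ hS _ h1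
  obtain ⟨n2, hn2, w, hw⟩ := h.liftp i n1 e1
  obtain ⟨n3, hn3, h3⟩ := hk n2 w
  refine ⟨n3, (hn1.trans hn2).trans hn3, ?_⟩
  rw [← rq_rq J (hn1.trans hn2) hn3, ← rq_rq J hn1 hn2, ← he1]
  change rs _ (rs _ (ps (ModuleCat.ofHom (LinearMap.ker π).subtype) e1)) = 0
  rw [rs_ps, hw, ps_ps, h.p_comp, ps_smul_id, rs_smul]
  exact h3

lemma QD.ex (h : QD J y π) {i n : ℕ} {a : R} (hk : Kill J a (i + 1) (ModuleCat.of R N))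
    (z : Abelian.Ext (ModuleCat.of R (R ⧸ J ^ n)) (ModuleCat.of R Q) i) :
    ∃ (n' : ℕ) (hn : n ≤ n') (v : Abelian.Ext (ModuleCat.of R (R ⧸ J ^ n')) (ModuleCat.of R N) i),
      a • rs (resq J hn) z = ps (ModuleCat.ofHom π) v := by
  have hS := LinearMap.shortExact_shortComplexKer h.surj
  obtain ⟨n1, hn1, w, hw⟩ := h.liftp (i + 1) n (z.comp hS.extClass rfl)
  obtain ⟨n2, hn2, h2⟩ := hk n1 w
  refine ⟨n2, hn1.trans hn2, ?_⟩
  have h3 : (a • rs (resq J (hn1.trans hn2)) z).comp hS.extClass rfl = 0 := by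
    rw [Abelian.Ext.smul_comp, ← rs_comp, ← rq_rq J hn1 hn2]
    erw [hw]
    rw [rs_ps, ← ps_smul]
    erw [h2]
    exact ps_zero _
  obtain ⟨v, hv⟩ := Abelian.Ext.covariant_sequence_exact₃ _ hS _ rfl h3
  exact ⟨v, hv.symm⟩

lemma QD.sur (h : QD J y π) {i : ℕ} {a : R} (hy : Kill J y (i + 1) (ModuleCat.of R N))
    (ha : Kill J a i (ModuleCat.of R Q)) : Kill J a (i + 1) (ModuleCat.of R N) := by
  intro n w
  have hS := LinearMap.shortExact_shortComplexKer h.surj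
  have hS1 := LinearMap.shortExact_shortComplexKer h.p_surj
  obtain ⟨n1, hn1, h1⟩ := hy n w
  have h2 : ps (ModuleCat.ofHom (LinearMap.ker π).subtype)
      (ps (ModuleCat.ofHom h.p) (rs (resq J hn1) w)) = 0 := by
    rw [ps_ps, h.p_comp, ps_smul_id]; exact h1
  obtain ⟨z, hz⟩ := Abelian.Ext.covariant_sequence_exact₁ _ hS _ h2 rfl
  obtain ⟨n2, hn2, h3⟩ := ha n1 z
  have h4 : ps (ModuleCat.ofHom h.p) (a • rs (resq J (hn1.trans hn2)) w) = 0 := by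
    rw [ps_smul, ← rq_rq J hn1 hn2, ← rs_ps, ← hz, rs_comp, ← Abelian.Ext.smul_comp]
    have h3' : a • rs (resq J hn2) z = 0 := h3
    rw [h3', Abelian.Ext.zero_comp]
  obtain ⟨e, he⟩ := Abelian.Ext.covariant_sequence_exact₂ _ hS1 _ h4
  obtain ⟨n3, hn3, h5⟩ := h.ezK i n2 e
  refine ⟨n3, (hn1.trans hn2).trans hn3, ?_⟩
  change a • rs _ _ = 0
  rw [← rq_rq J (hn1.trans hn2) hn3, ← rs_smul, ← he]
  change rs _ (ps (ModuleCat.ofHom (LinearMap.ker h.p).subtype) e) = 0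
  rw [rs_ps, h5, ps_zero]
end IES

section Elem
open CategoryTheory

variable {R : Type u} [CommRing R] [IsNoetherianRing R] (J : Ideal R)
  {M : Type u} [AddCommGroup M] [Module R M] [Module.Finite R M]

/-- `U : J^∞` -/
def satU (U : Submodule R M) : Submodule R M where
  carrier := {m | ∃ k, ∀ r ∈ J ^ k, r • m ∈ U}
  zero_mem' := ⟨0, fun r _ => by simp⟩
  add_mem' := by
    rintro a b ⟨k, hk⟩ ⟨l, hl⟩
    refine ⟨k + l, fun r hr => ?_⟩
    rw [smul_add]
    exact U.add_mem (hk r (Ideal.pow_le_pow_right (Nat.le_add_right _ _) hr))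
      (hl r (Ideal.pow_le_pow_right (Nat.le_add_left _ _) hr))
  smul_mem' := by
    rintro c a ⟨k, hk⟩
    refine ⟨k, fun r hr => ?_⟩
    rw [smul_comm]
    exact U.smul_mem _ (hk r hr)

lemma le_satU (U : Submodule R M) : U ≤ satU J U := fun m hm => ⟨0, fun _ _ => U.smul_mem _ hm⟩

lemma satU_mono {U V : Submodule R M} (h : U ≤ V) : satU J U ≤ satU J V :=
  fun _ ⟨k, hk⟩ => ⟨k, fun r hr => h (hk r hr)⟩

variable {J}

lemma mem_satU_of {U : Submodule R M} {m : M} (k : ℕ) (h : ∀ r ∈ J ^ k, r • m ∈ satU J U) :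
    m ∈ satU J U := by
  have h1 : ∀ z : (J ^ k • Submodule.span R {m} : Submodule R M).map (Submodule.mkQ U),
      ∃ l, ∀ r ∈ J ^ l, r • z = 0 := by
    rintro ⟨_, z, hz, rfl⟩
    have : (J ^ k • Submodule.span R {m} : Submodule R M) ≤ satU J U := by
      rw [Submodule.smul_le]
      intro r hr n hn
      obtain ⟨c, rfl⟩ := Submodule.mem_span_singleton.1 hn
      rw [smul_comm]
      exact Submodule.smul_mem _ _ (h r hr)
    obtain ⟨l, hl⟩ := this hz
    refine ⟨l, fun r hr => Subtype.ext ?_⟩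
    change r • (Submodule.mkQ U z) = 0
    rw [← map_smul, Submodule.mkQ_apply, Submodule.Quotient.mk_eq_zero]
    exact hl r hr
  obtain ⟨l, hl⟩ := unif_ann J ((J ^ k • Submodule.span R {m} : Submodule R M).map (Submodule.mkQ U)) h1
  refine ⟨l + k, ?_⟩
  have : J ^ (l + k) ≤ (Submodule.comap (LinearMap.toSpanSingleton R M m) U : Submodule R R) := by
    rw [pow_add, Ideal.mul_le]
    intro r hr s hs
    change (r * s) • m ∈ U
    have := hl r hr ⟨Submodule.mkQ U (s • m), s • m,
      Submodule.smul_mem_smul hs (Submodule.mem_span_singleton_self m), rfl⟩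
    have := congrArg Subtype.val this
    change r • (Submodule.mkQ U (s • m)) = 0 at this
    rwa [← map_smul, Submodule.mkQ_apply, Submodule.Quotient.mk_eq_zero, ← mul_smul] at this
  exact this

/-- `yM` -/
def ym (M : Type u) [AddCommGroup M] [Module R M] (y : R) : Submodule R M :=
  LinearMap.range (y • (LinearMap.id : M →ₗ[R] M))

lemma mem_ym {y : R} {m : M} : m ∈ ym M y ↔ ∃ b, y • b = m := Iff.rfl

lemma smul_mem_ym (y : R) (m : M) : y • m ∈ ym M y := ⟨m, rfl⟩

lemma mem_sup_ym {U : Submodule R M} {y : R} {m : M} :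
    m ∈ U ⊔ ym M y ↔ ∃ u ∈ U, ∃ b, u + y • b = m := by
  rw [Submodule.mem_sup]
  constructor
  · rintro ⟨u, hu, _, ⟨b, rfl⟩, rfl⟩
    exact ⟨u, hu, b, rfl⟩
  · rintro ⟨u, hu, b, rfl⟩
    exact ⟨u, hu, _, ⟨b, rfl⟩, rfl⟩

/-- filter regularity -/
def FR (J : Ideal R) (U : Submodule R M) (y : R) : Prop := ∀ m, y • m ∈ U → m ∈ satU J U

lemma FR.sat {U : Submodule R M} {y : R} (h : FR J U y) {m : M} (hm : y • m ∈ satU J U) :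
    m ∈ satU J U := by
  obtain ⟨k, hk⟩ := hm
  refine mem_satU_of k fun r hr => h _ ?_
  rw [smul_comm]
  exact hk r hr

lemma FR.pow {U : Submodule R M} {y : R} (h : FR J U y) (n : ℕ) : FR J U (y ^ n) := by
  induction n with
  | zero => intro m hm; rw [pow_zero, one_smul] at hm; exact le_satU _ _ hm
  | succ n ih =>
    intro m hm
    rw [pow_succ, mul_smul] at hm
    exact h.sat (ih _ hm)

lemma FR.qd {U U' : Submodule R M} {y : R} (h : FR J U y) (hU : U ≤ U') (hU' : U' = U ⊔ ym M y) :
    QD J y (Submodule.factor hU) where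
  fr := by
    intro m hm
    obtain ⟨m, rfl⟩ := Submodule.mkQ_surjective _ m
    rw [← map_smul, Submodule.mkQ_apply, Submodule.Quotient.mk_eq_zero] at hm
    obtain ⟨k, hk⟩ := h m hm
    refine ⟨k, fun r hr => ?_⟩
    rw [← map_smul, Submodule.mkQ_apply, Submodule.Quotient.mk_eq_zero]
    exact hk r hr
  surj := Submodule.factor_surjective hU
  ker := by
    intro m
    obtain ⟨m, rfl⟩ := Submodule.mkQ_surjective _ m
    rw [Submodule.factor_mk, Submodule.mkQ_apply, Submodule.Quotient.mk_eq_zero, Submodule.mkQ_apply, hU', mem_sup_ym]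
    constructor
    · rintro ⟨u, hu, b, rfl⟩
      refine ⟨Submodule.Quotient.mk b, ?_⟩
      rw [← Submodule.Quotient.mk_smul, Submodule.Quotient.eq]
      simpa using hu
    · rintro ⟨b, hb⟩
      obtain ⟨b, rfl⟩ := Submodule.mkQ_surjective _ b
      rw [← map_smul, Submodule.mkQ_apply, Submodule.Quotient.eq] at hb
      exact ⟨_, hb, b, by simp⟩

/-- the degree zero class -/
noncomputable def c0 {N : Type u} [AddCommGroup N] [Module R N] (n : ℕ) (m : N) (hm : ∀ r ∈ J ^ n, r • m = 0) :
    ModuleCat.of R (R ⧸ J ^ n) ⟶ ModuleCat.of R N :=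
  ModuleCat.ofHom (Submodule.liftQ (J ^ n) (LinearMap.toSpanSingleton R N m) hm)

lemma c0_one {N : Type u} [AddCommGroup N] [Module R N] (n n' : ℕ) (hn : n ≤ n') (m : N)
    (hm : ∀ r ∈ J ^ n, r • m = 0) :
    (resq J hn ≫ c0 n m hm).hom (Submodule.Quotient.mk (1:R)) = m := by
  change (1:R) • m = m
  simp

lemma kill0 {U : Submodule R M} {a : R} (h : Kill J a 0 (ModuleCat.of R (M ⧸ U))) {m : M}
    (hm : m ∈ satU J U) : a • m ∈ U := by
  obtain ⟨k, hk⟩ := hm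
  have hk' : ∀ r ∈ J ^ k, r • (Submodule.Quotient.mk m : M ⧸ U) = 0 := fun r hr => by
    rw [← Submodule.Quotient.mk_smul, Submodule.Quotient.mk_eq_zero]; exact hk r hr
  obtain ⟨n', hn, h1⟩ := h k (Abelian.Ext.mk₀ (c0 k _ hk'))
  rw [Abelian.Ext.mk₀_comp_mk₀, ← Abelian.Ext.mk₀_smul, Abelian.Ext.mk₀_eq_zero_iff] at h1
  have h2 := congrArg (fun f => f.hom (Submodule.Quotient.mk (1:R))) h1
  have h3 : a • (resq J hn ≫ c0 k _ hk').hom (Submodule.Quotient.mk (1:R)) = 0 := h2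
  rw [c0_one] at h3
  rwa [← Submodule.Quotient.mk_smul, Submodule.Quotient.mk_eq_zero] at h3

lemma ex0 {U : Submodule R M} {a y : R} (hf : FR J U y) (h : Kill J a 1 (ModuleCat.of R (M ⧸ U))) {m : M}
    (hm : m ∈ satU J (U ⊔ ym M y)) : ∃ m' ∈ satU J U, a • m - m' ∈ U ⊔ ym M y := by
  obtain ⟨k, hk⟩ := hm
  have hk' : ∀ r ∈ J ^ k, r • (Submodule.Quotient.mk m : M ⧸ (U ⊔ ym M y)) = 0 := fun r hr => by
    rw [← Submodule.Quotient.mk_smul, Submodule.Quotient.mk_eq_zero]; exact hk r hr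
  obtain ⟨n', hn, v, hv⟩ := (hf.qd le_sup_left rfl).ex h (Abelian.Ext.mk₀ (c0 k _ hk'))
  obtain ⟨f, rfl⟩ := (Abelian.Ext.mk₀_bijective _ _).2 v
  unfold rs ps at hv
  rw [Abelian.Ext.mk₀_comp_mk₀, ← Abelian.Ext.mk₀_smul, Abelian.Ext.mk₀_comp_mk₀] at hv
  have hv := (Abelian.Ext.mk₀_bijective _ _).1 hv
  have h2 := congrArg (fun f => f.hom (Submodule.Quotient.mk (1:R))) hv
  have h3 : a • (resq J hn ≫ c0 k _ hk').hom (Submodule.Quotient.mk (1:R)) =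
    Submodule.factor le_sup_left (f.hom (Submodule.Quotient.mk (1:R))) := h2
  rw [c0_one] at h3
  obtain ⟨m', hm'⟩ := Submodule.mkQ_surjective _ (f.hom (Submodule.Quotient.mk (1:R)))
  refine ⟨m', ⟨n', fun r hr => ?_⟩, ?_⟩
  · rw [← Submodule.Quotient.mk_eq_zero U, ← Submodule.mkQ_apply, map_smul, hm', ← map_smul,
      ← Submodule.Quotient.mk_smul]
    have : (Submodule.Quotient.mk (r • (1:R)) : R ⧸ J ^ n') = 0 := by
      rw [Submodule.Quotient.mk_eq_zero]; simpa using hr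
    rw [this, map_zero]
  · rw [← hm', ← Submodule.Quotient.mk_smul, Submodule.factor_mk, Submodule.mkQ_apply,
      Submodule.Quotient.eq] at h3
    exact h3

end Elem

section Swap
open CategoryTheory

variable {R : Type u} [CommRing R] [IsNoetherianRing R] [IsLocalRing R] {J : Ideal R}
  {M : Type u} [AddCommGroup M] [Module R M] [Module.Finite R M]

lemma krullU (hJ : J ≠ ⊤) {y : R} (hy : y ∈ J) (W : Submodule R M) (m : M)
    (h : ∀ n, 1 ≤ n → m ∈ W ⊔ ym M (y ^ n)) : m ∈ W := by
  have h0 := Ideal.iInf_pow_smul_eq_bot_of_isLocalRing (M := M ⧸ W) J hJ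
  have h1 : (Submodule.Quotient.mk m : M ⧸ W) ∈ (⨅ i : ℕ, J ^ i • ⊤ : Submodule R (M ⧸ W)) := by
    rw [Submodule.mem_iInf]
    intro i
    obtain ⟨w, hw, b, rfl⟩ := mem_sup_ym.1 (h (i + 1) (Nat.le_add_left _ _))
    have : (Submodule.Quotient.mk (w + y ^ (i + 1) • b) : M ⧸ W) =
        y ^ (i + 1) • (Submodule.Quotient.mk b) := by
      rw [← Submodule.Quotient.mk_smul, Submodule.Quotient.eq]
      simpa using hw
    rw [this]
    exact Submodule.smul_mem_smul (Ideal.pow_le_pow_right (Nat.le_succ i) (Ideal.pow_mem_pow hy _))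
      Submodule.mem_top
  rw [h0, Submodule.mem_bot, Submodule.Quotient.mk_eq_zero] at h1
  exact h1

lemma FR_pow_step {U : Submodule R M} {y1 y2 : R} (h1 : FR J U y1) (h2 : FR J (U ⊔ ym M y1) y2)
    {m : M} (hm : y2 • m ∈ U) (n : ℕ) : m ∈ satU J (U ⊔ ym M (y1 ^ (n + 1))) := by
  induction n with
  | zero => rw [zero_add, pow_one]; exact h2 _ (Submodule.mem_sup_left hm)
  | succ n ih =>
    obtain ⟨k, hk⟩ := ih
    refine mem_satU_of k fun r hr => ?_
    obtain ⟨w, hw, b, hb⟩ := mem_sup_ym.1 (hk r hr)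
    have h3 : y1 ^ (n + 1) • (y2 • b) ∈ U := by
      have : y1 ^ (n + 1) • (y2 • b) = r • (y2 • m) - y2 • w := by
        rw [smul_comm r, ← hb]; rw [smul_add, smul_comm y2]; abel
      rw [this]
      exact U.sub_mem (U.smul_mem _ hm) (U.smul_mem _ hw)
    have h4 : b ∈ satU J (U ⊔ ym M y1) := h2.sat (satU_mono J le_sup_left (h1.pow _ _ h3))
    rw [← hb]
    refine Submodule.add_mem _ (le_satU _ _ (Submodule.mem_sup_left hw)) ?_
    obtain ⟨l, hl⟩ := h4
    refine ⟨l, fun s hs => ?_⟩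
    obtain ⟨w', hw', b', hb'⟩ := mem_sup_ym.1 (hl s hs)
    rw [smul_comm, ← hb', smul_add]
    refine Submodule.add_mem _ (Submodule.mem_sup_left (U.smul_mem _ hw')) (Submodule.mem_sup_right ?_)
    rw [← mul_smul, ← pow_succ]
    exact smul_mem_ym _ _

lemma swap_FR (hJ : J ≠ ⊤) {U : Submodule R M} {y1 y2 : R} (hy : y1 ∈ J) (h1 : FR J U y1)
    (h2 : FR J (U ⊔ ym M y1) y2) (hk : Kill J y1 1 (ModuleCat.of R (M ⧸ U))) : FR J U y2 := by
  intro m hm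
  refine h1.sat (krullU hJ hy _ _ fun n hn => ?_)
  obtain ⟨n, rfl⟩ : ∃ k, n = k + 1 := ⟨n - 1, by omega⟩
  obtain ⟨m', hm', h3⟩ := ex0 (h1.pow (n + 1)) hk (FR_pow_step h1 h2 hm n)
  have : y1 • m = m' + (y1 • m - m') := by abel
  rw [this]
  exact Submodule.add_mem _ (Submodule.mem_sup_left hm') (sup_le_sup_right (le_satU J U) _ h3)

lemma swap_FR2 {U : Submodule R M} {y1 y2 : R} (h1 : FR J U y1)
    (h2 : FR J (U ⊔ ym M y1) y2) : FR J (U ⊔ ym M y2) y1 := by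
  intro m hm
  obtain ⟨w, hw, b, hb⟩ := mem_sup_ym.1 hm
  have h3 : y2 • b ∈ U ⊔ ym M y1 := by
    have : y2 • b = y1 • m - w := by rw [← hb]; abel
    rw [this]
    exact Submodule.sub_mem _ (Submodule.mem_sup_right (smul_mem_ym _ _)) (Submodule.mem_sup_left hw)
  obtain ⟨k, hk⟩ := h2 b h3
  refine mem_satU_of k fun r hr => ?_
  obtain ⟨w', hw', c, hc⟩ := mem_sup_ym.1 (hk r hr)
  have h4 : y1 • (r • m - y2 • c) ∈ U := by
    have : y1 • (r • m - y2 • c) = r • w + y2 • w' := by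
      rw [smul_sub, smul_comm y1 r, ← hb, smul_add, smul_comm r y2, ← hc, smul_add, smul_comm y1 y2]
      abel
    rw [this]
    exact U.add_mem (U.smul_mem _ hw) (U.smul_mem _ hw')
  have h5 := satU_mono J (le_sup_left : U ≤ U ⊔ ym M y2) (h1 _ h4)
  have : r • m = (r • m - y2 • c) + y2 • c := by abel
  rw [this]
  exact Submodule.add_mem _ h5 (le_satU _ _ (Submodule.mem_sup_right (smul_mem_ym _ _)))

lemma swap_kill2 {U : Submodule R M} {y1 y2 : R} (h1 : FR J U y1) {l : ℕ}
    (hk1 : ∀ i < l + 2, Kill J y1 i (ModuleCat.of R (M ⧸ U)))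
    (hk2 : ∀ i < l + 1, Kill J y2 i (ModuleCat.of R (M ⧸ (U ⊔ ym M y1)))) :
    ∀ i < l + 2, Kill J y2 i (ModuleCat.of R (M ⧸ U)) := by
  intro i hi
  have hq := h1.qd le_sup_left rfl
  rcases i with _ | i
  · intro n e
    obtain ⟨n1, hn1, h3⟩ := hk2 0 (by omega) n (ps (ModuleCat.ofHom (Submodule.factor le_sup_left)) e)
    obtain ⟨n2, hn2, h4⟩ := hq.inj (hk1 0 hi) (y2 • e) ⟨n1, hn1, by
      rw [ps_smul, rs_smul]; exact h3⟩
    refine ⟨n2, hn2, ?_⟩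
    rw [rs_smul] at h4
    exact h4
  · exact hq.sur (hk1 _ hi) (hk2 i (by omega))

/-- factor map in the category -/
noncomputable def fac {U V : Submodule R M} (h : U ≤ V) : ModuleCat.of R (M ⧸ U) ⟶ ModuleCat.of R (M ⧸ V) :=
  ModuleCat.ofHom (Submodule.factor h)

lemma fac_fac {U V W : Submodule R M} (h : U ≤ V) (h' : V ≤ W) : fac h ≫ fac h' = fac (h.trans h') := by
  apply ModuleCat.hom_ext
  apply LinearMap.ext
  intro x
  obtain ⟨x, rfl⟩ := Submodule.mkQ_surjective _ x
  rfl

lemma smul_fac {U V : Submodule R M} (h : U ≤ V) (y : R) (hy : ym M y ≤ V) : y • fac h = 0 := by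
  apply ModuleCat.hom_ext
  apply LinearMap.ext
  intro x
  obtain ⟨x, rfl⟩ := Submodule.mkQ_surjective _ x
  change y • (Submodule.mkQ V x) = 0
  rw [← map_smul, Submodule.mkQ_apply, Submodule.Quotient.mk_eq_zero]
  exact hy (smul_mem_ym _ _)

lemma swap_kill1 {U : Submodule R M} {y1 y2 : R} (h1 : FR J U y1) (h2 : FR J (U ⊔ ym M y1) y2)
    (h3 : FR J U y2) {l : ℕ}
    (hk1 : ∀ i < l + 2, Kill J y1 i (ModuleCat.of R (M ⧸ U)))
    (hk2 : ∀ i < l + 1, Kill J y2 i (ModuleCat.of R (M ⧸ (U ⊔ ym M y1)))) :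
    ∀ i < l + 1, Kill J y1 i (ModuleCat.of R (M ⧸ (U ⊔ ym M y2))) := by
  intro i hi n z
  let W := U ⊔ ym M y1 ⊔ ym M y2
  have hW1 : U ⊔ ym M y1 ≤ W := le_sup_left
  have hW2 : U ⊔ ym M y2 ≤ W := sup_le_sup_right le_sup_left _
  have q1 := h1.qd le_sup_left rfl
  have q2 := h2.qd hW1 rfl
  have q3 := h3.qd le_sup_left rfl
  obtain ⟨n1, hn1, v, hv⟩ := q3.ex (hk1 (i + 1) (by omega)) z
  have e1 : ps (fac hW1) (ps (fac (le_sup_left : U ≤ U ⊔ ym M y1)) v) = 0 := by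
    rw [ps_ps, fac_fac, ← fac_fac (le_sup_left : U ≤ U ⊔ ym M y2) hW2, ← ps_ps]
    change ps _ (ps (ModuleCat.ofHom (Submodule.factor le_sup_left)) v) = 0
    rw [← hv, ps_smul]
    have h5 := smul_fac hW2 y1 (le_sup_right.trans le_sup_left)
    have h6 : ps (y1 • fac hW2) (rs (resq J hn1) z) = y1 • ps (fac hW2) (rs (resq J hn1) z) := by
      simp [ps, Abelian.Ext.mk₀_smul]
    rw [← h6, h5]
    simp [ps]
  have e2 := q2.inj (hk2 i hi) (ps (fac (le_sup_left : U ≤ U ⊔ ym M y1)) v) ⟨n1, le_rfl, by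
    change rs _ (ps (fac hW1) _) = 0
    rw [e1, rs_zero]⟩
  obtain ⟨n2, hn2, e3⟩ := q1.inj (hk1 i (by omega)) v e2
  refine ⟨n2, hn1.trans hn2, ?_⟩
  change y1 • rs _ _ = 0
  rw [← rq_rq J hn1 hn2, ← rs_smul, hv, rs_ps, e3, ps_zero]

/-- the inductive standardness condition -/
def CC (J : Ideal R) : Submodule R M → List R → Prop
  | _, [] => True
  | U, y :: L => FR J U y ∧ (∀ i < L.length + 1, Kill J y i (ModuleCat.of R (M ⧸ U))) ∧
      CC J (U ⊔ ym M y) L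

lemma CC.swap (hJ : J ≠ ⊤) {U : Submodule R M} {y1 y2 : R} {L : List R} (hy : y1 ∈ J)
    (h : CC J U (y1 :: y2 :: L)) : CC J U (y2 :: y1 :: L) := by
  obtain ⟨h1, hk1, h2, hk2, h3⟩ := h
  have f2 := swap_FR hJ hy h1 h2 (hk1 1 (by simp))
  refine ⟨f2, swap_kill2 h1 hk1 hk2, swap_FR2 h1 h2, swap_kill1 h1 h2 f2 hk1 hk2, ?_⟩
  rw [sup_right_comm]; exact h3

lemma CC.perm (hJ : J ≠ ⊤) {L L' : List R} (hp : L.Perm L') : ∀ {U : Submodule R M},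
    (∀ y ∈ L, y ∈ J) → CC J U L → CC J U L' := by
  induction hp with
  | nil => intro U _ h; exact h
  | cons x hp ih =>
    intro U hL h
    obtain ⟨h1, hk1, h2⟩ := h
    refine ⟨h1, ?_, ih (fun y hy => hL y (List.mem_cons_of_mem _ hy)) h2⟩
    rw [← hp.length_eq]; exact hk1
  | swap x y l =>
    intro U hL h
    exact h.swap hJ (hL _ (by simp))
  | trans h1 h2 ih1 ih2 =>
    intro U hL h
    exact ih2 (fun y hy => hL y (h1.mem_iff.2 hy)) (ih1 hL h)

lemma Kill.pow {N : ModuleCat.{u} R} {y : R} {i : ℕ} (h : Kill J y i N) (n : ℕ) :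
    Kill J (y ^ (n + 1)) i N := by
  intro k e
  obtain ⟨k', hk, h1⟩ := h k e
  exact ⟨k', hk, by rw [pow_succ, mul_smul, h1, smul_zero]⟩

lemma CC.pow_head (hJ : J ≠ ⊤) (n : ℕ) (L : List R) : ∀ {U : Submodule R M} {y1 : R},
    (∀ y ∈ y1 :: L, y ∈ J) → CC J U (y1 :: L) → CC J U (y1 ^ (n + 1) :: L) := by
  induction L with
  | nil =>
    intro U y1 hL h
    exact ⟨h.1.pow _, fun i hi => (h.2.1 i hi).pow n, trivial⟩
  | cons y2 L ih =>
    intro U y1 hL h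
    obtain ⟨h1, hk, h2⟩ := h.swap hJ (hL _ (by simp))
    have h3 := ih (fun y hy => hL y (by simp at hy ⊢; tauto)) h2
    have h4 : CC J U (y2 :: y1 ^ (n + 1) :: L) := ⟨h1, hk, h3⟩
    exact h4.swap hJ (hL _ (by simp))

lemma CC.pow {ι : Type*} (x : ι → R) (e : ι → ℕ) (hJ : J ≠ ⊤) (l : List ι) : ∀ {U : Submodule R M},
    (∀ i ∈ l, x i ∈ J) → ∀ L : List R, (∀ y ∈ L, y ∈ J) → CC J U (l.map x ++ L) →
      CC J U (l.map (fun i => x i ^ (e i + 1)) ++ L) := by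
  induction l with
  | nil => intro U _ L _ h; exact h
  | cons i l ih =>
    intro U hl L hL h
    have h1 := CC.pow_head hJ (e i) (l.map x ++ L) (by
      intro y hy
      rcases List.mem_cons.1 hy with rfl | hy
      · exact hl _ (by simp)
      · rcases List.mem_append.1 hy with hy | hy
        · obtain ⟨j, hj, rfl⟩ := List.mem_map.1 hy
          exact hl _ (List.mem_cons_of_mem _ hj)
        · exact hL _ hy) h
    obtain ⟨h2, h3, h4⟩ := h1
    refine ⟨h2, ?_, ih (fun j hj => hl _ (List.mem_cons_of_mem _ hj)) L hL h4⟩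
    simpa using h3

end Swap

section ThmE

variable {R : Type u} [CommRing R] [IsNoetherianRing R]
  {M : Type u} [AddCommGroup M] [Module R M] [Module.Finite R M] {ι : Type} [DecidableEq ι]

/-- sum of the `x_i^{e_i+1} M` -/
def Us (M : Type u) [AddCommGroup M] [Module R M] (x : ι → R) (I : Finset ι) (e : ι → ℕ) :
    Submodule R M := ⨆ i ∈ I, ym M (x i ^ (e i + 1))

lemma Us_insert (x : ι → R) (I : Finset ι) (e : ι → ℕ) (a : ι) :
    Us M x (insert a I) e = ym M (x a ^ (e a + 1)) ⊔ Us M x I e := by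
  unfold Us; rw [Finset.iSup_insert]

lemma Us_congr (x : ι → R) (I : Finset ι) (e e' : ι → ℕ) (h : ∀ i ∈ I, e i = e' i) :
    Us M x I e = Us M x I e' := by
  unfold Us
  refine iSup_congr fun i => iSup_congr fun hi => by rw [h i hi]

/-- the cancellation hypothesis -/
def HU (x : ι → R) (V : Submodule R M) (I : Finset ι) : Prop :=
  ∀ I' ⊆ I, ∀ e : ι → ℕ, ∀ i ∈ I, i ∉ I' → ∀ j ∈ I, j ∉ I' → ∀ m : M,
    x i • x j • m ∈ V ⊔ Us M x I' e → x i • m ∈ V ⊔ Us M x I' e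

lemma HU.step {x : ι → R} {V : Submodule R M} {I : Finset ι} {a : ι} (ha : a ∉ I)
    (h : HU x V (insert a I)) (n : ℕ) : HU x (V ⊔ ym M (x a ^ (n + 1))) I := by
  intro I' hI' e i hi hi' j hj hj' m hm
  have ha' : a ∉ I' := fun h => ha (hI' h)
  have key : V ⊔ ym M (x a ^ (n + 1)) ⊔ Us M x I' e =
      V ⊔ Us M x (insert a I') (Function.update e a n) := by
    rw [Us_insert, Us_congr x I' (Function.update e a n) e, Function.update_self, sup_assoc]
    intro k hk
    rw [Function.update_of_ne]
    rintro rfl; exact ha' hk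
  rw [key] at hm ⊢
  refine h _ (Finset.insert_subset_insert a hI') _ i (by simp [hi]) ?_ j (by simp [hj]) ?_ m hm
  · simp only [Finset.mem_insert, not_or]; exact ⟨fun h => ha (h ▸ hi), hi'⟩
  · simp only [Finset.mem_insert, not_or]; exact ⟨fun h => ha (h ▸ hj), hj'⟩

lemma HU.pow {x : ι → R} {V : Submodule R M} {I I' : Finset ι} (h : HU x V I) (hI : I' ⊆ I)
    (e : ι → ℕ) {a : ι} (ha : a ∈ I) (ha' : a ∉ I') (n : ℕ) {m : M}
    (hm : x a ^ (n + 1) • m ∈ V ⊔ Us M x I' e) : x a • m ∈ V ⊔ Us M x I' e := by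
  induction n with
  | zero => simpa using hm
  | succ n ih =>
    apply ih
    have := h I' hI e a ha ha' a ha ha' (x a ^ n • m) (by
      have e1 : x a • x a • x a ^ n • m = x a ^ (n + 1 + 1) • m := by
        rw [← mul_smul, ← mul_smul]; congr 1; ring
      rw [e1]; exact hm)
    rwa [← mul_smul, ← pow_succ'] at this

/-- the right-hand side -/
def GG (x : ι → R) (V : Submodule R M) (I : Finset ι) : Submodule R M :=
  V ⊔ Us M x I 0 ⊔ ⨆ i ∈ I, (V ⊔ Us M x (I.erase i) 0).comap (x i • (LinearMap.id : M →ₗ[R] M))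

lemma mem_GG_of {x : ι → R} {V : Submodule R M} {I : Finset ι} {i : ι} (hi : i ∈ I) {m : M}
    (h : x i • m ∈ V ⊔ Us M x (I.erase i) 0) : m ∈ GG x V I := by
  refine Submodule.mem_sup_right ?_
  exact Submodule.mem_iSup_of_mem i (Submodule.mem_iSup_of_mem hi h)

theorem thmE (x : ι → R) (n : ℕ) (I : Finset ι) : ∀ (V : Submodule R M), HU x V I → ∀ m : M,
    (∏ i ∈ I, x i) ^ n • m ∈ V ⊔ Us M x I (fun _ => n) → m ∈ GG x V I := by
  induction I using Finset.induction_on with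
  | empty =>
    intro V _ m hm
    simp [Us] at hm
    simp [GG, Us, hm]
  | insert a I ha ih =>
    intro V hV m hm
    rw [Finset.prod_insert ha, mul_pow, mul_comm, mul_smul, Us_insert, ← sup_assoc] at hm
    have h1 := ih _ (hV.step ha n) _ hm
    set G := GG x V (insert a I) with hG
    have hyG : ∀ c : M, x a • c ∈ G := fun c => by
      refine Submodule.mem_sup_left (Submodule.mem_sup_right ?_)
      rw [Us_insert]
      refine Submodule.mem_sup_left ?_
      simpa using smul_mem_ym (x a) c
    have hVG : ∀ {m}, x a • m ∈ V ⊔ Us M x I 0 → m ∈ G := fun {m} h => by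
      refine mem_GG_of (Finset.mem_insert_self a I) ?_
      rwa [Finset.erase_insert ha]
    have h2 : GG x (V ⊔ ym M (x a ^ (n + 1))) I ≤
        (V ⊔ Us M x I 0 ⊔ G.map (x a ^ (n + 1) • (LinearMap.id : M →ₗ[R] M))).comap
          (x a • (LinearMap.id : M →ₗ[R] M)) := by
      refine sup_le (sup_le (sup_le ?_ ?_) ?_) (iSup₂_le fun i hi => ?_)
      · intro v hv
        exact Submodule.mem_sup_left (Submodule.mem_sup_left (V.smul_mem _ hv))
      · rintro _ ⟨c, rfl⟩
        refine Submodule.mem_sup_right ⟨x a • c, hyG c, ?_⟩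
        exact smul_comm _ _ _
      · intro v hv
        exact Submodule.mem_sup_left (Submodule.mem_sup_right (Submodule.smul_mem _ _ hv))
      · intro b hb
        have hai : a ≠ i := fun h => ha (h ▸ hi)
        have hb : x i • b ∈ (V ⊔ ym M (x a ^ (n + 1))) ⊔ Us M x (I.erase i) 0 := hb
        rw [sup_right_comm] at hb
        set W := V ⊔ Us M x (I.erase i) 0 with hW
        obtain ⟨w, hw, c, hc⟩ := mem_sup_ym.1 hb
        have hWI : V ⊔ Us M x I 0 = W ⊔ ym M (x i) := by
          conv_lhs => rw [← Finset.insert_erase hi, Us_insert]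
          rw [sup_comm (ym M _), ← sup_assoc]; simp [hW]
        have h3 : x a ^ (n + 1) • c ∈ V ⊔ Us M x I 0 := by
          rw [hWI]
          have : x a ^ (n + 1) • c = x i • b - w := by rw [← hc]; abel
          rw [this]
          exact Submodule.sub_mem _ (Submodule.mem_sup_right (smul_mem_ym _ _)) (Submodule.mem_sup_left hw)
        have h4 := hV.pow (Finset.subset_insert a I) 0 (Finset.mem_insert_self a I) ha n h3
        rw [hWI] at h4
        obtain ⟨w', hw', d, hd⟩ := mem_sup_ym.1 h4
        have h5 : x i • (b - x a ^ n • d) ∈ W := by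
          have : x i • (b - x a ^ n • d) = w + x a ^ n • w' := by
            rw [smul_sub, ← hc, smul_comm (x i), pow_succ, mul_smul, ← hd, smul_add]; abel
          rw [this]
          exact W.add_mem hw (W.smul_mem _ hw')
        have h6 : x a • (b - x a ^ n • d) ∈ W := by
          refine hV _ ((Finset.erase_subset i I).trans (Finset.subset_insert a I)) 0 a
            (Finset.mem_insert_self a I) (fun h => ha (Finset.mem_of_mem_erase h)) i
            (Finset.mem_insert_of_mem hi) (Finset.notMem_erase i I) _ (W.smul_mem _ h5)
        have hdG : d ∈ G := by
          refine mem_GG_of (Finset.mem_insert_of_mem hi) ?_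
          rw [Finset.erase_insert_of_ne hai, Us_insert]
          have : x i • d = x a • c - w' := by rw [← hd]; abel
          rw [this]
          have hle : W ≤ V ⊔ (ym M (x a ^ ((0 : ι → ℕ) a + 1)) ⊔ Us M x (I.erase i) 0) :=
            sup_le_sup_left le_sup_right _
          refine Submodule.sub_mem _ (Submodule.mem_sup_right (Submodule.mem_sup_left ?_)) (hle hw')
          simpa using smul_mem_ym (x a) c
        change x a • b ∈ V ⊔ Us M x I 0 ⊔ G.map (x a ^ (n + 1) • (LinearMap.id : M →ₗ[R] M))
        have : x a • b = x a • (b - x a ^ n • d) + x a ^ (n + 1) • d := by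
          rw [smul_sub, ← mul_smul (x a), ← pow_succ']; abel
        rw [this]
        refine Submodule.add_mem _ (Submodule.mem_sup_left ?_) (Submodule.mem_sup_right ⟨d, hdG, rfl⟩)
        rw [hWI]
        exact Submodule.mem_sup_left h6
    have h3 : x a • x a ^ n • m ∈ V ⊔ Us M x I 0 ⊔ G.map (x a ^ (n + 1) • (LinearMap.id : M →ₗ[R] M)) := h2 h1
    obtain ⟨v, hv, _, ⟨g, hg, rfl⟩, hvg⟩ := Submodule.mem_sup.1 h3
    have h4 : x a ^ (n + 1) • (m - g) ∈ V ⊔ Us M x I 0 := by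
      have : x a ^ (n + 1) • (m - g) = v := by
        have hvg' : v + x a ^ (n + 1) • g = x a • x a ^ n • m := hvg
        rw [← mul_smul, ← pow_succ'] at hvg'
        rw [smul_sub, ← hvg']; abel
      rwa [this]
    have h5 := hVG (hV.pow (Finset.subset_insert a I) 0 (Finset.mem_insert_self a I) ha n h4)
    have : m = (m - g) + g := by abel
    rw [this]
    exact G.add_mem h5 hg

end ThmE

section Final

variable {R : Type u} [CommRing R] [IsNoetherianRing R] [IsLocalRing R]
  {M : Type u} [AddCommGroup M] [Module R M] [Module.Finite R M]

lemma CC.drop {J : Ideal R} {ι : Type} (f : ι → R) (L : List R) (l : List ι) :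
    ∀ {U : Submodule R M}, CC J U (l.map f ++ L) → CC J (U ⊔ ⨆ i ∈ l, ym M (f i)) L := by
  induction l with
  | nil => intro U h; simpa using h
  | cons a l ih =>
    intro U h
    have h1 := ih h.2.2
    have e : U ⊔ ⨆ i ∈ a :: l, ym M (f i) = U ⊔ ym M (f a) ⊔ ⨆ i ∈ l, ym M (f i) := by
      rw [sup_assoc]
      congr 1
      simp only [List.mem_cons, iSup_or, iSup_sup_eq, iSup_iSup_eq_left]
    rw [e]; exact h1

lemma CC.head {J : Ideal R} (hJ : J ≠ ⊤) {ι : Type} [DecidableEq ι] (x : ι → R) (S : Finset ι)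
    (hx : ∀ i ∈ S, x i ∈ J) (h : CC J (⊥ : Submodule R M) (S.toList.map x)) (I' : Finset ι)
    (hI : I' ⊆ S) (e : ι → ℕ) (i : ι) (hi : i ∈ S) (hi' : i ∉ I') :
    FR J (Us M x I' e) (x i) ∧ Kill J (x i) 0 (ModuleCat.of R (M ⧸ Us M x I' e)) := by
  have hp : S.toList.Perm (I'.toList ++ (i :: (S \ insert i I').toList)) := by
    rw [List.perm_ext_iff_of_nodup (Finset.nodup_toList _)]
    · intro a
      simp only [Finset.mem_toList, List.mem_append, List.mem_cons, Finset.mem_sdiff,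
        Finset.mem_insert]
      constructor
      · intro ha; tauto
      · rintro (h | rfl | h)
        · exact hI h
        · exact hi
        · exact h.1
    · rw [List.nodup_append]
      refine ⟨Finset.nodup_toList _, ?_, ?_⟩
      · rw [List.nodup_cons]; exact ⟨by simp, Finset.nodup_toList _⟩
      · intro a ha b hb hab
        subst hab
        simp only [Finset.mem_toList, List.mem_cons, Finset.mem_sdiff, Finset.mem_insert] at ha hb
        rcases hb with rfl | hb
        · exact hi' ha
        · exact hb.2 (Or.inr ha)
  have hxS : ∀ y ∈ S.toList.map x, y ∈ J := by
    intro y hy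
    obtain ⟨a, ha, rfl⟩ := List.mem_map.1 hy
    exact hx a (Finset.mem_toList.1 ha)
  have h1 := CC.perm hJ (hp.map x) hxS h
  rw [List.map_append] at h1
  have h2 := CC.pow x e hJ I'.toList (fun a ha => hx a (hI (Finset.mem_toList.1 ha))) _
    (fun y hy => hxS y ((hp.map x).mem_iff.2 (by
      rw [List.map_append]; exact List.mem_append_right _ hy))) h1
  have h3 := CC.drop _ _ _ h2
  have e1 : (⊥ ⊔ ⨆ i ∈ I'.toList, ym M (x i ^ (e i + 1))) = Us M x I' e := by
    rw [bot_sup_eq]; unfold Us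
    refine iSup_congr fun i => ?_
    simp only [Finset.mem_toList]
  rw [e1] at h3
  exact ⟨h3.1, h3.2.1 0 (Nat.succ_pos _)⟩

lemma CC.hu {J : Ideal R} (hJ : J ≠ ⊤) {ι : Type} [DecidableEq ι] (x : ι → R) (S : Finset ι)
    (hx : ∀ i ∈ S, x i ∈ J) (h : CC J (⊥ : Submodule R M) (S.toList.map x)) :
    HU x (⊥ : Submodule R M) S := by
  intro I' hI e i hi hi' j hj hj' m hm
  rw [bot_sup_eq] at hm ⊢
  obtain ⟨hfi, hki⟩ := CC.head hJ x S hx h I' hI e i hi hi'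
  obtain ⟨hfj, -⟩ := CC.head hJ x S hx h I' hI e j hj hj'
  exact kill0 hki (hfj.sat (hfi _ hm))

lemma span_smul_top {ι : Type} (f : ι → R) (S : Set ι) :
    (Ideal.span (f '' S) • ⊤ : Submodule R M) = ⨆ i ∈ S, ym M (f i) := by
  apply le_antisymm
  · rw [Submodule.smul_le]
    intro r hr n _
    have : Ideal.span (f '' S) ≤
        ((⨆ i ∈ S, ym M (f i)).comap (LinearMap.toSpanSingleton R M n) : Submodule R R) := by
      rw [Ideal.span, Submodule.span_le]
      rintro _ ⟨i, hi, rfl⟩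
      exact Submodule.mem_iSup_of_mem i (Submodule.mem_iSup_of_mem hi (smul_mem_ym (f i) n))
    exact this hr
  · refine iSup₂_le fun i hi => ?_
    rintro _ ⟨b, rfl⟩
    exact Submodule.smul_mem_smul (Ideal.subset_span ⟨i, hi, rfl⟩) trivial

lemma standard_CC {J : Ideal R} {t : ℕ} (x : Fin t → R) (hst : IsStandardSeq J M x) (s : ℕ)
    (hs : s ≤ t) (k : ℕ) : ∀ (j : ℕ) (h : j + k = s),
    CC J (Ideal.span (x '' {l | (l : ℕ) < j}) • ⊤ : Submodule R M)
      (List.ofFn (fun i : Fin k => x ⟨j + i, by omega⟩)) := by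
  induction k with
  | zero => intro j h; simp [CC]
  | succ k ih =>
    intro j h
    rw [List.ofFn_succ]
    have hj : j < t := by omega
    refine ⟨?_, ?_, ?_⟩
    · exact hst.1 ⟨j, hj⟩
    · intro i hi
      rw [List.length_ofFn] at hi
      refine kill_of_lcoh J _ i _ fun a => hst.2 i j (by omega) a _ ?_
      exact Ideal.subset_span ⟨_, rfl⟩
    · have h1 := ih (j + 1) (by omega)
      have e1 : (Ideal.span (x '' {l | (l : ℕ) < j + 1}) • ⊤ : Submodule R M) =
          (Ideal.span (x '' {l | (l : ℕ) < j}) • ⊤ : Submodule R M) ⊔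
            ym M (x ⟨j + ((0 : Fin (k + 1)) : ℕ), by simpa using hj⟩) := by
        rw [span_smul_top, span_smul_top]
        apply le_antisymm
        · refine iSup₂_le fun i hi => ?_
          have hi : (i : ℕ) < j + 1 := hi
          rcases Nat.lt_succ_iff_lt_or_eq.1 hi with hi | hi
          · exact le_sup_of_le_left (le_iSup₂_of_le i hi le_rfl)
          · refine le_sup_of_le_right (le_of_eq ?_)
            congr 2; ext; simpa using hi
        · refine sup_le (iSup₂_le fun i hi => le_iSup₂_of_le i (Nat.lt_succ_of_lt hi) le_rfl) ?_
          exact le_iSup₂_of_le (f := fun (i : Fin t) (_ : i ∈ {l : Fin t | (l : ℕ) < j + 1}) => ym M (x i))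
            (⟨j + ((0 : Fin (k + 1)) : ℕ), by simpa using hj⟩ : Fin t) (by simp) le_rfl
      rw [← e1]
      convert h1 using 4
      simp; omega

lemma CC.finset {J : Ideal R} (hJ : J ≠ ⊤) {t : ℕ} (x : Fin t → R) (hst : IsStandardSeq J M x) (s : ℕ)
    (hs : s ≤ t) (hx : ∀ i : Fin s, x (Fin.castLE hs i) ∈ J) :
    CC J (⊥ : Submodule R M)
      ((Finset.univ : Finset (Fin s)).toList.map (fun i => x (Fin.castLE hs i))) := by
  have h1 := standard_CC x hst s hs s 0 (by omega)
  have e1 : (Ideal.span (x '' {l | (l : ℕ) < 0}) • ⊤ : Submodule R M) = ⊥ := by simp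
  rw [e1] at h1
  have e2 : (List.ofFn (fun i : Fin s => x ⟨0 + i, by omega⟩)) =
      (List.finRange s).map (fun i => x (Fin.castLE hs i)) := by
    rw [List.ofFn_eq_map]
    refine List.map_congr_left fun i _ => ?_
    congr 1; ext; simp
  rw [e2] at h1
  refine CC.perm hJ (List.Perm.map _ ?_) ?_ h1
  · rw [List.perm_ext_iff_of_nodup (List.nodup_finRange s) (Finset.nodup_toList _)]
    intro a; simp
  · intro y hy
    obtain ⟨a, -, rfl⟩ := List.mem_map.1 hy
    exact hx a

lemma limit_le {s : ℕ} (x : Fin s → R) :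
    (Ideal.span (Set.range x) • (⊤ : Submodule R M))
          ⊔ ⨆ i : Fin s,
              (Ideal.span (x '' {j | j ≠ i}) • (⊤ : Submodule R M)).comap
                (x i • (LinearMap.id : M →ₗ[R] M)) ≤ limitClosure x M := by
  refine le_trans ?_ (le_iSup _ 0)
  have hsq : ∀ i, ∀ m : M, x i ^ 2 • m ∈
      (Ideal.span (Set.range fun i => x i ^ (0 + 2)) • (⊤ : Submodule R M)) := fun i m =>
    Submodule.smul_mem_smul (Ideal.subset_span ⟨i, rfl⟩) trivial
  have hpr : ∀ i, ∃ c, ∏ i, x i = x i * c := fun i =>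
    ⟨_, (Finset.mul_prod_erase Finset.univ x (Finset.mem_univ i)).symm⟩
  have hA : ∀ i, ∀ m : M, (∏ i, x i) • x i • m ∈
      (Ideal.span (Set.range fun i => x i ^ (0 + 2)) • (⊤ : Submodule R M)) := by
    intro i m
    obtain ⟨c, hc⟩ := hpr i
    rw [hc]
    have : (x i * c) • x i • m = x i ^ 2 • c • m := by
      simp only [← mul_smul]; congr 1; ring
    rw [this]; exact hsq _ _
  refine sup_le ?_ (iSup_le fun i => ?_)
  · rw [← Set.image_univ, span_smul_top]
    refine iSup₂_le fun i _ => ?_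
    rintro _ ⟨m, rfl⟩
    change (∏ i, x i) ^ (0 + 1) • x i • m ∈ (Ideal.span (Set.range fun i => x i ^ (0 + 2)) • (⊤ : Submodule R M))
    rw [zero_add, pow_one]; exact hA i m
  · intro m hm
    change (∏ i, x i) ^ (0 + 1) • m ∈ (Ideal.span (Set.range fun i => x i ^ (0 + 2)) • (⊤ : Submodule R M))
    rw [zero_add, pow_one, ← Finset.prod_erase_mul _ _ (Finset.mem_univ i), mul_smul]
    have hm : x i • m ∈ (Ideal.span (x '' {j | j ≠ i}) • (⊤ : Submodule R M)) := hm
    have hle : (Ideal.span (x '' {j | j ≠ i}) • (⊤ : Submodule R M)) ≤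
        (Ideal.span (Set.range fun i => x i ^ (0 + 2)) • (⊤ : Submodule R M)).comap
        ((∏ j ∈ Finset.univ.erase i, x j) • (LinearMap.id : M →ₗ[R] M)) := by
      rw [span_smul_top]
      refine iSup₂_le fun j hj => ?_
      rintro _ ⟨m, rfl⟩
      have hj' : j ∈ Finset.univ.erase i := by simpa using hj
      change (∏ j ∈ Finset.univ.erase i, x j) • x j • m ∈
        (Ideal.span (Set.range fun i => x i ^ (0 + 2)) • (⊤ : Submodule R M))
      rw [← Finset.mul_prod_erase _ _ hj']
      have : ∀ c : R, (x j * c) • x j • m = x j ^ 2 • c • m := by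
        intro c; simp only [← mul_smul]; congr 1; ring
      rw [this]; exact hsq _ _
    exact hle hm

lemma limit_ge {t : ℕ} (x : Fin t → R) (hst : IsStandardSeq (maximalIdeal R) M x) (s : ℕ)
    (hs : s ≤ t) (y : Fin s → R) (hy : y = fun i => x (Fin.castLE hs i)) :
    limitClosure y M ≤ (Ideal.span (Set.range y) • (⊤ : Submodule R M))
          ⊔ ⨆ i : Fin s,
              (Ideal.span (y '' {j | j ≠ i}) • (⊤ : Submodule R M)).comap
                (y i • (LinearMap.id : M →ₗ[R] M)) := by
  by_cases hu : ∀ i, y i ∈ maximalIdeal R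
  · have hJ : maximalIdeal R ≠ ⊤ := (maximalIdeal.isMaximal R).ne_top
    have hc := CC.finset (M := M) hJ x hst s hs (fun i => by have := hu i; rwa [hy] at this)
    rw [← hy] at hc
    have hH := CC.hu hJ y Finset.univ (fun i _ => hu i) hc
    refine iSup_le fun n => ?_
    intro m hm
    have hm : (∏ i, y i) ^ (n + 1) • m ∈
      (Ideal.span (Set.range fun i => y i ^ (n + 2)) • (⊤ : Submodule R M)) := hm
    rw [← Set.image_univ, span_smul_top] at hm
    have h1 := thmE y (n + 1) Finset.univ ⊥ hH m (by
      rw [bot_sup_eq]; unfold Us; simpa using hm)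
    unfold GG at h1
    revert h1
    refine fun h1 => (Eq.mp (congrArg (fun W : Submodule R M => m ∈ W) ?_) h1)
    rw [← Set.image_univ, span_smul_top]
    congr 1
    · rw [bot_sup_eq]; unfold Us; simp
    · simp only [Finset.mem_univ, iSup_pos]
      refine iSup_congr fun i => ?_
      rw [span_smul_top, bot_sup_eq]
      congr 1
      unfold Us; simp
  · push Not at hu
    obtain ⟨i, hi⟩ := hu
    have hun : IsUnit (y i) := by
      by_contra h; exact hi ((mem_maximalIdeal _).2 h)
    have : Ideal.span (Set.range y) = ⊤ := Ideal.eq_top_of_isUnit_mem _ (Ideal.subset_span ⟨i, rfl⟩) hun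
    rw [this]; simp

end Final

theorem limitClosure_eq_of_standard
    {R : Type u} [CommRing R] [IsNoetherianRing R] [IsLocalRing R]
    (M : Type u) [AddCommGroup M] [Module R M] [Module.Finite R M]
    (t n₀ : ℕ)
    (ht : sInf {i | ¬ Module.Finite R (lcoh (maximalIdeal R) i M)} = t) (ht0 : 0 < t)
    (hn₀ : 1 ≤ n₀)
    (hann : ∀ i < t, ∀ (a : lcoh (maximalIdeal R) i M),
      ∀ r ∈ maximalIdeal R ^ n₀, r • a = 0)
    (x : Fin t → R) (hst : IsStandardSeq (maximalIdeal R) M x) :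
    ∀ s : ℕ, ∀ hs : s ≤ t,
      limitClosure (fun i : Fin s => x (Fin.castLE hs i)) M
        = (Ideal.span (Set.range fun i : Fin s => x (Fin.castLE hs i))
              • (⊤ : Submodule R M))
          ⊔ ⨆ i : Fin s,
              (Ideal.span ((fun j : Fin s => x (Fin.castLE hs j)) '' {j | j ≠ i})
                  • (⊤ : Submodule R M)).comap
                (x (Fin.castLE hs i) • (LinearMap.id : M →ₗ[R] M)) := by
  intro s hs
  exact le_antisymm (limit_ge x hst s hs _ rfl)
    (limit_le (fun i : Fin s => x (Fin.castLE hs i)))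
end

section
/- Let (R,𝔪) be a Noetherian local ring, M a finitely generated R-module of finiteness dimension t > 0, and n_0 ≥ 1 with 𝔪^{n_0} H^i_𝔪(M) = 0 for all i < t. For every standard sequence x_1,…,x_t on M and all s ≤ t, the length of (x_1,…,x_s)^{lim}_M / (x_1,…,x_s)M equals Σ_{i=0}^{s-1} C(s,i)·length(H^i_𝔪(M)). -/
universe u

open IsLocalRing

/-- The length of an `R`-module, as the Krull dimension of its submodule lattice
(this agrees with the length of a composition series). -/
noncomputable def moduleLength (R : Type u) [CommRing R] (N : Type v) [AddCommGroup N]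
    [Module R N] : WithBot ℕ∞ :=
  Order.krullDim (Submodule R N)

set_option linter.unusedSectionVars false

namespace LC
open CategoryTheory Opposite Limits

section ExtPart
variable {R : Type u} [CommRing R]

/-- `Ext` modules. -/
noncomputable abbrev EE (i : ℕ) (X Y : ModuleCat.{u} R) : ModuleCat.{u} R :=
  ((Ext R (ModuleCat.{u} R) i).obj (op X)).obj Y

/-- `ξ` is the class of the cocycle `f`. -/
def ER {X : ModuleCat.{u} R} (P : ProjectiveResolution X) (i : ℕ) (Y : ModuleCat.{u} R)
    (f : P.complex.X i ⟶ Y) (ξ : EE i X Y) : Prop :=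
  ∃ z : (P.complex.linearYonedaObj R Y).cycles i,
    (P.complex.linearYonedaObj R Y).iCycles i z = f ∧
    (P.isoExt (R := R) i Y).hom ξ = (P.complex.linearYonedaObj R Y).homologyπ i z

variable {X : ModuleCat.{u} R} (P : ProjectiveResolution X) (i : ℕ) (Y : ModuleCat.{u} R)

lemma ER.ex (ξ : EE i X Y) : ∃ f, ER P i Y f ξ := by
  have : Function.Surjective ((P.complex.linearYonedaObj R Y).homologyπ i) :=
    (ModuleCat.epi_iff_surjective _).1 inferInstance
  obtain ⟨z, hz⟩ := this ((P.isoExt (R := R) i Y).hom ξ)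
  exact ⟨_, z, rfl, hz.symm⟩

lemma ER.cocycle {f} {ξ : EE i X Y} (h : ER P i Y f ξ) : P.complex.d (i+1) i ≫ f = 0 := by
  obtain ⟨z, rfl, -⟩ := h
  have := ConcreteCategory.congr_hom ((P.complex.linearYonedaObj R Y).iCycles_d i (i+1)) z
  exact this

lemma ER.uniq {f} {ξ η : EE i X Y} (h : ER P i Y f ξ) (h' : ER P i Y f η) : ξ = η := by
  obtain ⟨z, hz, h1⟩ := h
  obtain ⟨w, hw, h2⟩ := h'
  have hinj : Function.Injective ((P.complex.linearYonedaObj R Y).iCycles i) :=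
    (ModuleCat.mono_iff_injective _).1 inferInstance
  obtain rfl : z = w := hinj (hz.trans hw.symm)
  have hinj : Function.Injective (P.isoExt (R := R) i Y).hom :=
    (ModuleCat.mono_iff_injective _).1 inferInstance
  exact hinj (h1.trans h2.symm)

lemma ER.add {f g} {ξ η : EE i X Y} (h : ER P i Y f ξ) (h' : ER P i Y g η) :
    ER P i Y (f + g) (ξ + η) := by
  obtain ⟨z, hz, h1⟩ := h
  obtain ⟨w, hw, h2⟩ := h'
  refine ⟨z + w, ?_, ?_⟩
  · rw [map_add, hz, hw]; rfl
  · rw [map_add, map_add, h1, h2]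

lemma ER.smul {f} {ξ : EE i X Y} (r : R) (h : ER P i Y f ξ)  :
    ER P i Y (r • f) (r • ξ) := by
  obtain ⟨z, hz, h1⟩ := h
  refine ⟨r • z, ?_, ?_⟩
  · rw [map_smul, hz]; rfl
  · rw [map_smul, map_smul, h1]

lemma ER.mk {f : P.complex.X i ⟶ Y} (hf : P.complex.d (i+1) i ≫ f = 0) : ∃ ξ, ER P i Y f ξ := by
  let K := (P.complex.linearYonedaObj R Y)
  let k : ModuleCat.of R R ⟶ K.X i := ModuleCat.ofHom (LinearMap.toSpanSingleton R (K.X i) f)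
  have hk : k ≫ K.d i (i+1) = 0 := by
    ext
    change P.complex.d (i+1) i ≫ ((1:R) • f) = 0
    rw [one_smul, hf]
  refine ⟨(P.isoExt (R := R) i Y).inv (K.homologyπ i (K.liftCycles k (i+1) (by simp) hk (1:R))), 
    K.liftCycles k (i+1) (by simp) hk (1:R), ?_, ?_⟩
  · have := ConcreteCategory.congr_hom (K.liftCycles_i k (i+1) (by simp) hk) (1:R)
    refine this.trans ?_
    exact one_smul R f
  · simp [K]

lemma ER.zero_succ {f : P.complex.X (i+1) ⟶ Y} (hf : ER P (i+1) Y f 0) : 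
    ∃ g : P.complex.X i ⟶ Y, f = P.complex.d (i+1) i ≫ g := by
  obtain ⟨z, rfl, h⟩ := hf
  rw [map_zero] at h
  let K := (P.complex.linearYonedaObj R Y)
  have hex : (ShortComplex.mk (K.toCycles i (i+1)) (K.homologyπ (i+1)) (by simp)).Exact :=
    ShortComplex.exact_of_g_is_cokernel _ (K.homologyIsCokernel i (i+1) (by simp))
  rw [ShortComplex.moduleCat_exact_iff] at hex
  obtain ⟨g, hg⟩ := hex z h.symm
  refine ⟨g, ?_⟩
  have := ConcreteCategory.congr_hom (K.toCycles_i i (i+1)) g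
  dsimp at hg
  subst hg
  exact this

lemma ER.succ_zero (g : P.complex.X i ⟶ Y) : ER P (i+1) Y (P.complex.d (i+1) i ≫ g) 0 := by
  let K := (P.complex.linearYonedaObj R Y)
  refine ⟨K.toCycles i (i+1) g, ?_, ?_⟩
  · have := ConcreteCategory.congr_hom (K.toCycles_i i (i+1)) g
    exact this
  · have := ConcreteCategory.congr_hom (K.toCycles_comp_homologyπ i (i+1)) g
    rw [map_zero]
    exact this.symm

lemma ER.zero_zero {f : P.complex.X 0 ⟶ Y} (hf : ER P 0 Y f 0) : f = 0 := by
  obtain ⟨z, rfl, h⟩ := hf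
  rw [map_zero] at h
  let K := (P.complex.linearYonedaObj R Y)
  have : IsIso (K.homologyπ 0) := K.isIso_homologyπ 0 0 (by simp) (by simp [K])
  have hinj : Function.Injective (K.homologyπ 0) :=
    (ModuleCat.mono_iff_injective _).1 inferInstance
  have : z = 0 := hinj (h.symm.trans (map_zero _).symm)
  rw [this, map_zero]
  rfl

lemma flip_iso {C : Type*} [Category C] {A A' B B' : C} (e : A ≅ B) (e' : A' ≅ B')
    (x : A ⟶ A') (y : B ⟶ B') (h : e.hom ≫ y = x ≫ e'.hom) : y ≫ e'.inv = e.inv ≫ x := by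
  rw [Iso.eq_inv_comp, ← Category.assoc, Iso.comp_inv_eq, h]

lemma comp_flip {C : Type*} [Category C] {A B D E : C} (f : A ⟶ E) (a : A ⟶ B) (b : B ⟶ D)
    (e : E ≅ D) (h : f = a ≫ b ≫ e.inv) : f ≫ e.hom = a ≫ b := by
  subst h; simp

lemma sq_iso {C : Type*} [Category C] {A A' B B' D D' : C} (p : A ≅ B) (p' : A' ≅ B')
    (q : B ≅ D) (q' : B' ≅ D') (a : A ⟶ A') (b : B ⟶ B') (c : D ⟶ D')
    (h : a ≫ p'.hom = p.hom ≫ b) (h' : b ≫ q'.hom = q.hom ≫ c) :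
    a ≫ (p' ≪≫ q').hom = (p ≪≫ q).hom ≫ c := by
  simp [reassoc_of% h, h']

lemma unop_nat {K L : HomologicalComplex (ModuleCat.{u} R)ᵒᵖ (ComplexShape.down ℕ)} (β : K ⟶ L) :
    (HomologicalComplex.homologyMap β i).unop ≫ (K.homologyUnop i).inv =
    (L.homologyUnop i).inv ≫
      HomologicalComplex.homologyMap ((HomologicalComplex.unopFunctor _ _).map β.op) i := by
  have := HomologicalComplex.homologyOp_hom_naturality
    (φ := (HomologicalComplex.unopFunctor _ _).map β.op) i
  have h2 := congrArg Quiver.Hom.unop this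
  exact flip_iso (L.homologyUnop i) (K.homologyUnop i) _ _ h2

lemma ER.natY {Y Z : ModuleCat.{u} R} (φ : Y ⟶ Z) {f} {ξ : EE i X Y} (h : ER P i Y f ξ) :
    ER P i Z (f ≫ φ) (((Ext R (ModuleCat.{u} R) i).obj (op X)).map φ ξ) := by
  obtain ⟨z, rfl, h⟩ := h
  let KY := P.complex.linearYonedaObj R Y
  let KZ := P.complex.linearYonedaObj R Z
  let α := ((linearYoneda R (ModuleCat.{u} R)).map φ).rightOp
  let β := (NatTrans.mapHomologicalComplex α (ComplexShape.down ℕ)).app P.complex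
  let ψ : KY ⟶ KZ := (HomologicalComplex.unopFunctor _ _).map β.op
  have key : ((Ext R (ModuleCat.{u} R) i).obj (op X)).map φ ≫ (P.isoExt (R := R) i Z).hom =
      (P.isoExt (R := R) i Y).hom ≫ HomologicalComplex.homologyMap ψ i := by
    have h := ProjectiveResolution.leftDerived_app_eq α P i
    have h' : (NatTrans.leftDerived α i).app X ≫ (P.isoLeftDerivedObj _ i).hom =
        (P.isoLeftDerivedObj _ i).hom ≫ HomologicalComplex.homologyMap β i := by
      exact comp_flip _ _ _ _ h
    have h2 := congrArg Quiver.Hom.unop h'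
    exact sq_iso _ _ _ _ _ (HomologicalComplex.homologyMap β i).unop _
      (flip_iso (P.isoLeftDerivedObj _ i).unop (P.isoLeftDerivedObj _ i).unop _ _ h2)
      (unop_nat i β)
  refine ⟨HomologicalComplex.cyclesMap ψ i z, ?_, ?_⟩
  · exact ConcreteCategory.congr_hom (HomologicalComplex.cyclesMap_i ψ i) z
  · have h1 := ConcreteCategory.congr_hom key ξ
    have h2 := ConcreteCategory.congr_hom (HomologicalComplex.homologyπ_naturality ψ i) z
    refine h1.trans ?_
    refine Eq.trans ?_ h2
    exact congrArg (HomologicalComplex.homologyMap ψ i) h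

lemma ER.natX {X' : ModuleCat.{u} R} (P' : ProjectiveResolution X') (θ : X' ⟶ X)
    (τ : P'.complex ⟶ P.complex) (hτ : τ.f 0 ≫ P.π.f 0 = P'.π.f 0 ≫ θ)
    {f} {ξ : EE i X Y} (h : ER P i Y f ξ) :
    ER P' i Y (τ.f i ≫ f) (((Ext R (ModuleCat.{u} R) i).map θ.op).app Y ξ) := by
  obtain ⟨z, rfl, h⟩ := h
  let K := P.complex.linearYonedaObj R Y
  let K' := P'.complex.linearYonedaObj R Y
  let F := ((linearYoneda R (ModuleCat.{u} R)).obj Y).rightOp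
  let ψ : K ⟶ K' := (HomologicalComplex.unopFunctor _ _).map ((F.mapHomologicalComplex _).map τ).op
  have key : ((Ext R (ModuleCat.{u} R) i).map θ.op).app Y ≫ (P'.isoExt (R := R) i Y).hom =
      (P.isoExt (R := R) i Y).hom ≫ HomologicalComplex.homologyMap ψ i := by
    have h' := ProjectiveResolution.isoLeftDerivedObj_hom_naturality θ P' P τ hτ F i
    have h2 := congrArg Quiver.Hom.unop h'
    exact sq_iso _ _ _ _ _ (HomologicalComplex.homologyMap ((F.mapHomologicalComplex _).map τ) i).unop _
      (flip_iso (P.isoLeftDerivedObj F i).unop (P'.isoLeftDerivedObj F i).unop _ _ h2)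
      (unop_nat i ((F.mapHomologicalComplex _).map τ))
  refine ⟨HomologicalComplex.cyclesMap ψ i z, ?_, ?_⟩
  · exact ConcreteCategory.congr_hom (HomologicalComplex.cyclesMap_i ψ i) z
  · have h1 := ConcreteCategory.congr_hom key ξ
    have h2 := ConcreteCategory.congr_hom (HomologicalComplex.homologyπ_naturality ψ i) z
    refine h1.trans ?_
    refine Eq.trans ?_ h2
    exact congrArg (HomologicalComplex.homologyMap ψ i) h

end ExtPart
end LC

namespace LC
open CategoryTheory Opposite Limits

section RepPart
variable {R : Type u} [CommRing R] (J : Ideal R)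

/-- chosen projective resolution of `R/J^n`. -/
noncomputable def PR (n : ℕ) : ProjectiveResolution (ModuleCat.of R (R ⧸ J ^ n)) :=
  projectiveResolution _

/-- The canonical surjection `R/J^m → R/J^n`. -/
noncomputable def fac {n m : ℕ} (h : n ≤ m) :
    ModuleCat.of R (R ⧸ J ^ m) ⟶ ModuleCat.of R (R ⧸ J ^ n) :=
  ModuleCat.ofHom <| Submodule.mapQ _ _ LinearMap.id (Ideal.pow_le_pow_right h)

/-- Modules in the resolution of `R/J^n`. -/
noncomputable def CX (n i : ℕ) : ModuleCat.{u} R := (PR J n).complex.X i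

/-- Differential. -/
noncomputable def cd (n i : ℕ) : CX J n (i+1) →ₗ[R] CX J n i := ((PR J n).complex.d (i+1) i).hom

/-- Augmentation. -/
noncomputable def ce (n : ℕ) : CX J n 0 →ₗ[R] (R ⧸ J ^ n) := ((PR J n).π.f 0).hom

/-- Chain map lift of `fac`. -/
noncomputable def tauC {n m : ℕ} (h : n ≤ m) : (PR J m).complex ⟶ (PR J n).complex :=
  ProjectiveResolution.lift (fac J h) _ _

lemma tauC_comm {n m : ℕ} (h : n ≤ m) :
    (tauC J h).f 0 ≫ (PR J n).π.f 0 = (PR J m).π.f 0 ≫ fac J h :=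
  ProjectiveResolution.lift_commutes_zero (fac J h) (PR J m) (PR J n)

/-- transition maps. -/
noncomputable def ct {n m : ℕ} (h : n ≤ m) (i : ℕ) : CX J m i →ₗ[R] CX J n i :=
  ((tauC J h).f i).hom

lemma cd_cd (n i : ℕ) : cd J n i ∘ₗ cd J n (i+1) = 0 := by
  have := (PR J n).complex.d_comp_d (i+2) (i+1) i
  exact congrArg ModuleCat.Hom.hom this

lemma ce_cd (n : ℕ) : ce J n ∘ₗ cd J n 0 = 0 := by
  have := (PR J n).complex_d_comp_π_f_zero
  exact congrArg ModuleCat.Hom.hom this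

lemma cd_exact (n i : ℕ) (x : CX J n (i+1)) (h : cd J n i x = 0) : ∃ y, cd J n (i+1) y = x := by
  have := (PR J n).exact_succ i
  rw [ShortComplex.moduleCat_exact_iff] at this
  exact this x h

lemma ce_exact (n : ℕ) (x : CX J n 0) (h : ce J n x = 0) : ∃ y, cd J n 0 y = x := by
  have := (PR J n).exact₀
  rw [ShortComplex.moduleCat_exact_iff] at this
  exact this x h

lemma ce_surj (n : ℕ) : Function.Surjective (ce J n) := by
  have := (ModuleCat.epi_iff_surjective ((PR J n).π.f 0)).1 inferInstance
  exact this

instance (n i : ℕ) : Module.Projective R (CX J n i) := by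
  have := (PR J n).projective i
  exact (IsProjective.iff_projective _).2 this

lemma ct_cd {n m : ℕ} (h : n ≤ m) (i : ℕ) : ct J h i ∘ₗ cd J m i = cd J n i ∘ₗ ct J h (i+1) := by
  have := (tauC J h).comm (i+1) i
  exact (congrArg ModuleCat.Hom.hom this).symm

lemma ce_ct {n m : ℕ} (h : n ≤ m) (x : CX J m 0) :
    ce J n (ct J h 0 x) = Submodule.mapQ _ _ LinearMap.id (Ideal.pow_le_pow_right h) (ce J m x) :=
  ConcreteCategory.congr_hom (tauC_comm J h) x

open localCohomology in
/-- The diagram of Ext functors. -/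
noncomputable abbrev DD (i : ℕ) := diagram (idealPowersDiagram J) i

/-- Structure map to the colimit. -/
noncomputable def toH (n i : ℕ) (M : ModuleCat.{u} R) :
    EE i (ModuleCat.of R (R ⧸ J ^ n)) M ⟶ (localCohomology J i).obj M :=
  (colimit.ι (DD J i) (op (op n))).app M

/-- evaluated cocone is colimit -/
noncomputable def evColim (i : ℕ) (M : ModuleCat.{u} R) :
    IsColimit (((evaluation (ModuleCat.{u} R) (ModuleCat.{u} R)).obj M).mapCocone
      (colimit.cocone (DD J i))) :=
  isColimitOfPreserves _ (colimit.isColimit _)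

instance presDD (i : ℕ) (M : ModuleCat.{u} R) :
    PreservesColimit (DD J i ⋙ (evaluation (ModuleCat R) (ModuleCat R)).obj M)
      (forget (ModuleCat.{u} R)) := by
  have : PreservesFilteredColimitsOfSize.{0,0} (forget (ModuleCat.{u} R)) :=
    preservesSmallestFilteredColimits_of_preservesFilteredColimits.{u,u} _
  infer_instance

lemma toH_jsurj (i : ℕ) (M : ModuleCat.{u} R) (ξ : (localCohomology J i).obj M) :
    ∃ n e, toH J n i M e = ξ := by
  obtain ⟨j, e, he⟩ := Concrete.isColimit_exists_rep _ (evColim J i M) ξ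
  exact ⟨j.unop.unop, e, he⟩

lemma toH_trans {n m : ℕ} (h : n ≤ m) (i : ℕ) (M : ModuleCat.{u} R)
    (e : EE i (ModuleCat.of R (R ⧸ J ^ n)) M) :
    toH J m i M (((Ext R (ModuleCat.{u} R) i).map (fac J h).op).app M e) = toH J n i M e := by
  have := colimit.w (DD J i) ((homOfLE h).op.op : op (op n) ⟶ op (op m))
  have := congrArg (fun z => NatTrans.app z M) this
  exact ConcreteCategory.congr_hom this e

lemma toH_zero {n : ℕ} (i : ℕ) (M : ModuleCat.{u} R)
    (e : EE i (ModuleCat.of R (R ⧸ J ^ n)) M) (he : toH J n i M e = 0) :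
    ∃ m, ∃ h : n ≤ m, ((Ext R (ModuleCat.{u} R) i).map (fac J h).op).app M e = 0 := by
  obtain ⟨k, f, g, h⟩ := Concrete.isColimit_exists_of_rep_eq
    (DD J i ⋙ (evaluation (ModuleCat.{u} R) (ModuleCat.{u} R)).obj M) (evColim J i M)
    (i := op (op n)) (j := op (op n)) e 0 (by
      exact he.trans (map_zero _).symm)
  refine ⟨k.unop.unop, leOfHom f.unop.unop, ?_⟩
  exact h.trans (map_zero _)

lemma toH_nat {n : ℕ} (i : ℕ) {M N : ModuleCat.{u} R} (φ : M ⟶ N)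
    (e : EE i (ModuleCat.of R (R ⧸ J ^ n)) M) :
    toH J n i N (((Ext R (ModuleCat.{u} R) i).obj _).map φ e) =
      (localCohomology J i).map φ (toH J n i M e) := by
  have := (colimit.ι (DD J i) (op (op n))).naturality φ
  exact ConcreteCategory.congr_hom this e

variable {M : Type u} [AddCommGroup M] [Module R M] {N : Type u} [AddCommGroup N] [Module R N]
  {J} {n i : ℕ}

/-- `f` is a cocycle representing the class `ξ`. -/
def Rep (n : ℕ) (f : CX J n i →ₗ[R] M) (ξ : lcoh J i M) : Prop :=
  ∃ e : EE i (ModuleCat.of R (R ⧸ J ^ n)) (ModuleCat.of R M),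
    ER (PR J n) i (ModuleCat.of R M) (ModuleCat.ofHom f) e ∧ toH J n i (ModuleCat.of R M) e = ξ

lemma Rep.ex (ξ : lcoh J i M) : ∃ n f, Rep n f ξ := by
  obtain ⟨n, e, he⟩ := toH_jsurj J i (ModuleCat.of R M) ξ
  obtain ⟨f, hf⟩ := ER.ex (PR J n) i (ModuleCat.of R M) e
  exact ⟨n, f.hom, e, hf, he⟩

lemma Rep.cocycle {f : CX J n i →ₗ[R] M} {ξ} (h : Rep n f ξ) : f ∘ₗ cd J n i = 0 := by
  obtain ⟨e, he, -⟩ := h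
  exact congrArg ModuleCat.Hom.hom (ER.cocycle _ _ _ he)

lemma Rep.mk {f : CX J n i →ₗ[R] M} (h : f ∘ₗ cd J n i = 0) : ∃ ξ, Rep n f ξ := by
  obtain ⟨e, he⟩ := ER.mk (PR J n) i (ModuleCat.of R M) (f := ModuleCat.ofHom f)
    (ModuleCat.hom_ext h)
  exact ⟨_, e, he, rfl⟩

lemma Rep.uniq {f : CX J n i →ₗ[R] M} {ξ η} (h : Rep n f ξ) (h' : Rep n f η) : ξ = η := by
  obtain ⟨e, he, rfl⟩ := h
  obtain ⟨e', he', rfl⟩ := h'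
  rw [ER.uniq _ _ _ he he']

lemma Rep.add {f g : CX J n i →ₗ[R] M} {ξ η} (h : Rep n f ξ) (h' : Rep n g η) :
    Rep n (f + g) (ξ + η) := by
  obtain ⟨e, he, rfl⟩ := h
  obtain ⟨e', he', rfl⟩ := h'
  exact ⟨_, ER.add _ _ _ he he', map_add _ _ _⟩

lemma Rep.smul {f : CX J n i →ₗ[R] M} {ξ} (r : R) (h : Rep n f ξ) : Rep n (r • f) (r • ξ) := by
  obtain ⟨e, he, rfl⟩ := h
  exact ⟨_, ER.smul _ _ _ r he, map_smul _ _ _⟩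

lemma Rep.trans {f : CX J n i →ₗ[R] M} {ξ} {m : ℕ} (hm : n ≤ m) (h : Rep n f ξ) :
    Rep m (f ∘ₗ ct J hm i) ξ := by
  obtain ⟨e, he, rfl⟩ := h
  exact ⟨_, ER.natX (PR J n) i (ModuleCat.of R M) (PR J m) (fac J hm) (tauC J hm) 
    (tauC_comm J hm) he, toH_trans J hm i _ e⟩

lemma Rep.zero_succ {f : CX J n (i+1) →ₗ[R] M} (h : Rep n f 0) :
    ∃ m, ∃ hm : n ≤ m, ∃ g : CX J m i →ₗ[R] M, f ∘ₗ ct J hm (i+1) = g ∘ₗ cd J m i := by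
  obtain ⟨e, he, h0⟩ := h
  obtain ⟨m, hm, h1⟩ := toH_zero J _ _ e h0
  have := ER.natX (PR J n) _ (ModuleCat.of R M) (PR J m) (fac J hm) (tauC J hm) 
    (tauC_comm J hm) he
  rw [h1] at this
  obtain ⟨g, hg⟩ := ER.zero_succ _ _ _ this
  exact ⟨m, hm, g.hom, congrArg ModuleCat.Hom.hom hg⟩

lemma Rep.zero_zero {f : CX J n 0 →ₗ[R] M} (h : Rep n f 0) :
    ∃ m, ∃ hm : n ≤ m, f ∘ₗ ct J hm 0 = 0 := by
  obtain ⟨e, he, h0⟩ := h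
  obtain ⟨m, hm, h1⟩ := toH_zero J _ _ e h0
  have := ER.natX (PR J n) _ (ModuleCat.of R M) (PR J m) (fac J hm) (tauC J hm) 
    (tauC_comm J hm) he
  rw [h1] at this
  exact ⟨m, hm, congrArg ModuleCat.Hom.hom (ER.zero_zero _ _ this)⟩

lemma Rep.cobdry (g : CX J n i →ₗ[R] M) : Rep n (g ∘ₗ cd J n i) 0 :=
  ⟨0, ER.succ_zero (PR J n) i (ModuleCat.of R M) (ModuleCat.ofHom g), map_zero _⟩

lemma Rep.zero : Rep n (0 : CX J n i →ₗ[R] M) 0 := by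
  obtain ⟨ξ, h⟩ := Rep.mk (J := J) (f := (0 : CX J n i →ₗ[R] M)) (by simp)
  simpa using h.smul 0

/-- Functoriality of local cohomology. -/
noncomputable def hmap (J : Ideal R) (i : ℕ) (φ : M →ₗ[R] N) : lcoh J i M →ₗ[R] lcoh J i N :=
  ((localCohomology J i).map (ModuleCat.ofHom φ)).hom

lemma Rep.map {f : CX J n i →ₗ[R] M} {ξ} (h : Rep n f ξ) (φ : M →ₗ[R] N) :
    Rep n (φ ∘ₗ f) (hmap J i φ ξ) := by
  obtain ⟨e, he, rfl⟩ := h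
  exact ⟨_, ER.natY (PR J n) i (ModuleCat.ofHom φ) he, toH_nat J i (ModuleCat.ofHom φ) e⟩

end RepPart
end LC

namespace LC

section RelMap
variable {R : Type*} [CommRing R] {A B : Type*} [AddCommGroup A] [Module R A]
  [AddCommGroup B] [Module R B]

/-- A total functional linear relation gives a linear map. -/
lemma relMap_exists (r : A → B → Prop) (ex : ∀ a, ∃ b, r a b) (hadd : ∀ a b a' b', r a b → r a' b' →
    r (a + a') (b + b')) (smul : ∀ (c : R) a b, r a b → r (c • a) (c • b))
    (z : ∀ b, r 0 b → b = 0) : ∃ F : A →ₗ[R] B, ∀ a b, r a b ↔ F a = b := by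
  have uq : ∀ a b b', r a b → r a b' → b = b' := by
    intro a b b' h h'
    have := hadd _ _ _ _ h (smul (-1) _ _ h')
    simp only [neg_smul, one_smul, add_neg_cancel] at this
    exact sub_eq_zero.1 ((sub_eq_add_neg b b').trans (z _ this))
  choose F hF using ex
  refine ⟨{ toFun := F, map_add' := ?_, map_smul' := ?_ }, ?_⟩
  · intro a a'; exact uq _ _ _ (hF _) (hadd _ _ _ _ (hF a) (hF a'))
  · intro c a; exact uq _ _ _ (hF _) (smul _ _ _ (hF a))
  · intro a b
    constructor
    · intro h; exact uq _ _ _ (hF a) h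
    · rintro rfl; exact hF a

lemma exists_lift_inj {X : Type*} [AddCommGroup X] [Module R X] (α : A →ₗ[R] B)
    (hα : Function.Injective α) (k : X →ₗ[R] B) (h : ∀ x, ∃ a, α a = k x) :
    ∃ v : X →ₗ[R] A, α ∘ₗ v = k := by
  choose v hv using h
  refine ⟨{ toFun := v, map_add' := ?_, map_smul' := ?_ }, ?_⟩
  · intro a a'; apply hα; simp [hv]
  · intro c a; apply hα; simp [hv]
  · ext x; exact hv x
end RelMap

section
variable {R : Type u} [CommRing R] (J : Ideal R)
variable {M : Type u} [AddCommGroup M] [Module R M] {N : Type u} [AddCommGroup N] [Module R N]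
 {L : Type u} [AddCommGroup L] [Module R L]

lemma Rep.eq_of_eq {i n : ℕ} {f g : CX J n i →ₗ[R] M} {ξ η} (h : Rep n f ξ) (h' : Rep n g η)
    (e : f = g) : ξ = η := by subst e; exact h.uniq h'

lemma hmap_id (i : ℕ) (ξ : lcoh J i M) : hmap J i (LinearMap.id : M →ₗ[R] M) ξ = ξ := by
  obtain ⟨n, f, hf⟩ := Rep.ex ξ
  exact (hf.map LinearMap.id).eq_of_eq J hf (by simp)

lemma hmap_comp (i : ℕ) (φ : M →ₗ[R] N) (ψ : N →ₗ[R] L) (ξ : lcoh J i M) :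
    hmap J i (ψ ∘ₗ φ) ξ = hmap J i ψ (hmap J i φ ξ) := by
  obtain ⟨n, f, hf⟩ := Rep.ex ξ
  exact (hf.map _).eq_of_eq J ((hf.map _).map _) (by rw [LinearMap.comp_assoc])

lemma hmap_smul (i : ℕ) (r : R) (φ : M →ₗ[R] N) (ξ : lcoh J i M) :
    hmap J i (r • φ) ξ = r • hmap J i φ ξ := by
  obtain ⟨n, f, hf⟩ := Rep.ex ξ
  exact (hf.map _).eq_of_eq J ((hf.map φ).smul r) (by rw [LinearMap.smul_comp])

lemma hmap_lsmul (i : ℕ) (r : R) (ξ : lcoh J i M) :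
    hmap J i (r • (LinearMap.id : M →ₗ[R] M)) ξ = r • ξ := by
  rw [hmap_smul, hmap_id]

lemma hmap_zero (i : ℕ) (ξ : lcoh J i M) : hmap J i (0 : M →ₗ[R] N) ξ = 0 := by
  have := hmap_smul J i 0 (0 : M →ₗ[R] N) ξ
  simpa using this

lemma Rep.max {i n m : ℕ} {f : CX J n i →ₗ[R] M} {g : CX J m i →ₗ[R] N} {ξ η} (h : Rep n f ξ)
    (h' : Rep m g η) : ∃ k, ∃ hn : n ≤ k, ∃ hm : m ≤ k,
      Rep k (f ∘ₗ ct J hn i) ξ ∧ Rep k (g ∘ₗ ct J hm i) η :=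
  ⟨_, le_max_left _ _, le_max_right _ _, h.trans _, h'.trans _⟩

/-- Torsion submodule. -/
def Gam (M : Type u) [AddCommGroup M] [Module R M] : Submodule R M where
  carrier := {m | ∃ k : ℕ, ∀ r ∈ J ^ k, r • m = 0}
  zero_mem' := ⟨0, by simp⟩
  add_mem' := by
    rintro a b ⟨k, hk⟩ ⟨l, hl⟩
    refine ⟨max k l, fun r hr => ?_⟩
    rw [smul_add, hk r (Ideal.pow_le_pow_right (le_max_left _ _) hr),
      hl r (Ideal.pow_le_pow_right (le_max_right _ _) hr), add_zero]
  smul_mem' := by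
    rintro c a ⟨k, hk⟩
    refine ⟨k, fun r hr => ?_⟩
    rw [smul_comm, hk r hr, smul_zero]

lemma mem_Gam {m : M} : m ∈ Gam J M ↔ ∃ k : ℕ, ∀ r ∈ J ^ k, r • m = 0 := Iff.rfl

lemma Gam_map (φ : M →ₗ[R] N) {m : M} (h : m ∈ Gam J M) : φ m ∈ Gam J N := by
  obtain ⟨k, hk⟩ := h
  exact ⟨k, fun r hr => by rw [← map_smul, hk r hr, map_zero]⟩

/-- relation defining `iota`. -/
def IotaRel (ξ : lcoh J 0 M) (m : M) : Prop :=
  ∃ n, ∃ f : CX J n 0 →ₗ[R] M, Rep n f ξ ∧ ∀ c r, ce J n c = Ideal.Quotient.mk _ r → f c = r • m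

lemma ce_ct_mk {n m : ℕ} (h : n ≤ m) (c : CX J m 0) (r : R)
    (hc : ce J m c = Ideal.Quotient.mk _ r) : ce J n (ct J h 0 c) = Ideal.Quotient.mk _ r := by
  rw [ce_ct, hc]; rfl

lemma iota_exists : ∃ F : lcoh J 0 M →ₗ[R] M, ∀ a b, IotaRel J a b ↔ F a = b := by
  apply relMap_exists
  · intro ξ
    obtain ⟨n, f, hf⟩ := Rep.ex ξ
    obtain ⟨c₁, h₁⟩ := ce_surj J n (Ideal.Quotient.mk _ 1)
    refine ⟨f c₁, n, f, hf, fun c r hc => ?_⟩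
    have : ce J n (c - r • c₁) = 0 := by
      rw [map_sub, map_smul, hc, h₁, sub_eq_zero, ← Ideal.Quotient.mk_eq_mk,
        ← Ideal.Quotient.mk_eq_mk, ← Submodule.Quotient.mk_smul]; simp
    obtain ⟨y, hy⟩ := ce_exact J n _ this
    have h2 : f (cd J n 0 y) = 0 := LinearMap.congr_fun hf.cocycle y
    rw [hy, map_sub, sub_eq_zero, map_smul] at h2
    exact h2
  · rintro ξ m ξ' m' ⟨n, f, hf, h⟩ ⟨n', f', hf', h'⟩
    obtain ⟨k, hn, hm, r1, r2⟩ := hf.max J hf'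
    refine ⟨k, _, r1.add r2, fun c r hc => ?_⟩
    simp only [LinearMap.add_apply, LinearMap.comp_apply]
    rw [h _ r (ce_ct_mk J _ _ _ hc), h' _ r (ce_ct_mk J _ _ _ hc), smul_add]
  · rintro s ξ m ⟨n, f, hf, h⟩
    refine ⟨n, _, hf.smul s, fun c r hc => ?_⟩
    rw [LinearMap.smul_apply, h c r hc, smul_comm]
  · rintro m ⟨n, f, hf, h⟩
    obtain ⟨k, hk, h0⟩ := hf.zero_zero
    obtain ⟨c₁, h₁⟩ := ce_surj J k (Ideal.Quotient.mk _ 1)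
    have := h _ 1 (ce_ct_mk J hk _ _ h₁)
    rw [one_smul] at this
    rw [← this]
    exact LinearMap.congr_fun h0 c₁

/-- `H^0_J(M) → M`. -/
noncomputable def iota : lcoh J 0 M →ₗ[R] M := (iota_exists J).choose

lemma iota_spec (ξ : lcoh J 0 M) (m : M) : IotaRel J ξ m ↔ iota J ξ = m :=
  (iota_exists J).choose_spec ξ m

lemma iota_nat (φ : M →ₗ[R] N) (ξ : lcoh J 0 M) : iota J (hmap J 0 φ ξ) = φ (iota J ξ) := by
  obtain ⟨n, f, hf, h⟩ := (iota_spec J ξ _).2 rfl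
  refine (iota_spec J _ _).1 ⟨n, _, hf.map φ, fun c r hc => ?_⟩
  rw [LinearMap.comp_apply, h c r hc, map_smul]

lemma iota_inj : Function.Injective (iota J : lcoh J 0 M →ₗ[R] M) := by
  rw [injective_iff_map_eq_zero]
  intro ξ hξ
  obtain ⟨n, f, hf, h⟩ := (iota_spec J ξ _).2 hξ
  refine hf.eq_of_eq J Rep.zero ?_
  ext c
  obtain ⟨r, hr⟩ := Ideal.Quotient.mk_surjective (ce J n c)
  rw [h c r hr.symm, smul_zero]; rfl

lemma iota_mem (ξ : lcoh J 0 M) : iota J ξ ∈ Gam J M := by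
  obtain ⟨n, f, hf, h⟩ := (iota_spec J ξ _).2 rfl
  obtain ⟨c₁, h₁⟩ := ce_surj J n (Ideal.Quotient.mk _ 1)
  refine ⟨n, fun r hr => ?_⟩
  have h1 := h c₁ 1 h₁
  rw [one_smul] at h1
  rw [← h1, ← map_smul, h _ 0, zero_smul]
  rw [map_smul, h₁, ← Ideal.Quotient.mk_eq_mk, ← Ideal.Quotient.mk_eq_mk,
    ← Submodule.Quotient.mk_smul]
  simp only [smul_eq_mul, mul_one, Ideal.Quotient.mk_eq_mk, map_zero]
  exact Ideal.Quotient.eq_zero_iff_mem.2 hr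

lemma iota_surj (m : M) (hm : m ∈ Gam J M) : ∃ ξ, iota J ξ = m := by
  obtain ⟨k, hk⟩ := hm
  let g : (R ⧸ J ^ k) →ₗ[R] M := (J ^ k).liftQ (LinearMap.toSpanSingleton R M m) (fun r hr => by
    simpa using hk r hr)
  obtain ⟨ξ, hξ⟩ := Rep.mk (J := J) (f := g ∘ₗ ce J k) (by
    rw [LinearMap.comp_assoc, ce_cd, LinearMap.comp_zero])
  refine ⟨ξ, (iota_spec J _ _).1 ⟨k, _, hξ, fun c r hc => ?_⟩⟩
  rw [LinearMap.comp_apply, hc]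
  exact Submodule.liftQ_apply _ _ _

end

section Delta
variable {R : Type u} [CommRing R] (J : Ideal R)
variable {A : Type u} [AddCommGroup A] [Module R A] {B : Type u} [AddCommGroup B] [Module R B]
 {C : Type u} [AddCommGroup C] [Module R C]
variable {A' : Type u} [AddCommGroup A'] [Module R A'] {B' : Type u} [AddCommGroup B'] [Module R B']
 {C' : Type u} [AddCommGroup C'] [Module R C']

/-- Short exact sequence. -/
structure SES (α : A →ₗ[R] B) (β : B →ₗ[R] C) : Prop where
  inj : Function.Injective α
  surj : Function.Surjective β
  zero : ∀ a, β (α a) = 0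
  ex : ∀ b, β b = 0 → ∃ a, α a = b

/-- relation defining the connecting map -/
def DRel (α : A →ₗ[R] B) (β : B →ₗ[R] C) (i : ℕ) (ξ : lcoh J i C) (η : lcoh J (i+1) A) : Prop :=
  ∃ n, ∃ f : CX J n i →ₗ[R] C, ∃ g : CX J n i →ₗ[R] B, ∃ h : CX J n (i+1) →ₗ[R] A,
    Rep n f ξ ∧ β ∘ₗ g = f ∧ α ∘ₗ h = g ∘ₗ cd J n i ∧ Rep n h η

variable {α : A →ₗ[R] B} {β : B →ₗ[R] C} {i : ℕ}
variable {α' : A' →ₗ[R] B'} {β' : B' →ₗ[R] C'}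

lemma SES.lift_ker (S : SES α β) {X : Type u} [AddCommGroup X] [Module R X] (k : X →ₗ[R] B)
    (h : β ∘ₗ k = 0) : ∃ v : X →ₗ[R] A, α ∘ₗ v = k :=
  exists_lift_inj α S.inj k (fun x => S.ex _ (LinearMap.congr_fun h x))

lemma SES.cancel (S : SES α β) {X : Type u} [AddCommGroup X] [Module R X] {k l : X →ₗ[R] A}
    (h : α ∘ₗ k = α ∘ₗ l) : k = l := by
  ext x; exact S.inj (LinearMap.congr_fun h x)

lemma SES.comp_zero (S : SES α β) : β ∘ₗ α = 0 := by
  ext x; exact S.zero x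

/-- killing the class of a map: either zero or a coboundary; lifted through `β`. -/
lemma SES.zero_lift (S : SES α β) {n : ℕ} {f : CX J n i →ₗ[R] C} (hf : Rep n f 0) :
    ∃ m, ∃ hm : n ≤ m, ∃ w : CX J m i →ₗ[R] B, w ∘ₗ cd J m i = 0 ∧ Rep m w 0 ∧
      f ∘ₗ ct J hm i = β ∘ₗ w := by
  rcases i with _ | i
  · obtain ⟨m, hm, h⟩ := hf.zero_zero
    exact ⟨m, hm, 0, by simp, Rep.zero, by simp [h]⟩
  · obtain ⟨m, hm, g, hg⟩ := hf.zero_succ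
    obtain ⟨u, hu⟩ := Module.projective_lifting_property β g S.surj
    refine ⟨m, hm, u ∘ₗ cd J m i, ?_, Rep.cobdry _, ?_⟩
    · rw [LinearMap.comp_assoc, cd_cd, LinearMap.comp_zero]
    · rw [hg, ← LinearMap.comp_assoc, hu]

lemma DRel.up {n m : ℕ} (hm : n ≤ m) {g : CX J n i →ₗ[R] B}
    {h : CX J n (i+1) →ₗ[R] A} (e : α ∘ₗ h = g ∘ₗ cd J n i) :
    α ∘ₗ (h ∘ₗ ct J hm (i+1)) = (g ∘ₗ ct J hm i) ∘ₗ cd J m i := by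
  rw [LinearMap.comp_assoc, ct_cd, ← LinearMap.comp_assoc, e, LinearMap.comp_assoc]

lemma delta_exists (S : SES α β) (i : ℕ) :
    ∃ F : lcoh J i C →ₗ[R] lcoh J (i+1) A, ∀ a b, DRel J α β i a b ↔ F a = b := by
  apply relMap_exists
  · intro ξ
    obtain ⟨n, f, hf⟩ := Rep.ex ξ
    obtain ⟨g, hg⟩ := Module.projective_lifting_property β f S.surj
    obtain ⟨h, hh⟩ := S.lift_ker (g ∘ₗ cd J n i) (by rw [← LinearMap.comp_assoc, hg, hf.cocycle])
    obtain ⟨η, hη⟩ := Rep.mk (f := h) (S.cancel (by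
      rw [← LinearMap.comp_assoc, hh, LinearMap.comp_assoc, cd_cd]; simp))
    exact ⟨η, n, f, g, h, hf, hg, hh, hη⟩
  · rintro ξ η ξ' η' ⟨n, f, g, h, hf, hg, hh, hη⟩ ⟨n', f', g', h', hf', hg', hh', hη'⟩
    obtain ⟨k, hn, hm, r1, r2⟩ := hf.max J hf'
    refine ⟨k, _, g ∘ₗ ct J hn i + g' ∘ₗ ct J hm i, _, r1.add r2, ?_, ?_,
      (hη.trans hn).add (hη'.trans hm)⟩
    · rw [LinearMap.comp_add, ← LinearMap.comp_assoc, hg, ← LinearMap.comp_assoc, hg']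
    · rw [LinearMap.comp_add, DRel.up J hn hh, DRel.up J hm hh', LinearMap.add_comp]
  · rintro s ξ η ⟨n, f, g, h, hf, hg, hh, hη⟩
    refine ⟨n, _, s • g, _, hf.smul s, ?_, ?_, hη.smul s⟩
    · rw [LinearMap.comp_smul, hg]
    · rw [LinearMap.comp_smul, hh, LinearMap.smul_comp]
  · rintro η ⟨n, f, g, h, hf, hg, hh, hη⟩
    obtain ⟨m, hm, w, hw, -, hfw⟩ := S.zero_lift J hf
    obtain ⟨v, hv⟩ := S.lift_ker (g ∘ₗ ct J hm i - w) (by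
      rw [LinearMap.comp_sub, ← hfw, ← LinearMap.comp_assoc, hg, sub_self])
    refine (hη.trans hm).eq_of_eq J (Rep.cobdry v) (S.cancel ?_)
    rw [DRel.up J hm hh, ← LinearMap.comp_assoc, hv, LinearMap.sub_comp, hw, sub_zero]

/-- connecting homomorphism. -/
noncomputable def delta (S : SES α β) (i : ℕ) : lcoh J i C →ₗ[R] lcoh J (i+1) A :=
  (delta_exists J S i).choose

lemma delta_spec (S : SES α β) (ξ : lcoh J i C) (η) : DRel J α β i ξ η ↔ delta J S i ξ = η :=
  (delta_exists J S i).choose_spec ξ η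

lemma delta_hmap (S : SES α β) (ζ : lcoh J i B) : delta J S i (hmap J i β ζ) = 0 := by
  obtain ⟨n, f, hf⟩ := Rep.ex ζ
  refine (delta_spec J S _ _).1 ⟨n, _, f, 0, hf.map β, rfl, ?_, Rep.zero⟩
  rw [hf.cocycle]; simp

lemma hmap_delta (S : SES α β) (ξ : lcoh J i C) : hmap J (i+1) α (delta J S i ξ) = 0 := by
  obtain ⟨n, f, g, h, hf, hg, hh, hη⟩ := (delta_spec J S ξ _).2 rfl
  exact (hη.map α).eq_of_eq J (Rep.cobdry g) hh

lemma exact_B (S : SES α β) (ζ : lcoh J i B) (h0 : hmap J i β ζ = 0) :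
    ∃ ξ, hmap J i α ξ = ζ := by
  obtain ⟨n, f, hf⟩ := Rep.ex ζ
  have h1 := hf.map β
  rw [h0] at h1
  obtain ⟨m, hm, w, hw, hr, hfw⟩ := S.zero_lift J h1
  have h2 := (hf.trans hm).add (hr.smul (-1))
  obtain ⟨v, hv⟩ := S.lift_ker (f ∘ₗ ct J hm i + (-1 : R) • w) (by
      rw [LinearMap.comp_add, LinearMap.comp_smul, ← hfw, ← LinearMap.comp_assoc]; simp)
  obtain ⟨ξ, hξ⟩ := Rep.mk (f := v) (S.cancel (by
    rw [← LinearMap.comp_assoc, hv, h2.cocycle]; simp))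
  refine ⟨ξ, ((hξ.map α).eq_of_eq J h2 hv).trans ?_⟩
  simp

lemma exact_C (S : SES α β) (ξ : lcoh J i C) (h0 : delta J S i ξ = 0) :
    ∃ ζ, hmap J i β ζ = ξ := by
  obtain ⟨n, f, g, h, hf, hg, hh, hη⟩ := (delta_spec J S ξ _).2 h0
  obtain ⟨m, hm, v, hv⟩ := hη.zero_succ
  have hu := DRel.up J hm hh
  obtain ⟨ζ, hζ⟩ := Rep.mk (f := g ∘ₗ ct J hm i - α ∘ₗ v) (by
    rw [LinearMap.sub_comp, ← hu, hv, LinearMap.comp_assoc, sub_self])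
  refine ⟨ζ, (hζ.map β).eq_of_eq J (hf.trans hm) ?_⟩
  rw [LinearMap.comp_sub, ← LinearMap.comp_assoc, ← LinearMap.comp_assoc, hg, S.comp_zero]; simp

lemma exact_A (S : SES α β) (η : lcoh J (i+1) A) (h0 : hmap J (i+1) α η = 0) :
    ∃ ξ, delta J S i ξ = η := by
  obtain ⟨n, h, hh⟩ := Rep.ex η
  have h1 := hh.map α
  rw [h0] at h1
  obtain ⟨m, hm, g, hg⟩ := h1.zero_succ
  rw [LinearMap.comp_assoc] at hg
  obtain ⟨ξ, hξ⟩ := Rep.mk (f := β ∘ₗ g) (by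
    rw [LinearMap.comp_assoc, ← hg, ← LinearMap.comp_assoc, S.comp_zero, LinearMap.zero_comp])
  exact ⟨ξ, (delta_spec J S _ _).1 ⟨m, _, g, _, hξ, rfl, hg, hh.trans hm⟩⟩

lemma delta_nat (S : SES α β) (S' : SES α' β') (a : A →ₗ[R] A') (b : B →ₗ[R] B') (c : C →ₗ[R] C')
    (h1 : b ∘ₗ α = α' ∘ₗ a) (h2 : c ∘ₗ β = β' ∘ₗ b) (ξ : lcoh J i C) :
    delta J S' i (hmap J i c ξ) = hmap J (i+1) a (delta J S i ξ) := by
  obtain ⟨n, f, g, h, hf, hg, hh, hη⟩ := (delta_spec J S ξ _).2 rfl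
  refine (delta_spec J S' _ _).1 ⟨n, _, b ∘ₗ g, a ∘ₗ h, hf.map c, ?_, ?_, hη.map a⟩
  · rw [← hg, ← LinearMap.comp_assoc, ← LinearMap.comp_assoc, h2]
  · rw [← LinearMap.comp_assoc, ← h1, LinearMap.comp_assoc, hh, LinearMap.comp_assoc]

end Delta
end LC

namespace LC

section Vanish
variable {R : Type u} [CommRing R] (J : Ideal R)
variable {M : Type u} [AddCommGroup M] [Module R M] {N : Type u} [AddCommGroup N] [Module R N]

lemma lcoh_injective [Module.Injective R M] (i : ℕ) (ξ : lcoh J (i+1) M) : ξ = 0 := by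
  obtain ⟨n, f, hf⟩ := Rep.ex ξ
  let p := (cd J n i).rangeRestrict
  have hp : Function.Surjective p := LinearMap.surjective_rangeRestrict _
  have hk : LinearMap.ker p ≤ LinearMap.ker f := by
    intro x hx
    rw [LinearMap.mem_ker] at hx ⊢
    have : cd J n i x = 0 := congrArg Subtype.val hx
    obtain ⟨y, rfl⟩ := cd_exact J n i x this
    exact LinearMap.congr_fun hf.cocycle y
  obtain ⟨f', hf'⟩ : ∃ f' : LinearMap.range (cd J n i) →ₗ[R] M, f' ∘ₗ p = f := by
    let e := p.quotKerEquivOfSurjective hp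
    refine ⟨(LinearMap.ker p).liftQ f hk ∘ₗ e.symm.toLinearMap, ?_⟩
    ext x
    have : e.symm (p x) = Submodule.Quotient.mk x := by
      rw [LinearEquiv.symm_apply_eq]; rfl
    simp [this]
  obtain ⟨g, hg⟩ := Module.Injective.out (LinearMap.range (cd J n i)).subtype
    (Submodule.injective_subtype _) f'
  refine hf.eq_of_eq J (Rep.cobdry g) ?_
  rw [← hf']
  ext x
  exact (hg (p x)).symm

lemma Gam_uniform (S : Submodule R M) (hS : S.FG) (h : S ≤ Gam J M) :
    ∃ k : ℕ, ∀ x ∈ S, ∀ r ∈ J ^ k, r • x = 0 := by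
  induction S, hS using Submodule.fg_induction with
  | singleton x =>
    obtain ⟨k, hk⟩ := h (Submodule.mem_span_singleton_self x)
    refine ⟨k, fun y hy r hr => ?_⟩
    obtain ⟨a, rfl⟩ := Submodule.mem_span_singleton.1 hy
    rw [smul_comm, hk r hr, smul_zero]
  | sup S T _ _ h1 h2 =>
    obtain ⟨k, hk⟩ := h1 (le_sup_left.trans h)
    obtain ⟨l, hl⟩ := h2 (le_sup_right.trans h)
    refine ⟨max k l, fun y hy r hr => ?_⟩
    obtain ⟨a, ha, b, hb, rfl⟩ := Submodule.mem_sup.1 hy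
    rw [smul_add, hk a ha r (Ideal.pow_le_pow_right (le_max_left _ _) hr),
      hl b hb r (Ideal.pow_le_pow_right (le_max_right _ _) hr), add_zero]

lemma Gam_injective [IsNoetherianRing R] [Module.Injective R M] : Module.Injective R (Gam J M) := by
  apply Module.Baer.injective
  intro I g
  let g' : I →ₗ[R] M := (Gam J M).subtype ∘ₗ g
  obtain ⟨k, hk⟩ := Gam_uniform J (LinearMap.range g') (by
    exact Submodule.FG.of_finite) (by rintro _ ⟨x, rfl⟩; exact (g x).2)
  obtain ⟨c, hc⟩ := Ideal.exists_pow_inf_eq_pow_smul J (M := R) I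
  have hv : ∀ x : I, (x : R) ∈ J ^ (c + k) → g' x = 0 := by
    intro x hx
    have h1 := hc (c + k) (by omega)
    have h2 : (x : R) ∈ J ^ k • (J ^ c • ⊤ ⊓ I : Ideal R) := by
      rw [Nat.add_sub_cancel_left] at h1
      rw [← h1]
      exact ⟨by simpa using hx, x.2⟩
    have h3 : (x : R) ∈ J ^ k • I := (Submodule.smul_mono le_rfl inf_le_right : _ ≤ J ^ k • I) h2
    have : ∀ y ∈ J ^ k • I, ∃ hy : y ∈ I, g' ⟨y, hy⟩ = 0 := by
      intro y hy
      induction hy using Submodule.smul_induction_on' with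
      | smul r hr n hn =>
        refine ⟨I.smul_mem r hn, ?_⟩
        have := hk (g' ⟨n, hn⟩) ⟨_, rfl⟩ r hr
        rw [← map_smul] at this
        exact this
      | add y hy z hz h1 h2 =>
        obtain ⟨h1, h1'⟩ := h1
        obtain ⟨h2, h2'⟩ := h2
        refine ⟨I.add_mem h1 h2, ?_⟩
        have := map_add g' ⟨y, h1⟩ ⟨z, h2⟩
        rw [h1', h2', add_zero] at this
        exact this
    exact (this x h3).2
  let K : Submodule R I := Submodule.comap (Submodule.subtype I) (J ^ (c+k))
  let g'' : (I ⧸ K) →ₗ[R] M := K.liftQ g' (fun x hx => hv x hx)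
  let em : (I ⧸ K) →ₗ[R] (R ⧸ J ^ (c+k)) := Submodule.mapQ _ _ (Submodule.subtype I) le_rfl
  have hem : Function.Injective em := by
    rw [injective_iff_map_eq_zero]
    intro x hx
    obtain ⟨x, rfl⟩ := Submodule.Quotient.mk_surjective _ x
    rw [Submodule.mapQ_apply, Submodule.Quotient.mk_eq_zero] at hx
    exact (Submodule.Quotient.mk_eq_zero _).2 hx
  obtain ⟨h, hh⟩ := Module.Injective.out em hem g''
  have hG : ∀ x : R, h (Submodule.Quotient.mk x) ∈ Gam J M := by
    intro x
    refine ⟨c + k, fun r hr => ?_⟩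
    rw [← map_smul, ← Submodule.Quotient.mk_smul, (Submodule.Quotient.mk_eq_zero _).2, map_zero]
    exact Ideal.mul_mem_right _ _ hr
  refine ⟨(h ∘ₗ Submodule.mkQ _).codRestrict (Gam J M) hG, ?_⟩
  intro x hx
  apply Subtype.ext
  exact hh (Submodule.Quotient.mk ⟨x, hx⟩)

lemma exists_inj_embed (T : Type u) [AddCommGroup T] [Module R T] :
    ∃ (E : Type u) (_ : AddCommGroup E) (_ : Module R E) (_ : Module.Injective R E)
      (φ : T →ₗ[R] E), Function.Injective φ := by
  obtain ⟨⟨I, hI, f, hf⟩⟩ := CategoryTheory.EnoughInjectives.presentation (ModuleCat.of R T)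
  refine ⟨I, inferInstance, inferInstance, ?_, f.hom, (ModuleCat.mono_iff_injective f).1 hf⟩
  exact (Module.injective_iff_injective_object R I).2 hI

lemma SES.quot (φ : M →ₗ[R] N) (hφ : Function.Injective φ) :
    SES φ (LinearMap.range φ).mkQ where
  inj := hφ
  surj := Submodule.mkQ_surjective _
  zero a := by simp
  ex b hb := by simpa using hb

lemma lcoh_torsion [IsNoetherianRing R] (i : ℕ) : ∀ (T : Type u) [AddCommGroup T] [Module R T]
    (_ : ∀ x : T, x ∈ Gam J T) (ξ : lcoh J (i+1) T), ξ = 0 := by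
  induction i with
  | zero =>
    intro T _ _ hT ξ
    obtain ⟨E, _, _, hE, φ, hφ⟩ := exists_inj_embed (R := R) T
    have := Gam_injective J (M := E)
    let ψ : T →ₗ[R] Gam J E := φ.codRestrict _ (fun x => Gam_map J φ (hT x))
    have hψ : Function.Injective ψ := fun x y h => hφ (congrArg Subtype.val h)
    have S := SES.quot ψ hψ
    obtain ⟨ζ, rfl⟩ := exact_A J S ξ (lcoh_injective J _ _)
    obtain ⟨y, hy⟩ := Submodule.mkQ_surjective _ (iota J ζ)
    have hyG : y ∈ Gam J (Gam J E) := by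
      obtain ⟨k, hk⟩ := y.2
      exact ⟨k, fun r hr => Subtype.ext (hk r hr)⟩
    obtain ⟨z, hz⟩ := iota_surj J y hyG
    have : ζ = hmap J 0 (LinearMap.range ψ).mkQ z := by
      apply iota_inj
      rw [iota_nat, hz, hy]
    rw [this, delta_hmap]
  | succ i ih =>
    intro T _ _ hT ξ
    obtain ⟨E, _, _, hE, φ, hφ⟩ := exists_inj_embed (R := R) T
    have := Gam_injective J (M := E)
    let ψ : T →ₗ[R] Gam J E := φ.codRestrict _ (fun x => Gam_map J φ (hT x))
    have hψ : Function.Injective ψ := fun x y h => hφ (congrArg Subtype.val h)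
    have S := SES.quot ψ hψ
    obtain ⟨ζ, rfl⟩ := exact_A J S ξ (lcoh_injective J _ _)
    have : ζ = 0 := by
      apply ih
      intro x
      obtain ⟨y, rfl⟩ := Submodule.mkQ_surjective _ x
      apply Gam_map
      obtain ⟨k, hk⟩ := y.2
      exact ⟨k, fun r hr => Subtype.ext (hk r hr)⟩
    rw [this, map_zero]

end Vanish

section Partial
variable {R : Type u} [CommRing R] [IsNoetherianRing R] (J : Ideal R)
variable {A : Type u} [AddCommGroup A] [Module R A] {B : Type u} [AddCommGroup B] [Module R B]
 {C : Type u} [AddCommGroup C] [Module R C]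
variable {A' : Type u} [AddCommGroup A'] [Module R A'] {B' : Type u} [AddCommGroup B'] [Module R B']
 {C' : Type u} [AddCommGroup C'] [Module R C']

/-- Exact sequence `A → B → C → 0` with `J`-torsion kernel. -/
structure TES (α : A →ₗ[R] B) (β : B →ₗ[R] C) : Prop where
  tors : ∀ a, α a = 0 → a ∈ Gam J A
  surj : Function.Surjective β
  zero : ∀ a, β (α a) = 0
  ex : ∀ b, β b = 0 → ∃ a, α a = b

variable {J}
variable {α : A →ₗ[R] B} {β : B →ₗ[R] C} {i : ℕ}
variable {α' : A' →ₗ[R] B'} {β' : B' →ₗ[R] C'}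

lemma TES.ses1 (_ : TES J α β) : SES (LinearMap.ker α).subtype α.rangeRestrict where
  inj := Submodule.injective_subtype _
  surj := LinearMap.surjective_rangeRestrict _
  zero a := by
    apply Subtype.ext
    exact a.2
  ex b hb := ⟨⟨b, congrArg Subtype.val hb⟩, rfl⟩

lemma TES.ses2 (T : TES J α β) : SES (LinearMap.range α).subtype β where
  inj := Submodule.injective_subtype _
  surj := T.surj
  zero a := by obtain ⟨_, a, rfl⟩ := a; exact T.zero a
  ex b hb := by
    obtain ⟨a, rfl⟩ := T.ex b hb
    exact ⟨⟨_, a, rfl⟩, rfl⟩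

lemma TES.ker_tors (T : TES J α β) (x : LinearMap.ker α) : x ∈ Gam J (LinearMap.ker α) := by
  obtain ⟨k, hk⟩ := T.tors x x.2
  exact ⟨k, fun r hr => Subtype.ext (hk r hr)⟩

lemma TES.bij (T : TES J α β) (i : ℕ) :
    Function.Bijective (hmap J (i+1) α.rangeRestrict) := by
  constructor
  · rw [injective_iff_map_eq_zero]
    intro ξ hξ
    obtain ⟨η, rfl⟩ := exact_B J T.ses1 ξ hξ
    rw [lcoh_torsion J i _ T.ker_tors η, map_zero]
  · intro ξ
    exact exact_C J T.ses1 ξ (lcoh_torsion J _ _ T.ker_tors _)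

/-- Connecting map of a `TES`. -/
noncomputable def TES.del (T : TES J α β) (i : ℕ) : lcoh J i C →ₗ[R] lcoh J (i+1) A :=
  (LinearEquiv.ofBijective _ (T.bij i)).symm.toLinearMap ∘ₗ delta J T.ses2 i

lemma TES.del_eq (T : TES J α β) (i : ℕ) (ξ : lcoh J i C) :
    hmap J (i+1) α.rangeRestrict (T.del i ξ) = delta J T.ses2 i ξ :=
  (LinearEquiv.ofBijective _ (T.bij i)).apply_symm_apply _

lemma hmap_rr (α : A →ₗ[R] B) (i : ℕ) (ξ : lcoh J i A) : hmap J i α ξ =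
    hmap J i (LinearMap.range α).subtype (hmap J i α.rangeRestrict ξ) := by
  rw [← hmap_comp]; rfl

lemma TES.del_hmap (T : TES J α β) (i : ℕ) (ξ : lcoh J i B) : T.del i (hmap J i β ξ) = 0 := by
  apply (T.bij i).1
  rw [T.del_eq, delta_hmap, map_zero]

lemma TES.hmap_del (T : TES J α β) (i : ℕ) (ξ : lcoh J i C) : hmap J (i+1) α (T.del i ξ) = 0 := by
  rw [hmap_rr, T.del_eq, hmap_delta]

lemma TES.exact_C (T : TES J α β) (i : ℕ) (ξ : lcoh J i C) (h : T.del i ξ = 0) :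
    ∃ ζ, hmap J i β ζ = ξ := by
  apply LC.exact_C J T.ses2 ξ
  rw [← T.del_eq, h, map_zero]

lemma TES.exact_A (T : TES J α β) (i : ℕ) (η : lcoh J (i+1) A) (h : hmap J (i+1) α η = 0) :
    ∃ ζ, T.del i ζ = η := by
  rw [hmap_rr] at h
  obtain ⟨ζ, hζ⟩ := LC.exact_A J T.ses2 _ h
  refine ⟨ζ, (T.bij i).1 ?_⟩
  rw [T.del_eq, hζ]

lemma TES.exact_B (T : TES J α β) (i : ℕ) (η : lcoh J (i+1) B) (h : hmap J (i+1) β η = 0) :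
    ∃ ζ, hmap J (i+1) α ζ = η := by
  obtain ⟨ζ, hζ⟩ := LC.exact_B J T.ses2 _ h
  obtain ⟨ζ, rfl⟩ := (T.bij i).2 ζ
  exact ⟨ζ, by rw [hmap_rr, hζ]⟩

lemma TES.del_nat (T : TES J α β) (T' : TES J α' β') (a : A →ₗ[R] A') (b : B →ₗ[R] B')
    (c : C →ₗ[R] C') (h1 : b ∘ₗ α = α' ∘ₗ a) (h2 : c ∘ₗ β = β' ∘ₗ b) (ξ : lcoh J i C) :
    T'.del i (hmap J i c ξ) = hmap J (i+1) a (T.del i ξ) := by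
  apply (T'.bij i).1
  have hb : ∀ x : LinearMap.range α, (b ∘ₗ (LinearMap.range α).subtype) x ∈ LinearMap.range α' := by
    rintro ⟨_, x, rfl⟩
    exact ⟨a x, (LinearMap.congr_fun h1 x).symm⟩
  let a' : LinearMap.range α →ₗ[R] LinearMap.range α' :=
    (b ∘ₗ (LinearMap.range α).subtype).codRestrict _ hb
  have key := delta_nat J T.ses2 T'.ses2 a' b c (by ext x; rfl) h2 ξ
  rw [T'.del_eq, key, ← T.del_eq, ← hmap_comp, ← hmap_comp]
  congr 2
  ext x
  exact LinearMap.congr_fun h1 x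

end Partial
end LC

namespace LC

section Quot
variable {R : Type u} [CommRing R]
variable {M : Type u} [AddCommGroup M] [Module R M] {N : Type u} [AddCommGroup N] [Module R N]
  {L : Type u} [AddCommGroup L] [Module R L]

/-- multiplication by `x`. -/
def mulx (x : R) (M : Type u) [AddCommGroup M] [Module R M] : M →ₗ[R] M := x • LinearMap.id

/-- `M/xM`. -/
abbrev Qd (x : R) (M : Type u) [AddCommGroup M] [Module R M] : Type u :=
  M ⧸ LinearMap.range (mulx x M)

/-- `M → M/xM`. -/
def pr (x : R) (M : Type u) [AddCommGroup M] [Module R M] : M →ₗ[R] Qd x M :=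
  Submodule.mkQ _

lemma pr_surj (x : R) : Function.Surjective (pr x M) := Submodule.mkQ_surjective _

lemma pr_eq_zero {x : R} {m : M} : pr x M m = 0 ↔ ∃ n, x • n = m := by
  unfold pr
  rw [Submodule.mkQ_apply, Submodule.Quotient.mk_eq_zero, LinearMap.mem_range]
  rfl

lemma pr_smul_self (x : R) (m : M) : pr x M (x • m) = 0 := pr_eq_zero.2 ⟨m, rfl⟩

lemma smul_Qd (x : R) (m : Qd x M) : x • m = 0 := by
  obtain ⟨m, rfl⟩ := pr_surj x m
  rw [← map_smul, pr_smul_self]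

lemma pr_eq {x : R} {m m' : M} (h : pr x M m = pr x M m') : ∃ p, m = m' + x • p := by
  rw [← sub_eq_zero, ← map_sub, pr_eq_zero] at h
  obtain ⟨p, hp⟩ := h
  exact ⟨p, by rw [hp]; abel⟩

/-- General induced map on quotients. -/
def ql (x y : R) (φ : M →ₗ[R] N) (h : ∀ m, ∃ n, φ (x • m) = y • n) : Qd x M →ₗ[R] Qd y N :=
  Submodule.mapQ _ _ φ (by
    rintro _ ⟨m, rfl⟩
    obtain ⟨n, hn⟩ := h m
    exact ⟨n, hn.symm⟩)

lemma ql_pr (x y : R) (φ : M →ₗ[R] N) (h) (m : M) : ql x y φ h (pr x M m) = pr y N (φ m) := rfl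

lemma ql_comp (x y : R) (φ : M →ₗ[R] N) (h) : ql x y φ h ∘ₗ pr x M = pr y N ∘ₗ φ := rfl

lemma Qd_ext {x : R} {f g : Qd x M →ₗ[R] L} (h : ∀ m, f (pr x M m) = g (pr x M m)) : f = g := by
  ext m; exact h m

/-- functoriality of `M/xM`. -/
def qmap (x : R) (φ : M →ₗ[R] N) : Qd x M →ₗ[R] Qd x N := ql x x φ (fun m => ⟨φ m, map_smul _ _ _⟩)

lemma qmap_pr (x : R) (φ : M →ₗ[R] N) (m : M) : qmap x φ (pr x M m) = pr x N (φ m) := rfl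

/-- multiplication by `z` as a map `M/xM → M/yM` where `y = zx`. -/
def qmul (x z y : R) (h : z * x = y) (M : Type u) [AddCommGroup M] [Module R M] :
    Qd x M →ₗ[R] Qd y M :=
  ql x y (mulx z M) (fun m => ⟨m, by rw [← h, mul_smul]; rfl⟩)

lemma qmul_pr (x z y : R) (h : z * x = y) (m : M) :
    qmul x z y h M (pr x M m) = pr y M (z • m) := rfl

/-- equivalences on quotients -/
noncomputable def qequiv (x : R) (e : M ≃ₗ[R] N) : Qd x M ≃ₗ[R] Qd x N :=
  LinearEquiv.ofLinearMap (qmap x e.toLinearMap) (qmap x e.symm.toLinearMap)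
    (Qd_ext fun m => by rw [LinearMap.comp_apply, qmap_pr, qmap_pr]; simp)
    (Qd_ext fun m => by rw [LinearMap.comp_apply, qmap_pr, qmap_pr]; simp)

/-- the swap map. -/
def qswapMap (a b : R) (M : Type u) [AddCommGroup M] [Module R M] :
    Qd b (Qd a M) →ₗ[R] Qd a (Qd b M) :=
  Submodule.liftQ _ (qmap a (pr b M)) (by
    rintro _ ⟨m, rfl⟩
    obtain ⟨m, rfl⟩ := pr_surj a m
    rw [LinearMap.mem_ker]
    change qmap a (pr b M) (b • pr a M m) = 0
    rw [map_smul, qmap_pr, ← map_smul, smul_Qd, map_zero])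

lemma qswapMap_pr (a b : R) (m : M) :
    qswapMap a b M (pr b _ (pr a M m)) = pr a _ (pr b M m) := rfl

/-- `M/a/b = M/b/a`. -/
noncomputable def qswap (a b : R) (M : Type u) [AddCommGroup M] [Module R M] :
    Qd b (Qd a M) ≃ₗ[R] Qd a (Qd b M) :=
  LinearEquiv.ofLinearMap (qswapMap a b M) (qswapMap b a M)
    (Qd_ext fun m => by
      obtain ⟨m, rfl⟩ := pr_surj b m
      rw [LinearMap.comp_apply, qswapMap_pr, qswapMap_pr]; rfl)
    (Qd_ext fun m => by
      obtain ⟨m, rfl⟩ := pr_surj a m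
      rw [LinearMap.comp_apply, qswapMap_pr, qswapMap_pr]; rfl)

lemma qswap_pr (a b : R) (m : M) :
    qswap a b M (pr b _ (pr a M m)) = pr a _ (pr b M m) := rfl

end Quot

section FRsec
variable {R : Type u} [CommRing R] [IsNoetherianRing R] (J : Ideal R)
variable {M : Type u} [AddCommGroup M] [Module R M] {N : Type u} [AddCommGroup N] [Module R N]
  {L : Type u} [AddCommGroup L] [Module R L]

/-- filter regular element -/
def FR (x : R) (M : Type u) [AddCommGroup M] [Module R M] : Prop :=
  ∀ m : M, x • m = 0 → m ∈ Gam J M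

/-- `y` kills `H^i(M)` -/
def Kill (y : R) (i : ℕ) (M : Type u) [AddCommGroup M] [Module R M] : Prop :=
  ∀ ξ : lcoh J i M, y • ξ = 0

lemma Gam_of_smul {m : M} (k : ℕ) (h : ∀ r ∈ J ^ k, r • m ∈ Gam J M) : m ∈ Gam J M := by
  obtain ⟨l, hl⟩ := Gam_uniform J (Submodule.map (LinearMap.toSpanSingleton R M m) (J ^ k))
    (Submodule.FG.map _ (IsNoetherian.noetherian _)) (by
      rintro _ ⟨r, hr, rfl⟩; exact h r hr)
  refine ⟨l + k, fun r hr => ?_⟩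
  rw [pow_add] at hr
  refine Submodule.mul_induction_on hr (fun a ha b hb => ?_) (fun a b ha hb => ?_)
  · rw [mul_smul]
    exact hl _ ⟨b, hb, rfl⟩ a ha
  · rw [add_smul, ha, hb, add_zero]

variable {J}

lemma FR.gam {x : R} (h : FR J x M) {m : M} (hm : x • m ∈ Gam J M) : m ∈ Gam J M := by
  obtain ⟨k, hk⟩ := hm
  refine Gam_of_smul J k (fun r hr => h _ ?_)
  rw [smul_comm, hk r hr]

lemma FR.pow {x : R} (h : FR J x M) (n : ℕ) : FR J (x ^ n) M := by
  induction n with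
  | zero => intro m hm; rw [pow_zero, one_smul] at hm; rw [hm]; exact zero_mem _
  | succ n ih =>
    intro m hm
    rw [pow_succ, mul_smul] at hm
    exact h.gam (ih _ hm)

lemma FR.equiv {x : R} (h : FR J x M) (e : M ≃ₗ[R] N) : FR J x N := by
  intro m hm
  have := h (e.symm m) (by rw [← map_smul, hm, map_zero])
  simpa using Gam_map J e.toLinearMap this

lemma hmap_equiv_bij (e : M ≃ₗ[R] N) (i : ℕ) : Function.Bijective (hmap J i e.toLinearMap) := by
  constructor
  · apply Function.LeftInverse.injective (g := hmap J i e.symm.toLinearMap)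
    intro ξ
    rw [← hmap_comp]; simp [hmap_id]
  · apply Function.RightInverse.surjective (g := hmap J i e.symm.toLinearMap)
    intro ξ
    rw [← hmap_comp]; simp [hmap_id]

lemma Kill.equiv {y : R} {i : ℕ} (h : Kill J y i M) (e : M ≃ₗ[R] N) : Kill J y i N := by
  intro ξ
  obtain ⟨ξ, rfl⟩ := (hmap_equiv_bij e i).2 ξ
  rw [← map_smul, h, map_zero]

lemma kill_zero {y : R} : Kill J y 0 M ↔ ∀ m ∈ Gam J M, y • m = 0 := by
  constructor
  · intro h m hm
    obtain ⟨ξ, rfl⟩ := iota_surj J m hm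
    rw [← map_smul, h, map_zero]
  · intro h ξ
    apply iota_inj J
    rw [map_smul, h _ (iota_mem J ξ), map_zero]

lemma FR.tes {x : R} (h : FR J x M) : TES J (mulx x M) (pr x M) where
  tors := h
  surj := pr_surj x
  zero m := pr_smul_self x m
  ex _ hb := pr_eq_zero.1 hb

open Classical in
/-- Connecting map `H^i(M/xM) → H^{i+1}(M)`. -/
noncomputable def dlt (J : Ideal R) (x : R) (i : ℕ) (M : Type u) [AddCommGroup M] [Module R M] :
    lcoh J i (Qd x M) →ₗ[R] lcoh J (i+1) M :=
  if h : FR J x M then h.tes.del i else 0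

lemma dlt_eq {x : R} (h : FR J x M) (i : ℕ) : dlt J x i M = h.tes.del i := dif_pos h

lemma hmap_mulx (x : R) (i : ℕ) (ξ : lcoh J i M) : hmap J i (mulx x M) ξ = x • ξ :=
  hmap_lsmul J i x ξ

lemma dlt_hmap {x : R} (h : FR J x M) (i : ℕ) (ξ : lcoh J i M) :
    dlt J x i M (hmap J i (pr x M) ξ) = 0 := by
  rw [dlt_eq h, TES.del_hmap]

lemma dlt_ker {x : R} (h : FR J x M) (i : ℕ) (ξ : lcoh J i (Qd x M)) (h0 : dlt J x i M ξ = 0) :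
    ∃ ζ, hmap J i (pr x M) ζ = ξ := by
  rw [dlt_eq h] at h0
  exact h.tes.exact_C i ξ h0

lemma dlt_surj {x : R} (h : FR J x M) (i : ℕ) (η : lcoh J (i+1) M) (h0 : x • η = 0) :
    ∃ ζ, dlt J x i M ζ = η := by
  rw [dlt_eq h]
  exact h.tes.exact_A i η (by rw [hmap_mulx, h0])

/-- naturality in `M` -/
lemma dlt_nat {x : R} (h : FR J x M) (h' : FR J x N) (φ : M →ₗ[R] N) (i : ℕ)
    (ξ : lcoh J i (Qd x M)) :
    dlt J x i N (hmap J i (qmap x φ) ξ) = hmap J (i+1) φ (dlt J x i M ξ) := by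
  rw [dlt_eq h, dlt_eq h']
  exact TES.del_nat _ _ φ φ (qmap x φ) (by ext m; exact map_smul φ x m) rfl ξ

/-- comparison of `x` and `zx`. -/
lemma dlt_mul {x z y : R} (e : z * x = y) (h : FR J x M) (h' : FR J y M) (i : ℕ)
    (ξ : lcoh J i (Qd x M)) :
    dlt J y i M (hmap J i (qmul x z y e M) ξ) = dlt J x i M ξ := by
  rw [dlt_eq h, dlt_eq h']
  rw [TES.del_nat h.tes h'.tes LinearMap.id (mulx z M) (qmul x z y e M) (by
    ext m; change z • (x • m) = y • m; rw [← e, mul_smul]) rfl ξ, hmap_id]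

lemma hpr_inj {x : R} (h : FR J x M) {i : ℕ} (hk : Kill J x i M) :
    Function.Injective (hmap J i (pr x M)) := by
  rw [injective_iff_map_eq_zero]
  intro ξ hξ
  rcases i with _ | i
  · apply iota_inj J
    have := iota_nat J (pr x M) ξ
    rw [hξ, map_zero] at this
    obtain ⟨n, hn⟩ := pr_eq_zero.1 this.symm
    have hn2 : n ∈ Gam J M := h.gam (by rw [hn]; exact iota_mem J ξ)
    rw [map_zero, ← hn, kill_zero.1 hk n hn2]
  · obtain ⟨ζ, rfl⟩ := h.tes.exact_B i ξ hξ
    rw [hmap_mulx, hk]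

end FRsec
end LC

namespace LC

section QLsec
variable {R : Type u} [CommRing R]

/-- Iterated quotient. -/
noncomputable def QL : List R → ∀ (M : Type u) [AddCommGroup M] [Module R M], ModuleCat.{u} R
  | [], M, _, _ => ModuleCat.of R M
  | x :: l, M, _, _ => QL l (Qd x M)

/-- projection to the iterated quotient -/
noncomputable def prL : ∀ (l : List R) (M : Type u) [AddCommGroup M] [Module R M], M →ₗ[R] QL l M
  | [], _, _, _ => LinearMap.id
  | x :: l, M, _, _ => prL l (Qd x M) ∘ₗ pr x M

/-- functoriality of the iterated quotient -/
noncomputable def QLmap : ∀ (l : List R) {M : Type u} [AddCommGroup M] [Module R M]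
    {N : Type u} [AddCommGroup N] [Module R N] (_ : M →ₗ[R] N), QL l M →ₗ[R] QL l N
  | [], _, _, _, _, _, _, φ => φ
  | x :: l, _, _, _, _, _, _, φ => QLmap l (qmap x φ)

lemma prL_cons (x : R) (l : List R) {M : Type u} [AddCommGroup M] [Module R M] (m : M) :
    prL (x :: l) M m = prL l (Qd x M) (pr x M m) := rfl

lemma prL_surj : ∀ (l : List R) (M : Type u) [AddCommGroup M] [Module R M],
    Function.Surjective (prL l M)
  | [], _, _, _ => fun m => ⟨m, rfl⟩
  | x :: l, M, _, _ => by
    intro m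
    obtain ⟨m, rfl⟩ := prL_surj l (Qd x M) m
    obtain ⟨m, rfl⟩ := pr_surj x m
    exact ⟨m, rfl⟩

lemma QLmap_prL : ∀ (l : List R) {M : Type u} [AddCommGroup M] [Module R M]
    {N : Type u} [AddCommGroup N] [Module R N] (φ : M →ₗ[R] N) (m : M),
    QLmap l φ (prL l M m) = prL l N (φ m)
  | [], _, _, _, _, _, _, φ => fun m => rfl
  | x :: l, _, _, _, _, _, _, φ => fun m => by
    rw [prL_cons, prL_cons, ← qmap_pr]
    exact QLmap_prL l (qmap x φ) _

lemma prL_smul_mem (l : List R) (y : R) (hy : y ∈ l) : ∀ {M : Type u} [AddCommGroup M] [Module R M]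
    (m : M), prL l M (y • m) = 0 := by
  induction l with
  | nil => simp at hy
  | cons x l ih =>
    intro M _ _ m
    change prL l (Qd x M) (pr x M (y • m)) = (0 : QL l (Qd x M))
    rcases List.mem_cons.1 hy with rfl | h
    · rw [pr_smul_self, map_zero]
    · rw [map_smul, ih h]

lemma prL_ker (l : List R) : ∀ {M : Type u} [AddCommGroup M] [Module R M]
    (m : M), prL l M m = 0 ↔ m ∈ (Ideal.ofList l • ⊤ : Submodule R M) := by
  induction l with
  | nil => intro M _ _ m; simp [prL]; exact Iff.rfl
  | cons x l ih =>
    intro M _ _ m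
    refine (ih (pr x M m)).trans ?_
    rw [Ideal.ofList_cons_smul]
    have h1 : (⊤ : Submodule R (Qd x M)) = Submodule.map (pr x M) ⊤ := by
      rw [Submodule.map_top, LinearMap.range_eq_top.2 (pr_surj x)]
    rw [h1, ← Submodule.map_smul'']
    constructor
    · rintro ⟨m', hm', h⟩
      obtain ⟨p, hp⟩ := pr_eq h
      have : m = m' + x • (-p) := by rw [hp]; simp
      rw [this, add_comm]
      exact Submodule.add_mem_sup (Submodule.smul_mem_pointwise_smul _ _ _ trivial) hm'
    · intro h
      obtain ⟨a, ha, b, hb, rfl⟩ := Submodule.mem_sup.1 h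
      obtain ⟨p, -, rfl⟩ := ha
      refine ⟨b, hb, ?_⟩
      rw [map_add]
      change _ = pr x M (x • p) + _
      rw [pr_smul_self, zero_add]

end QLsec

section Stdsec
variable {R : Type u} [CommRing R] [IsNoetherianRing R] (J : Ideal R)

/-- Standard sequences, recursively. -/
def Std : List R → ℕ → ∀ (M : Type u) [AddCommGroup M] [Module R M], Prop
  | [], _, _, _, _ => True
  | x :: l, d, M, _, _ => FR J x M ∧ (∀ i < d, ∀ y ∈ x :: l, Kill J y i M) ∧ Std l (d - 1) (Qd x M)

variable {J}
lemma Std.kill {l : List R} {d : ℕ} {M : Type u} [AddCommGroup M] [Module R M] (h : Std J l d M)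
    {i : ℕ} (hi : i < d) {y : R} (hy : y ∈ l) : Kill J y i M := by
  cases l with
  | nil => simp at hy
  | cons x l => exact h.2.1 i hi y hy

lemma Std.equiv {l : List R} : ∀ {d : ℕ} {M : Type u} [AddCommGroup M] [Module R M]
    {N : Type u} [AddCommGroup N] [Module R N] (_ : Std J l d M) (_ : M ≃ₗ[R] N), Std J l d N := by
  induction l with
  | nil => intros; trivial
  | cons x l ih =>
    intro d M _ _ N _ _ h e
    exact ⟨h.1.equiv e, fun i hi y hy => (h.2.1 i hi y hy).equiv e, ih h.2.2 (qequiv x e)⟩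

lemma Std.gam_inter {l : List R} : ∀ {d : ℕ} {M : Type u} [AddCommGroup M] [Module R M]
    (_ : Std J l d M) (_ : l.length ≤ d) {m : M} (_ : m ∈ Gam J M) (_ : prL l M m = 0), m = 0 := by
  induction l with
  | nil => intro d M _ _ _ _ m _ h; exact h
  | cons x l ih =>
    intro d M _ _ h hd m hm h0
    rw [List.length_cons] at hd
    have h1 := ih h.2.2 (by omega) (Gam_map J (pr x M) hm) h0
    obtain ⟨n, rfl⟩ := pr_eq_zero.1 h1
    exact kill_zero.1 (h.2.1 0 (by omega) x (by simp)) n (h.1.gam hm)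

variable {M : Type u} [AddCommGroup M] [Module R M]

lemma swap_FR1 [Module.Finite R M] (hJ : J ≤ Ideal.jacobson ⊥) {a b : R} {l : List R} {d : ℕ}
    (ha : a ∈ J) (h : Std J (a :: b :: l) d M)
    (hd : l.length + 2 ≤ d) : FR J b M := by
  obtain ⟨h1, h2, h3, h4, h5⟩ := h
  have hbG : ∀ p : M, a • (b • p) = 0 → b • p = 0 := by
    intro p hp
    refine Std.gam_inter (d := d) (l := a :: b :: l) ⟨h1, h2, h3, h4, h5⟩ (by simp only [List.length_cons]; omega)
      (h1 _ hp) (prL_smul_mem _ _ (by simp) _)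
  let K : Submodule R M := LinearMap.ker (mulx b M)
  have memK : ∀ m, m ∈ K ↔ b • m = 0 := fun m => Iff.rfl
  have hKa : ∀ m ∈ K, pr a M m ∈ Gam J (Qd a M) := fun m hm => h3 _ (by
    rw [← map_smul, (memK m).1 hm, map_zero])
  have ha2 : a * a = a ^ 2 := by ring
  have hK : K ≤ Gam J M ⊔ J • K := by
    intro m hm
    have hm2 : pr (a^2) M m ∈ Gam J (Qd (a^2) M) := by
      obtain ⟨k, hk⟩ := hKa m hm
      refine Gam_of_smul J k (fun r hr => ?_)
      have := hk r hr
      rw [← map_smul, pr_eq_zero] at this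
      obtain ⟨p, hp⟩ := this
      have hpK : p ∈ K := (memK p).2 (hbG p (by
        rw [smul_comm, hp, smul_comm, (memK m).1 hm, smul_zero]))
      rw [← map_smul, ← hp, ← qmul_pr a a (a^2) ha2]
      exact Gam_map J _ (hKa p hpK)
    obtain ⟨ξ, hξ⟩ := iota_surj J _ (hKa m hm)
    obtain ⟨ξ2, hξ2⟩ := iota_surj J _ hm2
    have e1 : hmap J 0 (qmul a a (a^2) ha2 M) ξ = a • ξ2 := by
      apply iota_inj J
      rw [iota_nat, hξ, map_smul, hξ2, qmul_pr, map_smul]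
    have e2 := dlt_mul ha2 h1 (h1.pow 2) 0 ξ
    rw [e1, map_smul, h2 1 (by omega) a (by simp)] at e2
    obtain ⟨ζ, rfl⟩ := dlt_ker h1 0 ξ e2.symm
    rw [iota_nat] at hξ
    obtain ⟨p, hp⟩ := pr_eq hξ.symm
    rw [hp]
    refine Submodule.add_mem_sup (iota_mem J ζ) (Submodule.smul_mem_smul ha ?_)
    apply (memK p).2
    apply hbG
    have h6 := (memK m).1 hm
    rw [hp, smul_add, kill_zero.1 (h2 0 (by omega) b (by simp)) _ (iota_mem J ζ), zero_add] at h6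
    rw [smul_comm, h6]
  have : IsNoetherian R M := inferInstance
  exact Submodule.le_of_le_smul_of_le_jacobson_bot (IsNoetherian.noetherian K) hJ hK

lemma swap_FR2 {a b : R} (h1 : FR J a M) (h2 : FR J b (Qd a M)) : FR J a (Qd b M) := by
  intro m hm
  obtain ⟨m, rfl⟩ := pr_surj b m
  rw [← map_smul, pr_eq_zero] at hm
  obtain ⟨n, hn⟩ := hm
  obtain ⟨k, hk⟩ := h2 (pr a M n) (by rw [← map_smul, hn, pr_smul_self])
  refine Gam_of_smul J k (fun r hr => ?_)
  have := hk r hr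
  rw [← map_smul, pr_eq_zero] at this
  obtain ⟨p, hp⟩ := this
  have h3 : r • m - b • p ∈ Gam J M := h1 _ (by
    rw [smul_sub, smul_comm a b, hp, smul_comm a r, ← hn, smul_comm r b, sub_self])
  have := Gam_map J (pr b M) h3
  rwa [map_sub, pr_smul_self, sub_zero, map_smul] at this

lemma Std.swap [Module.Finite R M] (hJ : J ≤ Ideal.jacobson ⊥) {a b : R} {l : List R} {d : ℕ}
    (ha : a ∈ J) (h : Std J (a :: b :: l) d M)
    (hd : l.length + 2 ≤ d) : Std J (b :: a :: l) d M := by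
  have hbM := swap_FR1 hJ ha h hd
  obtain ⟨h1, h2, h3, h4, h5⟩ := id h
  have haMb := swap_FR2 h1 h3
  have hak : ∀ i < d - 1, Kill J a i (Qd b M) := by
    intro i hi ξ
    obtain ⟨η, hη⟩ := dlt_ker hbM i (a • ξ) (by rw [map_smul, h2 (i+1) (by omega) a (by simp)])
    have e1 : hmap J i (pr a (Qd b M)) (a • ξ) = 0 := by
      have : a • pr a (Qd b M) = 0 := by
        ext m; simp [smul_Qd]
      rw [map_smul, ← hmap_smul, this, hmap_zero]
    rw [← hη, ← hmap_comp] at e1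
    have e2 : hmap J i (pr b (Qd a M) ∘ₗ pr a M) η = 0 := by
      apply (hmap_equiv_bij (qswap a b M) i).1
      rw [← hmap_comp, map_zero]
      exact e1
    rw [hmap_comp] at e2
    have e3 := hpr_inj h3 (h4 i hi b (by simp)) (e2.trans (map_zero _).symm)
    have e4 := hpr_inj h1 (h2 i (by omega) a (by simp)) (e3.trans (map_zero _).symm)
    rw [← hη, e4, map_zero]
  refine ⟨hbM, fun i hi y hy => h2 i hi y ?_, haMb, fun i hi y hy => ?_, h5.equiv (qswap a b M)⟩
  · simp only [List.mem_cons] at hy ⊢; tauto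
  rcases List.mem_cons.1 hy with rfl | hy
  · exact hak i hi
  rcases i with _ | i
  · rw [kill_zero]
    intro m hm
    have hm0 := kill_zero.1 (hak 0 hi) m hm
    obtain ⟨m, rfl⟩ := pr_surj b m
    rw [← map_smul, pr_eq_zero] at hm0
    obtain ⟨n, hn⟩ := hm0
    have hnG := h3 (pr a M n) (by rw [← map_smul, hn, pr_smul_self])
    have := kill_zero.1 (h4 0 hi y (by simp [hy])) _ hnG
    rw [← map_smul, pr_eq_zero] at this
    obtain ⟨p, hp⟩ := this
    have h6 : y • m - b • p ∈ Gam J M := h1 _ (by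
      rw [smul_sub, smul_comm a b, hp, smul_comm a y, ← hn, smul_comm y b, sub_self])
    have h7 := h.gam_inter (by simp only [List.length_cons]; omega) h6 (by
      rw [map_sub, prL_smul_mem _ _ (by simp [hy]), prL_smul_mem _ _ (by simp), sub_zero])
    rw [← map_smul, sub_eq_zero.1 h7, pr_smul_self]
  · intro ξ
    obtain ⟨ζ, rfl⟩ := dlt_surj haMb i ξ (hak _ hi ξ)
    have := (h5.equiv (qswap a b M)).kill (i := i) (by omega) hy
    rw [← map_smul, this, map_zero]

lemma Std.drop (hJ : J ≤ Ideal.jacobson ⊥) {a : R} (ha : a ∈ J) : ∀ {l : List R} {d : ℕ}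
    {M : Type u} [AddCommGroup M] [Module R M] [Module.Finite R M]
    (_ : ∀ y ∈ l, y ∈ J) (_ : Std J (a :: l) d M)
    (_ : l.length + 1 ≤ d), Std J l d M ∧ FR J a (QL l M) := by
  intro l
  induction l with
  | nil => intro d M _ _ _ _ h _; exact ⟨trivial, h.1⟩
  | cons b l ih =>
    intro d M _ _ _ hl h hd
    rw [List.length_cons] at hd
    have h1 := h.swap hJ ha (by omega)
    have h2 := ih (fun y hy => hl y (by simp [hy])) h1.2.2 (by omega)
    exact ⟨⟨h1.1, fun i hi y hy => h.2.1 i hi y (by simp at hy ⊢; tauto), h2.1⟩, h2.2⟩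

lemma pow_FR {x b : R} (hx : FR J x M) (hb : FR J b (Qd x M)) (n : ℕ) : FR J b (Qd (x ^ n) M) := by
  induction n with
  | zero =>
    intro m _
    have : m = 0 := by simpa using smul_Qd (x ^ 0) m
    rw [this]; exact zero_mem _
  | succ n ih =>
    intro m hm
    obtain ⟨m, rfl⟩ := pr_surj _ m
    rw [← map_smul, pr_eq_zero] at hm
    obtain ⟨p', hp'⟩ := hm
    obtain ⟨k, hk⟩ := hb (pr x M m) (by
      rw [← map_smul, ← hp', pow_succ', mul_smul, pr_smul_self])
    refine Gam_of_smul J k (fun r hr => ?_)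
    have := hk r hr
    rw [← map_smul, pr_eq_zero] at this
    obtain ⟨q, hq⟩ := this
    have h3 : b • q - x ^ n • (r • p') ∈ Gam J M := hx _ (by
      rw [smul_sub, smul_comm x b, hq, smul_comm b r, ← hp', ← mul_smul x, ← pow_succ',
        smul_comm r, sub_self])
    have h4 := Gam_map J (pr (x ^ n) M) h3
    rw [map_sub, pr_smul_self, sub_zero, map_smul] at h4
    have h5 := ih.gam h4
    rw [← map_smul, ← hq, ← qmul_pr (x ^ n) x (x ^ (n+1)) (by ring)]
    exact Gam_map J _ h5

lemma pow_kill {x y : R} {n i : ℕ} (hx : FR J x M) (hk : Kill J x (i+1) M) (h1 : Kill J y i M)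
    (h2 : Kill J y i (Qd x M)) : Kill J y i (Qd (x ^ (n+1)) M) := by
  intro ζ
  obtain ⟨ζ', hζ'⟩ := dlt_surj hx i (dlt J (x ^ (n+1)) i M ζ) (hk _)
  have e : x ^ n * x = x ^ (n+1) := by ring
  have h3 := dlt_mul e hx (hx.pow (n+1)) i ζ'
  obtain ⟨η, hη⟩ := dlt_ker (hx.pow (n+1)) i (ζ - hmap J i (qmul x (x^n) (x^(n+1)) e M) ζ') (by
    rw [map_sub, h3, hζ', sub_self])
  have : ζ = hmap J i (pr (x^(n+1)) M) η + hmap J i (qmul x (x^n) (x^(n+1)) e M) ζ' := by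
    rw [hη]; abel
  rw [this, smul_add, ← map_smul, ← map_smul, h1, h2, map_zero, map_zero, add_zero]

lemma Std.pow (hJ : J ≤ Ideal.jacobson ⊥) {x : R} (ha : x ∈ J) (n : ℕ) : ∀ {l : List R} {d : ℕ}
    {M : Type u} [AddCommGroup M] [Module R M] [Module.Finite R M]
    (_ : Std J (x :: l) d M)
    (_ : l.length + 1 ≤ d), Std J l (d - 1) (Qd (x ^ (n+1)) M) := by
  intro l
  induction l with
  | nil => intros; trivial
  | cons b l ih =>
    intro d M _ _ _ h hd
    rw [List.length_cons] at hd
    have h1 := h.swap hJ ha (by omega)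
    have h2 := ih h1.2.2 (by omega)
    refine ⟨pow_FR h.1 h.2.2.1 _, fun i hi y hy => ?_, h2.equiv (qswap b _ M)⟩
    exact pow_kill h.1 (h.2.1 (i+1) (by omega) x (by simp))
      (h.2.1 i (by omega) y (List.mem_cons_of_mem _ hy)) (h.2.2.2.1 i hi y hy)

end Stdsec
end LC

namespace LC

section Dsec
variable {R : Type u} [CommRing R] [IsNoetherianRing R]

/-- The iterated connecting map. -/
noncomputable def D (J : Ideal R) : ∀ (l : List R) (M : Type u) [AddCommGroup M] [Module R M],
    lcoh J 0 (QL l M) →ₗ[R] lcoh J l.length M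
  | [], _, _, _ => LinearMap.id
  | x :: l, M, _, _ => dlt J x l.length M ∘ₗ D J l (Qd x M)

variable {J : Ideal R}

lemma D_cons (x : R) (l : List R) {M : Type u} [AddCommGroup M] [Module R M]
    (ξ : lcoh J 0 (QL l (Qd x M))) :
    D J (x :: l) M ξ = dlt J x l.length M (D J l (Qd x M) ξ) := rfl

lemma D_nat (l : List R) : ∀ {d d' : ℕ} {M : Type u} [AddCommGroup M] [Module R M]
    {N : Type u} [AddCommGroup N] [Module R N] (_ : Std J l d M) (_ : Std J l d' N)
    (φ : M →ₗ[R] N) (ξ : lcoh J 0 (QL l M)),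
    D J l N (hmap J 0 (QLmap l φ) ξ) = hmap J l.length φ (D J l M ξ) := by
  induction l with
  | nil => intros; rfl
  | cons x l ih =>
    intro d d' M _ _ N _ _ h h' φ ξ
    have := ih h.2.2 h'.2.2 (qmap x φ) ξ
    refine (congrArg (dlt J x l.length N) this).trans ?_
    exact dlt_nat h.1 h'.1 φ l.length _

lemma D_surj (l : List R) : ∀ {d : ℕ} {M : Type u} [AddCommGroup M] [Module R M]
    (_ : Std J l d M) (_ : l.length + 1 ≤ d), Function.Surjective (D J l M) := by
  induction l with
  | nil => intro d M _ _ _ _ ξ; exact ⟨ξ, rfl⟩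
  | cons x l ih =>
    intro d M _ _ h hd η
    rw [List.length_cons] at hd
    obtain ⟨ζ, rfl⟩ := dlt_surj h.1 l.length η (h.2.1 (l.length + 1) (by omega) x (by simp) η)
    obtain ⟨ξ, rfl⟩ := ih h.2.2 (by omega) ζ
    exact ⟨ξ, rfl⟩

lemma length_ker_comp {A B C : Type*} [AddCommGroup A] [Module R A] [AddCommGroup B] [Module R B]
    [AddCommGroup C] [Module R C] (f : A →ₗ[R] B) (g : B →ₗ[R] C)
    (h : LinearMap.ker g ≤ LinearMap.range f) :
    Module.length R (LinearMap.ker (g ∘ₗ f)) =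
      Module.length R (LinearMap.ker f) + Module.length R (LinearMap.ker g) := by
  have hle : LinearMap.ker f ≤ LinearMap.ker (g ∘ₗ f) := LinearMap.ker_le_ker_comp f g
  refine Module.length_eq_add_of_exact (Submodule.inclusion hle)
    (f.restrict (p := LinearMap.ker (g ∘ₗ f)) (q := LinearMap.ker g) (fun x hx => hx))
    (Submodule.inclusion_injective hle) ?_ ?_
  · rintro ⟨b, hb⟩
    obtain ⟨a, rfl⟩ := h hb
    exact ⟨⟨a, hb⟩, rfl⟩
  · rintro ⟨a, ha⟩
    constructor
    · intro h0
      exact ⟨⟨a, congrArg Subtype.val h0⟩, rfl⟩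
    · rintro ⟨⟨b, hb⟩, h0⟩
      have : b = a := congrArg Subtype.val h0
      subst this
      exact Subtype.ext hb

lemma length_ker_dlt {M : Type u} [AddCommGroup M] [Module R M] {x : R} {i : ℕ} (h : FR J x M)
    (hk : Kill J x i M) :
    Module.length R (LinearMap.ker (dlt J x i M)) = Module.length R (lcoh J i M) := by
  have e : LinearMap.ker (dlt J x i M) = LinearMap.range (hmap J i (pr x M)) := by
    ext ξ
    constructor
    · intro h0; exact dlt_ker h i ξ h0
    · rintro ⟨ζ, rfl⟩; exact dlt_hmap h i ζ
  rw [e]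
  exact (LinearEquiv.ofInjective _ (hpr_inj h hk)).length_eq.symm

lemma length_lcoh_Qd {M : Type u} [AddCommGroup M] [Module R M] {x : R} {i : ℕ} (h : FR J x M)
    (hk : Kill J x i M) (hk' : Kill J x (i+1) M) :
    Module.length R (lcoh J i (Qd x M)) =
      Module.length R (lcoh J i M) + Module.length R (lcoh J (i+1) M) := by
  refine Module.length_eq_add_of_exact (hmap J i (pr x M)) (dlt J x i M) (hpr_inj h hk) ?_ ?_
  · intro η; exact dlt_surj h i η (hk' η)
  · intro ξ
    constructor
    · intro h0; exact dlt_ker h i ξ h0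
    · rintro ⟨ζ, rfl⟩; exact dlt_hmap h i ζ

lemma pascal_sum (a : ℕ → ℕ∞) (s : ℕ) :
    ∑ i ∈ Finset.range s, (s.choose i) • (a i + a (i+1)) + a s =
      ∑ i ∈ Finset.range (s+1), ((s+1).choose i) • a i := by
  rw [Finset.sum_range_succ' _ s]
  simp only [Nat.choose_succ_succ, smul_add, add_smul, Finset.sum_add_distrib]
  have h1 : ∑ i ∈ Finset.range s, s.choose i • a i + a s =
      ∑ i ∈ Finset.range s, s.choose (i+1) • a (i+1) + (1 : ℕ) • a 0 := by
    have h2 := Finset.sum_range_succ (fun i => s.choose i • a i) s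
    have h3 := Finset.sum_range_succ' (fun i => s.choose i • a i) s
    simp only [Nat.choose_self, Nat.choose_zero_right, one_smul] at h2 h3 ⊢
    rw [← h2, h3]
  rw [Nat.choose_zero_right]
  simp only [Nat.succ_eq_add_one]
  rw [add_assoc (∑ i ∈ Finset.range s, s.choose i • a (i + 1)), ← h1]
  abel

lemma length_ker_D (hJ : J ≤ Ideal.jacobson ⊥) (l : List R) : ∀ {d : ℕ}
    {M : Type u} [AddCommGroup M] [Module R M] [Module.Finite R M]
    (_ : ∀ y ∈ l, y ∈ J) (_ : Std J l d M) (_ : l.length ≤ d),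
    Module.length R (LinearMap.ker (D J l M)) =
      ∑ i ∈ Finset.range l.length, (l.length.choose i) • Module.length R (lcoh J i M) := by
  induction l with
  | nil =>
    intro d M _ _ _ _ _ _
    simp only [List.length_nil, Finset.range_zero, Finset.sum_empty]
    rw [Module.length_eq_zero_iff, Submodule.subsingleton_iff_eq_bot]
    exact LinearMap.ker_id
  | cons x l ih =>
    intro d M _ _ _ hl h hd
    rw [List.length_cons] at hd
    have hx : x ∈ J := hl x (by simp)
    have hl' : ∀ y ∈ l, y ∈ J := fun y hy => hl y (by simp [hy])
    have h2 := (Std.drop hJ hx hl' h hd).1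
    have h1 := ih hl' h.2.2 (by omega)
    have h3 : Module.length R (LinearMap.ker (D J (x :: l) M)) =
        Module.length R (LinearMap.ker (D J l (Qd x M))) +
          Module.length R (LinearMap.ker (dlt J x l.length M)) := by
      refine length_ker_comp (D J l (Qd x M)) (dlt J x l.length M) ?_
      intro ξ hξ
      obtain ⟨η, rfl⟩ := dlt_ker h.1 _ ξ hξ
      obtain ⟨ζ, rfl⟩ := D_surj l h2 (by omega) η
      exact ⟨_, D_nat l h2 h.2.2 (pr x M) ζ⟩
    rw [h3, h1, length_ker_dlt h.1 (h.2.1 _ (by omega) x (by simp)), List.length_cons,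
      ← pascal_sum]
    congr 1
    refine Finset.sum_congr rfl fun i hi => ?_
    rw [Finset.mem_range] at hi
    rw [length_lcoh_Qd h.1 (h.2.1 _ (by omega) x (by simp)) (h.2.1 _ (by omega) x (by simp))]

end Dsec

section Limsec
variable {R : Type u} [CommRing R]

/-- `m` lies in the `n`-th piece of the limit closure. -/
def LimN (n : ℕ) : ∀ (_ : List R) {M : Type u} [AddCommGroup M] [Module R M] (_ : M), Prop
  | [], _, _, _, m => m = 0
  | x :: l, M, _, _, m => LimN n l (pr (x ^ (n+1)) M (x ^ n • m))

lemma LimN_nat (n : ℕ) (l : List R) : ∀ {M : Type u} [AddCommGroup M] [Module R M]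
    {N : Type u} [AddCommGroup N] [Module R N] (φ : M →ₗ[R] N) (m : M) (_ : LimN n l m),
    LimN n l (φ m) := by
  induction l with
  | nil => intro M _ _ N _ _ φ m h; change m = 0 at h; rw [h, map_zero]; rfl
  | cons x l ih =>
    intro M _ _ N _ _ φ m h
    have := ih (qmap (x ^ (n+1)) φ) _ h
    rw [qmap_pr, map_smul] at this
    exact this

lemma LimN_iff (n : ℕ) (l : List R) : ∀ {M : Type u} [AddCommGroup M] [Module R M] (m : M),
    LimN n l m ↔ prL (l.map (· ^ (n+1))) M ((l.map (· ^ n)).prod • m) = 0 := by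
  induction l with
  | nil => intro M _ _ m; simp only [List.map_nil, List.prod_nil, one_smul]; exact Iff.rfl
  | cons x l ih =>
    intro M _ _ m
    refine (ih (pr (x ^ (n+1)) M (x ^ n • m))).trans ?_
    rw [List.map_cons, List.map_cons, List.prod_cons, mul_comm, mul_smul, ← map_smul]
    exact Iff.rfl

variable [IsNoetherianRing R] {J : Ideal R}

lemma lim_iff (hJ : J ≤ Ideal.jacobson ⊥) (l : List R) : ∀ {d : ℕ}
    {M : Type u} [AddCommGroup M] [Module R M] [Module.Finite R M]
    (_ : ∀ y ∈ l, y ∈ J) (_ : Std J l d M) (_ : l.length ≤ d) (m : M),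
    (∃ n, LimN (n+1) l m) ↔ ∃ ξ, iota J ξ = prL l M m ∧ D J l M ξ = 0 := by
  induction l with
  | nil =>
    intro d M _ _ _ _ _ _ m
    constructor
    · rintro ⟨n, hn⟩
      change m = 0 at hn
      exact ⟨0, by rw [hn, map_zero, map_zero], map_zero _⟩
    · rintro ⟨ξ, h1, h2⟩
      refine ⟨0, ?_⟩
      change ξ = 0 at h2
      rw [h2, map_zero] at h1
      exact h1.symm
  | cons x l ih =>
    intro d M _ _ _ hl h hd m
    rw [List.length_cons] at hd
    have hx : x ∈ J := hl x (by simp)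
    have hl' : ∀ y ∈ l, y ∈ J := fun y hy => hl y (by simp [hy])
    have hdr := Std.drop hJ hx hl' h hd
    constructor
    · rintro ⟨n, hn⟩
      have hp := Std.pow hJ hx (n+1) h hd
      obtain ⟨ξ', h1, h2⟩ := (ih hl' hp (by omega) _).1 ⟨n, hn⟩
      have e : x ^ (n+1) * x = x ^ (n+1+1) := by ring
      have hy : prL l (Qd x M) (pr x M m) ∈ Gam J (QL l (Qd x M)) := by
        obtain ⟨k, hk⟩ := iota_mem J ξ'
        refine Gam_of_smul J k (fun r hr => ?_)
        have h3 := hk r hr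
        rw [h1, ← map_smul, ← map_smul] at h3
        have h4 : r • x ^ (n+1) • m ∈ (Ideal.ofList (x ^ (n+1+1) :: l) • ⊤ : Submodule R M) :=
          (prL_ker (x ^ (n+1+1) :: l) _).1 h3
        rw [Ideal.ofList_cons_smul] at h4
        obtain ⟨a, ⟨q, -, ha⟩, b, hb, hab⟩ := Submodule.mem_sup.1 h4
        change x ^ (n+1+1) • q = a at ha
        have h5 := (prL_ker l b).2 hb
        have hb' : b = x ^ (n+1) • (r • m - x • q) := by
          rw [smul_sub, smul_comm _ r, ← hab, ← ha, ← mul_smul, e]; abel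
        rw [hb', map_smul] at h5
        have h6 := Gam_map J (QLmap l (pr x M)) (hdr.2.pow (n+1) _ h5)
        rw [QLmap_prL, map_sub, pr_smul_self, sub_zero, map_smul, map_smul] at h6
        exact h6
      obtain ⟨ξ, hξ⟩ := iota_surj J _ hy
      refine ⟨ξ, hξ, ?_⟩
      have h3 : hmap J 0 (QLmap l (qmul x (x ^ (n+1)) (x ^ (n+1+1)) e M)) ξ = ξ' := by
        apply iota_inj J
        rw [iota_nat, hξ, h1, QLmap_prL, qmul_pr]
      rw [D_cons, ← dlt_mul e h.1 (h.1.pow _), ← D_nat l h.2.2 hp, h3, h2, map_zero]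
    · rintro ⟨ξ, h1, h2⟩
      change lcoh J 0 (QL l (Qd x M)) at ξ
      replace h1 : iota J ξ = prL l (Qd x M) (pr x M m) := h1
      replace h2 : dlt J x l.length M (D J l (Qd x M) ξ) = 0 := h2
      obtain ⟨η, hη⟩ := dlt_ker h.1 _ _ h2
      have hp := Std.pow hJ hx 1 h hd
      have e : x * x = x ^ (1+1) := by ring
      obtain ⟨n, hn⟩ := (ih hl' hp (by omega) (pr (x ^ (1+1)) M (x • m))).2
        ⟨hmap J 0 (QLmap l (qmul x x (x ^ (1+1)) e M)) ξ, by
          rw [iota_nat, h1, QLmap_prL, qmul_pr], by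
          rw [D_nat l h.2.2 hp, ← hη, ← hmap_comp]
          have : qmul x x (x ^ (1+1)) e M ∘ₗ pr x M = x • pr (x ^ (1+1)) M := by
            ext m; simp [qmul_pr]
          rw [this, hmap_smul, ← map_smul, h.2.1 _ (by omega) x (by simp), map_zero]⟩
      refine ⟨n, ?_⟩
      have := LimN_nat _ l (qmul (x ^ (1+1)) (x ^ n) (x ^ (n+1+1)) (by ring) M) _ hn
      rw [qmul_pr, ← mul_smul, ← pow_succ] at this
      exact this

end Limsec
end LC

namespace LC
section Final
variable {R : Type u} [CommRing R]

lemma length_main [IsNoetherianRing R] {J : Ideal R} (hJ : J ≤ Ideal.jacobson ⊥) (l : List R)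
    {d : ℕ} {M : Type u} [AddCommGroup M] [Module R M] [Module.Finite R M]
    (hl : ∀ y ∈ l, y ∈ J) (h : Std J l d M) (hd : l.length ≤ d) (L : Submodule R M)
    (hL : ∀ m, m ∈ L ↔ ∃ n, LimN (n+1) l m) :
    Module.length R (L ⧸ (Ideal.ofList l • (⊤ : Submodule R M)).comap L.subtype) =
      ∑ i ∈ Finset.range l.length, (l.length.choose i) • Module.length R (lcoh J i M) := by
  rw [← length_ker_D hJ l hl h hd]
  have e1 : (Ideal.ofList l • (⊤ : Submodule R M)).comap L.subtype =
      LinearMap.ker (prL l M ∘ₗ L.subtype) := by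
    ext m
    exact (prL_ker l (m : M)).symm
  have e2 : LinearMap.range (prL l M ∘ₗ L.subtype) =
      Submodule.map (iota J) (LinearMap.ker (D J l M)) := by
    ext q
    constructor
    · rintro ⟨m, rfl⟩
      obtain ⟨ξ, h1, h2⟩ := (lim_iff hJ l hl h hd (m : M)).1 ((hL m).1 m.2)
      exact ⟨ξ, h2, h1⟩
    · rintro ⟨ξ, h2, rfl⟩
      obtain ⟨m, hm⟩ := prL_surj l M (iota J ξ)
      exact ⟨⟨m, (hL m).2 ((lim_iff hJ l hl h hd m).2 ⟨ξ, hm.symm, h2⟩)⟩, hm⟩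
  rw [e1, (LinearMap.quotKerEquivRange _).length_eq, e2]
  exact (Submodule.equivMapOfInjective _ (iota_inj J) _).length_eq.symm

lemma mem_limitClosure {s : ℕ} (x : Fin s → R) (M : Type u) [AddCommGroup M] [Module R M] (m : M) :
    m ∈ limitClosure x M ↔ ∃ n, LimN (n+1) (List.ofFn x) m := by
  unfold limitClosure
  rw [Submodule.mem_iSup_of_directed]
  · refine exists_congr fun n => ?_
    rw [LimN_iff, prL_ker, Submodule.mem_comap]
    simp only [List.map_ofFn, List.prod_ofFn, Function.comp_def, Finset.prod_pow,
      LinearMap.smul_apply, LinearMap.id_apply, Ideal.ofList, List.mem_ofFn]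
    exact Iff.rfl
  · apply Monotone.directed_le
    refine monotone_nat_of_le_succ fun n => ?_
    intro m hm
    rw [Submodule.mem_comap] at hm ⊢
    simp only [LinearMap.smul_apply, LinearMap.id_apply] at hm ⊢
    rw [pow_succ', mul_smul]
    have h1 : (∏ i, x i) • (∏ i, x i) ^ (n + 1) • m ∈ Ideal.span {∏ i, x i} •
        (Ideal.span (Set.range fun i => x i ^ (n + 2)) • (⊤ : Submodule R M)) :=
      Submodule.smul_mem_smul (Ideal.mem_span_singleton_self _) hm
    rw [← Submodule.mul_smul] at h1
    refine Submodule.smul_mono_left ?_ h1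
    rw [Ideal.span_singleton_mul_le_iff]
    intro z hz
    induction hz using Submodule.span_induction with
    | mem z hz =>
      obtain ⟨i, rfl⟩ := hz
      obtain ⟨c, hc⟩ := Finset.dvd_prod_of_mem x (Finset.mem_univ i)
      have : (∏ i, x i) * x i ^ (n + 2) = c * x i ^ (n + 1 + 2) := by rw [hc]; ring
      change (∏ i, x i) * x i ^ (n + 2) ∈ _
      rw [this]
      exact Ideal.mul_mem_left _ _ (Ideal.subset_span ⟨i, rfl⟩)
    | zero => rw [mul_zero]; exact zero_mem _
    | add a b _ _ ha hb => rw [mul_add]; exact add_mem ha hb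
    | smul r a _ ha =>
      rw [smul_eq_mul, mul_left_comm]; exact Ideal.mul_mem_left _ _ ha

lemma quot_equiv (I : Ideal R) (y : R) (M : Type u) [AddCommGroup M] [Module R M] :
    Nonempty ((M ⧸ ((I ⊔ Ideal.span {y}) • ⊤ : Submodule R M)) ≃ₗ[R]
      Qd y (M ⧸ (I • ⊤ : Submodule R M))) := by
  let f : M →ₗ[R] Qd y (M ⧸ (I • ⊤ : Submodule R M)) := pr y _ ∘ₗ Submodule.mkQ _
  have hs : Function.Surjective f := (pr_surj y).comp (Submodule.mkQ_surjective _)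
  have hk : ((I ⊔ Ideal.span {y}) • ⊤ : Submodule R M) = LinearMap.ker f := by
    rw [Submodule.sup_smul]
    apply le_antisymm
    · refine sup_le ?_ ?_
      · intro m hm
        change pr y _ (Submodule.mkQ _ m) = 0
        rw [show Submodule.mkQ (I • ⊤ : Submodule R M) m = 0 by simpa using hm, map_zero]
      · rw [Submodule.ideal_span_singleton_smul]
        rintro _ ⟨m, -, rfl⟩
        change pr y _ (Submodule.mkQ _ (y • m)) = 0
        rw [map_smul, pr_smul_self]
    · intro m hm
      change pr y _ (Submodule.mkQ _ m) = 0 at hm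
      obtain ⟨n, hn⟩ := pr_eq_zero.1 hm
      obtain ⟨n, rfl⟩ := Submodule.mkQ_surjective _ n
      rw [← map_smul, eq_comm, ← sub_eq_zero, ← map_sub] at hn
      have h1 : m - y • n ∈ (I • ⊤ : Submodule R M) :=
        (Submodule.Quotient.mk_eq_zero _).1 hn
      have : m = (m - y • n) + y • n := by abel
      rw [this]
      exact Submodule.add_mem_sup h1
        (Submodule.smul_mem_smul (Ideal.mem_span_singleton_self y) trivial)
  exact ⟨(Submodule.quotEquivOfEq _ _ hk).trans (f.quotKerEquivOfSurjective hs)⟩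

lemma std_bridge [IsNoetherianRing R] {J : Ideal R} {M : Type u} [AddCommGroup M] [Module R M]
    {t : ℕ} (x : Fin t → R) (h : IsStandardSeq J M x) {s : ℕ} (hs : s ≤ t) (k : ℕ) :
    ∀ j, j + k = s → Std J ((List.ofFn fun i : Fin s => x (Fin.castLE hs i)).drop j) k
      (M ⧸ (Ideal.span (x '' {l | (l : ℕ) < j}) • ⊤ : Submodule R M)) := by
  induction k with
  | zero =>
    intro j hj
    rw [List.drop_of_length_le (by simp; omega)]
    trivial
  | succ k ih =>
    intro j hj
    have hjs : j < s := by omega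
    rw [List.drop_eq_getElem_cons (by simpa using hjs)]
    have hy : (List.ofFn fun i : Fin s => x (Fin.castLE hs i))[j]'(by simpa using hjs) =
      x ⟨j, by omega⟩ := by simp
    rw [hy]
    have hset : {l : Fin t | (l : ℕ) < j} = {l : Fin t | l < ⟨j, by omega⟩} := by
      ext l; simp [Fin.lt_def]
    refine ⟨?_, ?_, ?_⟩
    · intro m hm
      obtain ⟨m, rfl⟩ := Submodule.mkQ_surjective _ m
      rw [← map_smul, Submodule.mkQ_apply, Submodule.Quotient.mk_eq_zero, hset] at hm
      obtain ⟨n, hn⟩ := h.1 _ m hm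
      refine ⟨n, fun r hr => ?_⟩
      rw [← map_smul, Submodule.mkQ_apply, Submodule.Quotient.mk_eq_zero, hset]
      exact hn r hr
    · intro i hi y hy' ξ
      refine h.2 i j (by omega) ξ y (Ideal.subset_span ?_)
      rcases List.mem_cons.1 hy' with rfl | hy'
      · exact ⟨_, rfl⟩
      · have := List.mem_of_mem_drop hy'
        rw [List.mem_ofFn] at this
        obtain ⟨i, rfl⟩ := this
        exact ⟨_, rfl⟩
    · have h1 := ih (j+1) (by omega)
      have e : Ideal.span (x '' {l | (l : ℕ) < j + 1}) =
          Ideal.span (x '' {l | (l : ℕ) < j}) ⊔ Ideal.span {x ⟨j, by omega⟩} := by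
        rw [← Ideal.span_union, ← Set.image_singleton, ← Set.image_union]
        congr 2
        ext l
        simp only [Set.mem_ofPred_eq, Set.union_singleton, Set.mem_insert_iff, Fin.ext_iff]
        omega
      rw [e] at h1
      obtain ⟨e'⟩ := quot_equiv (Ideal.span (x '' {l | (l : ℕ) < j})) (x ⟨j, by omega⟩) M
      exact h1.equiv e'

/-- `M / 0 = M`. -/
noncomputable def quotZero {t : ℕ} (x : Fin t → R) (M : Type u) [AddCommGroup M] [Module R M] :
    (M ⧸ (Ideal.span (x '' {l | (l : ℕ) < 0}) • ⊤ : Submodule R M)) ≃ₗ[R] M :=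
  Submodule.quotEquivOfEqBot _ (by simp)

lemma moduleLength_eq (N : Type u) [AddCommGroup N] [Module R N] :
    moduleLength R N = ((Module.length R N : ℕ∞) : WithBot ℕ∞) := (Module.coe_length R N).symm

lemma coe_sum_nsmul (s : ℕ) (c : ℕ → ℕ) (a : ℕ → ℕ∞) :
    ((∑ i ∈ Finset.range s, c i • a i : ℕ∞) : WithBot ℕ∞) =
      ∑ i ∈ Finset.range s, c i • (a i : WithBot ℕ∞) := by
  have := map_sum (WithBot.addHom : ℕ∞ →+ WithBot ℕ∞) (fun i => c i • a i) (Finset.range s)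
  refine this.trans ?_
  refine Finset.sum_congr rfl fun i _ => ?_
  exact map_nsmul (WithBot.addHom : ℕ∞ →+ WithBot ℕ∞) _ _

end Final
end LC

/-- for a standard sequence `x_1,…,x_t` on `M` and every `s ≤ t`,
`ℓ((x_1,…,x_s)^{lim}_M / (x_1,…,x_s)M) = Σ_{i=0}^{s-1} C(s,i) ⬝ ℓ(H^i_𝔪(M))`. -/
theorem length_limitClosure_quotient
    {R : Type u} [CommRing R] [IsNoetherianRing R] [IsLocalRing R]
    (M : Type u) [AddCommGroup M] [Module R M] [Module.Finite R M]
    (t n₀ : ℕ)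
    (ht : sInf {i | ¬ Module.Finite R (lcoh (maximalIdeal R) i M)} = t) (ht0 : 0 < t)
    (hn₀ : 1 ≤ n₀)
    (hann : ∀ i < t, ∀ (a : lcoh (maximalIdeal R) i M),
      ∀ r ∈ maximalIdeal R ^ n₀, r • a = 0)
    (x : Fin t → R) (hst : IsStandardSeq (maximalIdeal R) M x) :
    ∀ s : ℕ, ∀ hs : s ≤ t,
      moduleLength R
          (↥(limitClosure (fun i : Fin s => x (Fin.castLE hs i)) M) ⧸
            ((Ideal.span (Set.range fun i : Fin s => x (Fin.castLE hs i))
                • (⊤ : Submodule R M)).comap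
              (limitClosure (fun i : Fin s => x (Fin.castLE hs i)) M).subtype))
        = ∑ i ∈ Finset.range s, (s.choose i) • moduleLength R (lcoh (maximalIdeal R) i M) := by
  intro s hs
  simp only [LC.moduleLength_eq]
  rw [← LC.coe_sum_nsmul]
  congr 1
  by_cases hu : ∀ i : Fin s, x (Fin.castLE hs i) ∈ maximalIdeal R
  · have h1 := (LC.std_bridge x hst hs s 0 (by omega)).equiv (LC.quotZero x M)
    rw [List.drop_zero] at h1
    have h2 := LC.length_main (IsLocalRing.maximalIdeal_le_jacobson _) _ (by
      intro y hy
      rw [List.mem_ofFn] at hy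
      obtain ⟨i, rfl⟩ := hy
      exact hu i) h1 (by simp) (limitClosure (fun i : Fin s => x (Fin.castLE hs i)) M)
      (LC.mem_limitClosure _ M)
    simp only [List.length_ofFn] at h2
    rw [← h2]
    have : Ideal.ofList (List.ofFn fun i : Fin s => x (Fin.castLE hs i)) =
        Ideal.span (Set.range fun i : Fin s => x (Fin.castLE hs i)) := by
      simp only [Ideal.ofList, List.mem_ofFn]
      rfl
    rw [this]
  · push Not at hu
    obtain ⟨k, hk⟩ := hu
    have hunit : IsUnit (x (Fin.castLE hs k)) := by
      by_contra h
      exact hk ((mem_maximalIdeal _).2 h)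
    have htop : Ideal.span (Set.range fun i : Fin s => x (Fin.castLE hs i)) = ⊤ :=
      Ideal.eq_top_of_isUnit_mem _ (Ideal.subset_span ⟨k, rfl⟩) hunit
    rw [Finset.sum_eq_zero]
    · rw [Module.length_eq_zero_iff, Submodule.Quotient.subsingleton_iff, htop, Submodule.top_smul,
        Submodule.comap_top]
    · intro i hi
      rw [Finset.mem_range] at hi
      have hkill : LC.Kill (maximalIdeal R) (x (Fin.castLE hs k)) i
          (M ⧸ (Ideal.span (x '' {l | (l : ℕ) < 0}) • ⊤ : Submodule R M)) :=
        fun ξ => hst.2 i 0 (by omega) ξ _ (Ideal.subset_span ⟨_, rfl⟩)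
      have hkill' := hkill.equiv (LC.quotZero x M)
      have : Subsingleton (lcoh (maximalIdeal R) i M) :=
        subsingleton_of_forall_eq 0 fun ξ => (hunit.smul_eq_zero).1 (hkill' ξ)
      rw [Module.length_eq_zero, smul_zero]
end
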